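/- Fix constants p ≤ 1 − 1/e² with p > 0 and ε > 0, and let [s_n, t_n] be a sequence of intervals such that P(χ(G_{n,p}) ∈ [s_n, t_n]) ≥ 0.9 for every n. Then for every δ > 0 there is n₀ such that for every n ≥ n₀ with μ_{α(n)}(n) < n^{1−ε}, there exists an integer n* with |n*/n − 1| ≤ δ and t_{n*} − s_{n*} > C · √(μ_{α(n*)}(n*)) / log n*, where C = C(p,ε) = ε·log b / 9. -/

import Mathlib

open Filter Real

/-- Number of edges of a graph on `Fin n`. -/
noncomputable def edgeCount {n : ℕ} (G : SimpleGraph (Fin n)) : ℕ := G.edgeSet.ncard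

/-- The probability that the binomial random graph `G_{n,p}` equals `G`. -/
noncomputable def gnpWeight (n : ℕ) (p : ℝ) (G : SimpleGraph (Fin n)) : ℝ :=
  p ^ edgeCount G * (1 - p) ^ (n.choose 2 - edgeCount G)

open scoped Classical in
/-- The probability that `G_{n,p}` lies in the set `A` of graphs. -/
noncomputable def gnpProb (n : ℕ) (p : ℝ) (A : Set (SimpleGraph (Fin n))) : ℝ :=
  ∑ G : SimpleGraph (Fin n), if G ∈ A then gnpWeight n p G else 0

/-- The chromatic number, as a natural number. -/
noncomputable def chrom {n : ℕ} (G : SimpleGraph (Fin n)) : ℕ := G.chromaticNumber.toNat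

/-- `α₀(n) = 2 log_b n − 2 log_b log_b n + 2 log_b (e/2) + 1`. -/
noncomputable def alpha0 (b : ℝ) (x : ℝ) : ℝ :=
  2 * Real.logb b x - 2 * Real.logb b (Real.logb b x) + 2 * Real.logb b (Real.exp 1 / 2) + 1

/-- `α(n) = ⌊α₀(n)⌋`, as a natural number. -/
noncomputable def alphaNat (b : ℝ) (x : ℝ) : ℕ := (⌊alpha0 b x⌋).toNat

/-- `μ_t(n) = C(n,t) q^C(t,2)`, the expected number of independent `t`-sets in `G_{n,p}`,
where `q = 1 - p`. -/
noncomputable def muNat (n t : ℕ) (q : ℝ) : ℝ := (n.choose t : ℝ) * q ^ t.choose 2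

/-- `μ_{α(n)}(n)` for `G_{n,p}`, with `b = 1/(1-p)`. -/
noncomputable def muAlpha (p : ℝ) (n : ℕ) : ℝ :=
  muNat n (alphaNat (1 / (1 - p)) n) (1 - p)

section Auxiliary

open Finset

section Bernoulli

variable {β γ : Type*} [DecidableEq β] [DecidableEq γ]

/-- Expectation of `φ` over a random subset of `E` containing each element independently with
probability `p`. -/
noncomputable def ev (p : ℝ) (E : Finset β) (φ : Finset β → ℝ) : ℝ :=
  ∑ A ∈ E.powerset, p ^ #A * (1 - p) ^ #(E \ A) * φ A

lemma ev_empty (p : ℝ) (φ : Finset β → ℝ) : ev p ∅ φ = φ ∅ := by simp [ev]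

lemma ev_insert (p : ℝ) {E : Finset β} {a : β} (ha : a ∉ E) (φ : Finset β → ℝ) :
    ev p (insert a E) φ = (1 - p) * ev p E φ + p * ev p E (fun A => φ (insert a A)) := by
  unfold ev
  rw [Finset.sum_powerset_insert ha, Finset.mul_sum, Finset.mul_sum]
  congr 1
  · refine Finset.sum_congr rfl fun A hA => ?_
    have hA' : a ∉ A := fun h => ha (Finset.mem_powerset.1 hA h)
    rw [Finset.insert_sdiff_of_notMem _ hA', Finset.card_insert_of_notMem
      (fun h => ha (Finset.mem_sdiff.1 h).1)]
    ring
  · refine Finset.sum_congr rfl fun A hA => ?_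
    have hA' : a ∉ A := fun h => ha (Finset.mem_powerset.1 hA h)
    rw [Finset.card_insert_of_notMem hA', Finset.insert_sdiff_insert,
      Finset.sdiff_insert_of_notMem ha]
    ring

lemma ev_congr (p : ℝ) {E : Finset β} {φ ψ : Finset β → ℝ} (h : ∀ A ⊆ E, φ A = ψ A) :
    ev p E φ = ev p E ψ :=
  Finset.sum_congr rfl fun A hA => by rw [h A (Finset.mem_powerset.1 hA)]

lemma ev_mono {p : ℝ} (hp0 : 0 ≤ p) (hp1 : p ≤ 1) {E : Finset β} {φ ψ : Finset β → ℝ}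
    (h : ∀ A ⊆ E, φ A ≤ ψ A) : ev p E φ ≤ ev p E ψ :=
  Finset.sum_le_sum fun A hA => mul_le_mul_of_nonneg_left (h A (Finset.mem_powerset.1 hA))
    (mul_nonneg (pow_nonneg hp0 _) (pow_nonneg (by linarith) _))

lemma ev_add (p : ℝ) (E : Finset β) (φ ψ : Finset β → ℝ) :
    ev p E (fun A => φ A + ψ A) = ev p E φ + ev p E ψ := by
  simp [ev, mul_add, Finset.sum_add_distrib]

lemma ev_mul_left (p : ℝ) (E : Finset β) (c : ℝ) (φ : Finset β → ℝ) :
    ev p E (fun A => c * φ A) = c * ev p E φ := by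
  unfold ev; rw [Finset.mul_sum]; exact Finset.sum_congr rfl fun _ _ => by ring

lemma ev_mul_right (p : ℝ) (E : Finset β) (c : ℝ) (φ : Finset β → ℝ) :
    ev p E (fun A => φ A * c) = ev p E φ * c := by
  unfold ev; rw [Finset.sum_mul]; exact Finset.sum_congr rfl fun _ _ => by ring

lemma ev_sum {ι : Type*} (p : ℝ) (E : Finset β) (s : Finset ι) (φ : ι → Finset β → ℝ) :
    ev p E (fun A => ∑ i ∈ s, φ i A) = ∑ i ∈ s, ev p E (φ i) := by
  unfold ev; rw [Finset.sum_comm]; exact Finset.sum_congr rfl fun _ _ => by rw [Finset.mul_sum]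

lemma ev_const (p : ℝ) (E : Finset β) (c : ℝ) : ev p E (fun _ => c) = c := by
  induction E using Finset.induction_on with
  | empty => rw [ev_empty]
  | insert a E ha ih => rw [ev_insert p ha, ih]; ring

lemma ev_nonneg {p : ℝ} (hp0 : 0 ≤ p) (hp1 : p ≤ 1) {E : Finset β} {φ : Finset β → ℝ}
    (h : ∀ A ⊆ E, 0 ≤ φ A) : 0 ≤ ev p E φ :=
  (ev_const p E 0).ge.trans (ev_mono hp0 hp1 h)

lemma ev_union (p : ℝ) {E F : Finset β} (h : Disjoint E F) (φ : Finset β → ℝ) :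
    ev p (E ∪ F) φ = ev p E (fun A => ev p F (fun B => φ (A ∪ B))) := by
  induction E using Finset.induction_on generalizing φ with
  | empty => simp [ev_empty]
  | insert a E ha ih =>
    rw [Finset.disjoint_insert_left] at h
    rw [Finset.insert_union, ev_insert p (by simp [ha, h.1]), ev_insert p ha, ih h.2, ih h.2]
    simp [Finset.insert_union]

lemma ev_map (p : ℝ) (f : β ↪ γ) (E : Finset β) (φ : Finset γ → ℝ) :
    ev p (E.map f) φ = ev p E (fun A => φ (A.map f)) := by
  induction E using Finset.induction_on generalizing φ with
  | empty => simp [ev_empty]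
  | insert a E ha ih =>
    rw [Finset.map_insert, ev_insert p (by simpa using ha), ev_insert p ha, ih, ih]
    simp [Finset.map_insert]

lemma ev_disjoint (p : ℝ) {E F : Finset β} (h : F ⊆ E) :
    ev p E (fun A => if Disjoint F A then 1 else 0) = (1 - p) ^ #F := by
  have hE : E = F ∪ (E \ F) := (Finset.union_sdiff_of_subset h).symm
  rw [hE, ev_union p Finset.disjoint_sdiff]
  have h1 : ∀ A ⊆ F, ev p (E \ F) (fun B => if Disjoint F (A ∪ B) then (1:ℝ) else 0)
      = if A = ∅ then 1 else 0 := by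
    intro A hA
    rw [← ev_const p (E \ F) (if A = ∅ then (1:ℝ) else 0)]
    refine ev_congr p fun B hB => ?_
    have hFB : Disjoint F B := (Finset.disjoint_sdiff).mono_right hB
    have : Disjoint F (A ∪ B) ↔ A = ∅ := by
      rw [Finset.disjoint_union_right]
      constructor
      · rintro ⟨h1, -⟩
        exact Finset.disjoint_self_iff_empty A |>.1 (h1.mono_left hA)
      · rintro rfl
        exact ⟨Finset.disjoint_empty_right _, hFB⟩
    simp [this]
  rw [ev_congr p h1]
  unfold ev
  rw [Finset.sum_eq_single ∅]
  · simp
  · intro A _ hA; simp [hA]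
  · simp

/-- Independence: the part of the random set inside `F` does not affect an event depending only on
the complement of `F`. -/
lemma ev_disjoint_mul (p : ℝ) {E F : Finset β} (h : F ⊆ E) (φ : Finset β → ℝ) :
    ev p E (fun A => (if Disjoint F A then 1 else 0) * φ (A \ F)) =
      (1 - p) ^ #F * ev p (E \ F) φ := by
  have hE : E = F ∪ (E \ F) := (Finset.union_sdiff_of_subset h).symm
  conv_lhs => rw [hE, ev_union p Finset.disjoint_sdiff]
  rw [← ev_disjoint p (Finset.Subset.refl F), ← ev_mul_right]
  refine ev_congr p fun A hA => ?_
  rw [← ev_mul_left]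
  refine ev_congr p fun B hB => ?_
  have hFB : Disjoint F B := (Finset.disjoint_sdiff).mono_right hB
  have h1 : (A ∪ B) \ F = B := by
    rw [Finset.union_sdiff_distrib, Finset.sdiff_eq_empty_iff_subset.2 hA, Finset.empty_union,
      Finset.sdiff_eq_self_of_disjoint hFB.symm]
  rw [h1]
  simp [Finset.disjoint_union_right, hFB]

lemma ev_cauchy_schwarz {p : ℝ} (hp0 : 0 ≤ p) (hp1 : p ≤ 1) (E : Finset β)
    (φ ψ : Finset β → ℝ) :
    (ev p E (fun A => φ A * ψ A)) ^ 2 ≤ ev p E (fun A => φ A ^ 2) * ev p E (fun A => ψ A ^ 2) := by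
  unfold ev
  have hw : ∀ A : Finset β, 0 ≤ p ^ #A * (1 - p) ^ #(E \ A) := fun A =>
    mul_nonneg (pow_nonneg hp0 _) (pow_nonneg (by linarith) _)
  refine Finset.sum_sq_le_sum_mul_sum_of_sq_le_mul _ (fun A _ => mul_nonneg (hw A) (sq_nonneg _))
    (fun A _ => mul_nonneg (hw A) (sq_nonneg _)) (fun A _ => le_of_eq (by ring))

end Bernoulli

section Pairs

variable {V : Type*} [DecidableEq V]

/-- The pairs of distinct elements of `S`. -/
def pairs (S : Finset V) : Finset (Sym2 V) := S.offDiag.image Sym2.mk.uncurry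

lemma mem_pairs {S : Finset V} {a b : V} : s(a, b) ∈ pairs S ↔ a ∈ S ∧ b ∈ S ∧ a ≠ b := by
  unfold pairs
  simp only [Finset.mem_image, Finset.mem_offDiag, Prod.exists]
  constructor
  · rintro ⟨x, y, ⟨hx, hy, hxy⟩, h⟩
    simp only [Function.uncurry_apply_pair, Sym2.eq_iff] at h
    rcases h with ⟨rfl, rfl⟩ | ⟨rfl, rfl⟩
    · exact ⟨hx, hy, hxy⟩
    · exact ⟨hy, hx, hxy.symm⟩
  · rintro ⟨h1, h2, h3⟩
    exact ⟨a, b, ⟨h1, h2, h3⟩, rfl⟩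

lemma card_pairs (S : Finset V) : #(pairs S) = (#S).choose 2 := Sym2.card_image_offDiag S

lemma pairs_inter (S T : Finset V) : pairs S ∩ pairs T = pairs (S ∩ T) := by
  ext e
  induction e with
  | h a b => simp only [Finset.mem_inter, mem_pairs]; tauto

lemma pairs_mono {S T : Finset V} (h : S ⊆ T) : pairs S ⊆ pairs T := by
  intro e
  induction e with
  | h a b => simp only [mem_pairs]; exact fun ⟨h1, h2, h3⟩ => ⟨h h1, h h2, h3⟩

lemma pairs_disjoint {S T : Finset V} (h : Disjoint S T) : Disjoint (pairs S) (pairs T) := by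
  rw [Finset.disjoint_iff_inter_eq_empty, pairs_inter, Finset.disjoint_iff_inter_eq_empty.1 h]
  simp [pairs]

lemma edgeSet_fromEdgeSet_of_subset_pairs {S : Finset V} {A : Finset (Sym2 V)} (hA : A ⊆ pairs S) :
    (SimpleGraph.fromEdgeSet (A : Set (Sym2 V))).edgeSet = A := by
  rw [SimpleGraph.edgeSet_fromEdgeSet]
  ext e
  induction e with
  | h a b =>
    simp only [Set.mem_sdiff, Finset.mem_coe, Sym2.mem_diagSet, Sym2.mk_isDiag_iff]
    exact ⟨fun h => h.1, fun h => ⟨h, (mem_pairs.1 (hA h)).2.2⟩⟩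

end Pairs

open scoped Classical in
lemma gnpProb_eq_ev (n : ℕ) (p : ℝ) (S : Set (SimpleGraph (Fin n))) :
    gnpProb n p S = ev p (pairs (univ : Finset (Fin n)))
      (fun A => if SimpleGraph.fromEdgeSet (A : Set (Sym2 (Fin n))) ∈ S then 1 else 0) := by
  unfold gnpProb ev
  symm
  refine Finset.sum_bij' (fun A _ => SimpleGraph.fromEdgeSet (A : Set (Sym2 (Fin n))))
    (fun G _ => (pairs univ).filter (· ∈ G.edgeSet)) (fun _ _ => Finset.mem_univ _) ?_ ?_ ?_ ?_
  · intro G _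
    exact Finset.mem_powerset.2 (Finset.filter_subset _ _)
  · intro A hA
    have hA' := Finset.mem_powerset.1 hA
    ext e
    simp only [Finset.mem_filter, edgeSet_fromEdgeSet_of_subset_pairs hA', Finset.mem_coe]
    exact ⟨fun h => h.2, fun h => ⟨hA' h, h⟩⟩
  · intro G _
    ext a b
    simp only [SimpleGraph.fromEdgeSet_adj, Finset.coe_filter, Set.mem_ofPred_eq, mem_pairs,
      Finset.mem_univ, true_and, SimpleGraph.mem_edgeSet]
    exact ⟨fun h => h.1.2, fun h => ⟨⟨h.ne, h⟩, h.ne⟩⟩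
  · intro A hA
    have hA' := Finset.mem_powerset.1 hA
    have h1 : edgeCount (SimpleGraph.fromEdgeSet (A : Set (Sym2 (Fin n)))) = #A := by
      unfold edgeCount
      rw [edgeSet_fromEdgeSet_of_subset_pairs hA', Set.ncard_coe_finset]
    unfold gnpWeight
    rw [h1, Finset.card_sdiff_of_subset hA', card_pairs, Finset.card_univ, Fintype.card_fin]
    by_cases h : SimpleGraph.fromEdgeSet (A : Set (Sym2 (Fin n))) ∈ S
    · simp only [if_pos h, mul_one]
    · simp only [if_neg h, mul_zero]

lemma chrom_le_iff {n : ℕ} (G : SimpleGraph (Fin n)) (k : ℕ) : chrom G ≤ k ↔ G.Colorable k := by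
  have h : G.chromaticNumber ≠ ⊤ :=
    SimpleGraph.chromaticNumber_ne_top_iff_exists.2 ⟨_, G.colorable_of_fintype⟩
  rw [← SimpleGraph.chromaticNumber_le_iff_colorable]
  unfold chrom
  conv_rhs => rw [← ENat.natCast_toNat h]
  exact_mod_cast Iff.rfl

section Concentration

lemma ev_exp_sub_le {β : Type*} [DecidableEq β] {p : ℝ} (hp0 : 0 ≤ p) (hp1 : p ≤ 1)
    (E : Finset β) (h : Finset β → ℝ)
    (hosc : ∀ A ⊆ E, ∀ B ⊆ E, |h A - h B| ≤ 1) {l : ℝ} (hl : |l| ≤ 1) :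
    ev p E (fun A => exp (l * (h A - ev p E h))) ≤ exp (l ^ 2) := by
  set m := ev p E h with hm
  have hsub : ∀ A, h A - m = ev p E (fun B => h A - h B) := by
    intro A
    have := ev_add p E (fun _ => h A) (fun B => (-1) * h B)
    rw [ev_const, ev_mul_left] at this
    simp only [neg_mul, one_mul] at this
    simp only [sub_eq_add_neg]
    rw [this]
  have habs : ∀ A ⊆ E, |h A - m| ≤ 1 := by
    intro A hA
    rw [hsub, abs_le]
    constructor
    · rw [← ev_const p E (-1)]
      exact ev_mono hp0 hp1 fun B hB => (abs_le.1 (hosc A hA B hB)).1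
    · conv_rhs => rw [← ev_const p E 1]
      exact ev_mono hp0 hp1 fun B hB => (abs_le.1 (hosc A hA B hB)).2
  calc ev p E (fun A => exp (l * (h A - m)))
      ≤ ev p E (fun A => (1 + l ^ 2) + (l * h A + (- (l * m)))) := by
        refine ev_mono hp0 hp1 fun A hA => ?_
        have h1 := habs A hA
        have h2 : |l * (h A - m)| ≤ 1 := by
          rw [abs_mul]; exact mul_le_one₀ hl (abs_nonneg _) h1
        have h3 := (abs_le.1 (Real.abs_exp_sub_one_sub_id_le h2)).2
        have h4 : (l * (h A - m)) ^ 2 ≤ l ^ 2 := by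
          rw [mul_pow]
          have : (h A - m) ^ 2 ≤ 1 := by rw [← sq_abs]; exact pow_le_one₀ (abs_nonneg _) h1
          nlinarith [sq_nonneg l]
        linarith
    _ = 1 + l ^ 2 := by
        rw [ev_add, ev_const, ev_add, ev_const, ev_mul_left]
        ring
    _ ≤ exp (l ^ 2) := by linarith [Real.add_one_le_exp (l ^ 2)]

variable {V : Type*} [DecidableEq V]

/-- The pairs joining `v` to an element of `S`. -/
def pairsFrom (v : V) (S : Finset V) : Finset (Sym2 V) := S.image fun w => s(v, w)

lemma pairs_insert {v : V} {S : Finset V} (hv : v ∉ S) :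
    pairs (insert v S) = pairs S ∪ pairsFrom v S := by
  ext e
  induction e with
  | h a b =>
    simp only [mem_pairs, pairsFrom, Finset.mem_union, Finset.mem_image, Finset.mem_insert,
      Sym2.eq_iff]
    constructor
    · rintro ⟨rfl | ha, rfl | hb, hab⟩
      · exact absurd rfl hab
      · exact Or.inr ⟨b, hb, Or.inl ⟨rfl, rfl⟩⟩
      · exact Or.inr ⟨a, ha, Or.inr ⟨rfl, rfl⟩⟩
      · exact Or.inl ⟨ha, hb, hab⟩
    · rintro (⟨ha, hb, hab⟩ | ⟨w, hw, ⟨rfl, rfl⟩ | ⟨rfl, rfl⟩⟩)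
      · exact ⟨Or.inr ha, Or.inr hb, hab⟩
      · exact ⟨Or.inl rfl, Or.inr hw, fun h => hv (h ▸ hw)⟩
      · exact ⟨Or.inr hw, Or.inl rfl, fun h => hv (h ▸ hw)⟩

lemma disjoint_pairs_pairsFrom {v : V} {S : Finset V} (hv : v ∉ S) :
    Disjoint (pairs S) (pairsFrom v S) := by
  rw [Finset.disjoint_left]
  intro e
  induction e with
  | h a b =>
    simp only [mem_pairs, pairsFrom, Finset.mem_image, Sym2.eq_iff]
    rintro ⟨ha, hb, -⟩ ⟨w, hw, ⟨rfl, rfl⟩ | ⟨rfl, rfl⟩⟩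
    · exact hv ha
    · exact hv hb

/-- `f` changes by at most one when the edges at a single vertex change. -/
def VertexLipschitz (f : Finset (Sym2 V) → ℝ) : Prop :=
  ∀ (v : V) (A B : Finset (Sym2 V)), (∀ e, v ∉ e → (e ∈ A ↔ e ∈ B)) → |f A - f B| ≤ 1

lemma ev_exp_sub_le_of_vertexLipschitz {p : ℝ} (hp0 : 0 ≤ p) (hp1 : p ≤ 1) (S : Finset V)
    {l : ℝ} (hl : |l| ≤ 1) (f : Finset (Sym2 V) → ℝ) (hf : VertexLipschitz f) :
    ev p (pairs S) (fun A => exp (l * (f A - ev p (pairs S) f))) ≤ exp (l ^ 2 * #S) := by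
  induction S using Finset.induction_on generalizing f with
  | empty => simp [pairs, ev_empty]
  | insert v S hv ih =>
    have hd := disjoint_pairs_pairsFrom hv
    set g : Finset (Sym2 V) → ℝ := fun A => ev p (pairsFrom v S) (fun B => f (A ∪ B)) with hg
    have hgl : VertexLipschitz g := by
      intro w A A' h
      have key : ∀ A A' : Finset (Sym2 V), (∀ e, w ∉ e → (e ∈ A ↔ e ∈ A')) → g A - g A' ≤ 1 := by
        intro A A' h
        rw [sub_le_iff_le_add]
        calc g A ≤ ev p (pairsFrom v S) (fun B => 1 + f (A' ∪ B)) := by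
              refine ev_mono hp0 hp1 fun B _ => ?_
              have := (abs_le.1 (hf w (A ∪ B) (A' ∪ B) (fun e he => by
                simp [h e he]))).2
              linarith
          _ = 1 + g A' := by rw [ev_add, ev_const]
      rw [abs_le]
      exact ⟨by linarith [key A' A fun e he => (h e he).symm], key A A' h⟩
    have hm : ev p (pairs (insert v S)) f = ev p (pairs S) g := by
      rw [pairs_insert hv, ev_union p hd]
    rw [hm, pairs_insert hv, ev_union p hd, Finset.card_insert_of_notMem hv]
    set m := ev p (pairs S) g with hmm
    calc _ ≤ ev p (pairs S) (fun A => exp (l ^ 2) * exp (l * (g A - m))) := by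
          refine ev_mono hp0 hp1 fun A _ => ?_
          have h1 : ∀ B, exp (l * (f (A ∪ B) - m)) =
              exp (l * (g A - m)) * exp (l * (f (A ∪ B) - g A)) := by
            intro B; rw [← exp_add]; ring_nf
          simp only [h1]
          rw [ev_mul_left, mul_comm]
          refine mul_le_mul_of_nonneg_right ?_ (exp_pos _).le
          refine ev_exp_sub_le hp0 hp1 (pairsFrom v S) (fun B => f (A ∪ B)) ?_ hl
          intro B hB B' hB'
          refine hf v _ _ fun e he => ?_
          have : ∀ C ⊆ pairsFrom v S, e ∉ C := by
            intro C hC heC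
            obtain ⟨w, -, rfl⟩ := Finset.mem_image.1 (hC heC)
            exact he (Sym2.mem_mk_left v w)
          simp [this B hB, this B' hB']
      _ = exp (l ^ 2) * ev p (pairs S) (fun A => exp (l * (g A - m))) := ev_mul_left _ _ _ _
      _ ≤ exp (l ^ 2) * exp (l ^ 2 * #S) :=
          mul_le_mul_of_nonneg_left (ih g hgl) (exp_pos _).le
      _ = exp (l ^ 2 * ↑(#S + 1)) := by rw [← exp_add]; push_cast; ring_nf

open scoped Classical in
/-- The lower and upper tails of a vertex-Lipschitz function cannot both be heavy. -/
lemma ev_le_mul_ev_ge_le {p : ℝ} (hp0 : 0 ≤ p) (hp1 : p ≤ 1) (S : Finset V)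
    {f : Finset (Sym2 V) → ℝ} (hf : VertexLipschitz f) {l : ℝ} (hl0 : 0 ≤ l) (hl : l ≤ 1)
    (a w : ℝ) :
    ev p (pairs S) (fun A => if f A ≤ a then 1 else 0) *
      ev p (pairs S) (fun A => if a + w ≤ f A then 1 else 0) ≤
      exp (2 * l ^ 2 * #S - l * w) := by
  set m := ev p (pairs S) f with hm
  have h1 : ev p (pairs S) (fun A => if f A ≤ a then 1 else 0) ≤
      exp (l * (a - m)) * exp (l ^ 2 * #S) := by
    refine le_trans ?_ (mul_le_mul_of_nonneg_left
      (ev_exp_sub_le_of_vertexLipschitz hp0 hp1 S (l := -l) (by rwa [abs_neg, abs_of_nonneg hl0])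
        f hf |>.trans_eq (by rw [neg_sq])) (exp_pos _).le)
    rw [← ev_mul_left]
    refine ev_mono hp0 hp1 fun A _ => ?_
    rw [← exp_add]
    split_ifs with h
    · rw [one_le_exp_iff]; nlinarith
    · exact (exp_pos _).le
  have h2 : ev p (pairs S) (fun A => if a + w ≤ f A then 1 else 0) ≤
      exp (l * (m - a - w)) * exp (l ^ 2 * #S) := by
    refine le_trans ?_ (mul_le_mul_of_nonneg_left
      (ev_exp_sub_le_of_vertexLipschitz hp0 hp1 S (l := l) (by rwa [abs_of_nonneg hl0])
        f hf) (exp_pos _).le)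
    rw [← ev_mul_left]
    refine ev_mono hp0 hp1 fun A _ => ?_
    rw [← exp_add]
    split_ifs with h
    · rw [one_le_exp_iff]; nlinarith
    · exact (exp_pos _).le
  have h0 : 0 ≤ ev p (pairs S) (fun A => if a + w ≤ f A then (1:ℝ) else 0) :=
    ev_nonneg hp0 hp1 fun A _ => by split_ifs <;> norm_num
  refine (mul_le_mul h1 h2 h0 (by positivity)).trans_eq ?_
  rw [← exp_add, ← exp_add, ← exp_add]
  ring_nf

end Concentration

/-- Chromatic number of the graph with edge set `A`. -/
noncomputable def chi {n : ℕ} (A : Finset (Sym2 (Fin n))) : ℕ :=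
  chrom (SimpleGraph.fromEdgeSet (A : Set (Sym2 (Fin n))))

lemma vertexLipschitz_chi (n : ℕ) :
    VertexLipschitz (fun A : Finset (Sym2 (Fin n)) => (chi A : ℝ)) := by
  have key : ∀ (v : Fin n) (A B : Finset (Sym2 (Fin n))), (∀ e, v ∉ e → (e ∈ A ↔ e ∈ B)) →
      chi A ≤ chi B + 1 := by
    intro v A B h
    unfold chi
    rw [chrom_le_iff]
    obtain ⟨c⟩ := (chrom_le_iff _ _).1
      (le_refl (chrom (SimpleGraph.fromEdgeSet (B : Set (Sym2 (Fin n))))))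
    refine ⟨SimpleGraph.Coloring.mk
      (fun x => if x = v then Fin.last _ else (c x).castSucc) ?_⟩
    intro x y hxy
    rw [SimpleGraph.fromEdgeSet_adj] at hxy
    by_cases hx : x = v <;> by_cases hy : y = v
    · exact absurd (hx.trans hy.symm) hxy.2
    · simp only [hx, hy, if_true, if_false]
      exact (Fin.castSucc_lt_last _).ne'
    · simp only [hx, hy, if_true, if_false]
      exact (Fin.castSucc_lt_last _).ne
    · simp only [hx, hy, if_false]
      intro hc
      have hB : s(x, y) ∈ B := (h s(x, y) (by simp [Sym2.mem_iff, Ne.symm hx, Ne.symm hy])).1 hxy.1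
      exact c.valid (show (SimpleGraph.fromEdgeSet (B : Set (Sym2 (Fin n)))).Adj x y from
        (SimpleGraph.fromEdgeSet_adj _).2 ⟨hB, hxy.2⟩) (Fin.castSucc_injective _ hc)
  intro v A B h
  have h1 := key v A B h
  have h2 := key v B A fun e he => (h e he).symm
  have h1' : (chi A : ℝ) ≤ chi B + 1 := by exact_mod_cast h1
  have h2' : (chi B : ℝ) ≤ chi A + 1 := by exact_mod_cast h2
  rw [abs_le]; constructor <;> simp only <;> linarith

section Parts

variable {V : Type*} [DecidableEq V]

/-- Sum of `F` over the lists of disjoint subsets of `R` with the prescribed sizes. -/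
noncomputable def sumParts : List ℕ → Finset V → (List (Finset V) → ℝ) → ℝ
  | [], _, F => F []
  | u :: us, R, F => ∑ S ∈ R.powersetCard u, sumParts us (R \ S) (fun l => F (S :: l))

/-- `l` is a list of disjoint subsets of `R` with the prescribed sizes. -/
def IsParts : List ℕ → Finset V → List (Finset V) → Prop
  | [], _, [] => True
  | u :: us, R, S :: l => S ∈ R.powersetCard u ∧ IsParts us (R \ S) l
  | [], _, _ :: _ => False
  | _ :: _, _, [] => False

/-- The number of lists of disjoint subsets with the prescribed sizes of an `m`-set. -/
def cntParts : List ℕ → ℕ → ℕ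
  | [], _ => 1
  | u :: us, m => m.choose u * cntParts us (m - u)

lemma cntParts_mul (us : List ℕ) (m : ℕ) (h : us.sum ≤ m) :
    cntParts us m * ((us.map Nat.factorial).prod * (m - us.sum).factorial) = m.factorial := by
  induction us generalizing m with
  | nil => simp [cntParts]
  | cons u us ih =>
    rw [List.sum_cons] at h
    have h1 := ih (m - u) (by omega)
    rw [List.sum_cons, List.map_cons, List.prod_cons, cntParts, Nat.sub_add_eq,
      ← Nat.choose_mul_factorial_mul_factorial (show u ≤ m by omega), ← h1]
    ring

lemma sumParts_mono {us : List ℕ} {R : Finset V} {F G : List (Finset V) → ℝ}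
    (h : ∀ l, IsParts us R l → F l ≤ G l) : sumParts us R F ≤ sumParts us R G := by
  induction us generalizing R F G with
  | nil => exact h [] trivial
  | cons u us ih =>
    exact Finset.sum_le_sum fun S hS => ih fun l hl => h (S :: l) ⟨hS, hl⟩

lemma sumParts_congr {us : List ℕ} {R : Finset V} {F G : List (Finset V) → ℝ}
    (h : ∀ l, IsParts us R l → F l = G l) : sumParts us R F = sumParts us R G :=
  le_antisymm (sumParts_mono fun l hl => (h l hl).le) (sumParts_mono fun l hl => (h l hl).ge)

lemma sumParts_const (us : List ℕ) (R : Finset V) (c : ℝ) :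
    sumParts us R (fun _ => c) = cntParts us #R * c := by
  induction us generalizing R with
  | nil => simp [sumParts, cntParts]
  | cons u us ih =>
    rw [sumParts, cntParts]
    have : ∀ S ∈ R.powersetCard u, sumParts us (R \ S) (fun _ => c) =
        cntParts us (#R - u) * c := by
      intro S hS
      rw [Finset.mem_powersetCard] at hS
      rw [ih, Finset.card_sdiff_of_subset hS.1, hS.2]
    rw [Finset.sum_congr rfl this, Finset.sum_const, Finset.card_powersetCard, nsmul_eq_mul]
    push_cast; ring

lemma sumParts_mul_left (us : List ℕ) (R : Finset V) (c : ℝ) (F : List (Finset V) → ℝ) :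
    sumParts us R (fun l => c * F l) = c * sumParts us R F := by
  induction us generalizing R F with
  | nil => rfl
  | cons u us ih => simp only [sumParts, ih, Finset.mul_sum]

lemma ev_sumParts {β : Type*} [DecidableEq β] (p : ℝ) (E : Finset β) (us : List ℕ) (R : Finset V)
    (F : Finset β → List (Finset V) → ℝ) :
    ev p E (fun A => sumParts us R (F A)) = sumParts us R (fun l => ev p E (fun A => F A l)) := by
  induction us generalizing R F with
  | nil => rfl
  | cons u us ih =>
    simp only [sumParts]
    rw [ev_sum]
    exact Finset.sum_congr rfl fun S _ => ih _ _

/-- All pairs inside one of the sets in the list. -/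
def partPairs (l : List (Finset V)) : Finset (Sym2 V) := l.foldr (fun S E => pairs S ∪ E) ∅

@[simp] lemma partPairs_nil : partPairs ([] : List (Finset V)) = ∅ := rfl

@[simp] lemma partPairs_cons (S : Finset V) (l : List (Finset V)) :
    partPairs (S :: l) = pairs S ∪ partPairs l := rfl

lemma IsParts.subset {us : List ℕ} {R : Finset V} {l : List (Finset V)} (h : IsParts us R l) :
    ∀ S ∈ l, S ⊆ R := by
  induction us generalizing R l with
  | nil => cases l with
    | nil => simp
    | cons => exact h.elim
  | cons u us ih => cases l with
    | nil => exact h.elim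
    | cons S l =>
      intro S' hS'
      rcases List.mem_cons.1 hS' with rfl | h'
      · exact (Finset.mem_powersetCard.1 h.1).1
      · exact (ih h.2 S' h').trans Finset.sdiff_subset

lemma IsParts.length_eq {us : List ℕ} {R : Finset V} {l : List (Finset V)} (h : IsParts us R l) :
    l.length = us.length := by
  induction us generalizing R l with
  | nil => cases l with
    | nil => rfl
    | cons => exact h.elim
  | cons u us ih => cases l with
    | nil => exact h.elim
    | cons S l => simp [ih h.2]

lemma IsParts.card_mem {us : List ℕ} {R : Finset V} {l : List (Finset V)} (h : IsParts us R l) :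
    ∀ S ∈ l, #S ∈ us := by
  induction us generalizing R l with
  | nil => cases l with
    | nil => simp
    | cons => exact h.elim
  | cons u us ih => cases l with
    | nil => exact h.elim
    | cons S l =>
      intro S' hS'
      rcases List.mem_cons.1 hS' with rfl | h'
      · rw [(Finset.mem_powersetCard.1 h.1).2]; exact List.mem_cons_self
      · exact List.mem_cons_of_mem _ (ih h.2 S' h')

lemma IsParts.pairwise {us : List ℕ} {R : Finset V} {l : List (Finset V)} (h : IsParts us R l) :
    l.Pairwise Disjoint := by
  induction us generalizing R l with
  | nil => cases l with
    | nil => exact List.Pairwise.nil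
    | cons => exact h.elim
  | cons u us ih => cases l with
    | nil => exact h.elim
    | cons S l =>
      refine List.Pairwise.cons (fun T hT => ?_) (ih h.2)
      exact (Finset.disjoint_sdiff).mono_right (h.2.subset T hT)

lemma partPairs_subset {R : Finset V} {l : List (Finset V)} (h : ∀ S ∈ l, S ⊆ R) :
    partPairs l ⊆ pairs R := by
  induction l with
  | nil => simp
  | cons S l ih =>
    rw [partPairs_cons]
    exact Finset.union_subset (pairs_mono (h S List.mem_cons_self))
      (ih fun T hT => h T (List.mem_cons_of_mem _ hT))

lemma IsParts.card_partPairs {us : List ℕ} {R : Finset V} {l : List (Finset V)}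
    (h : IsParts us R l) : #(partPairs l) = (us.map (fun u => u.choose 2)).sum := by
  induction us generalizing R l with
  | nil => cases l with
    | nil => rfl
    | cons => exact h.elim
  | cons u us ih => cases l with
    | nil => exact h.elim
    | cons S l =>
      rw [partPairs_cons, List.map_cons, List.sum_cons, ← ih h.2,
        Finset.card_union_of_disjoint, card_pairs, (Finset.mem_powersetCard.1 h.1).2]
      exact (pairs_disjoint Finset.disjoint_sdiff).mono_right (partPairs_subset h.2.subset)

/-- Number of pairs of `S` lying inside a common member of `l` (for disjoint members). -/
def overlap (l : List (Finset V)) (S : Finset V) : ℕ :=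
  (l.map fun T => (#(S ∩ T)).choose 2).sum

lemma card_pairs_inter_partPairs_le (l : List (Finset V)) (S : Finset V) :
    #(pairs S ∩ partPairs l) ≤ overlap l S := by
  induction l with
  | nil => simp [overlap]
  | cons T l ih =>
    rw [partPairs_cons, Finset.inter_union_distrib_left]
    refine (Finset.card_union_le _ _).trans ?_
    rw [pairs_inter, card_pairs]
    simp only [overlap, List.map_cons, List.sum_cons] at ih ⊢
    omega

lemma card_partPairs_inter_le (l l' : List (Finset V)) :
    #(partPairs l' ∩ partPairs l) ≤ (l'.map (overlap l)).sum := by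
  induction l' with
  | nil => simp
  | cons T l' ih =>
    rw [partPairs_cons, Finset.union_inter_distrib_right, List.map_cons, List.sum_cons]
    exact (Finset.card_union_le _ _).trans (add_le_add (card_pairs_inter_partPairs_le l T) ih)

/-- Sum over lists of disjoint sets with the prescribed sizes of a product of weights. -/
noncomputable def wsum : List (ℕ × (Finset V → ℝ)) → Finset V → ℝ
  | [], _ => 1
  | a :: l, R => ∑ S ∈ R.powersetCard a.1, a.2 S * wsum l (R \ S)

lemma sumParts_prod_eq_wsum (us : List ℕ) (w : Finset V → ℝ) (R : Finset V) :
    sumParts us R (fun l => (l.map w).prod) = wsum (us.map fun u => (u, w)) R := by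
  induction us generalizing R with
  | nil => simp [sumParts, wsum]
  | cons u us ih =>
    simp only [sumParts, wsum, List.map_cons, List.prod_cons, sumParts_mul_left, ih]

lemma wsum_perm {l l' : List (ℕ × (Finset V → ℝ))} (h : l.Perm l') (R : Finset V) :
    wsum l R = wsum l' R := by
  induction h generalizing R with
  | nil => rfl
  | cons a _ ih => simp only [wsum, ih]
  | trans _ _ ih1 ih2 => rw [ih1, ih2]
  | swap a b l =>
    simp only [wsum, Finset.mul_sum]
    rw [Finset.sum_comm' (t' := R.powersetCard a.1) (s' := fun S => (R \ S).powersetCard b.1)]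
    · refine Finset.sum_congr rfl fun S _ => Finset.sum_congr rfl fun S' _ => ?_
      rw [sdiff_right_comm]; ring
    · intro S S'
      simp only [Finset.mem_powersetCard, Finset.subset_sdiff]
      constructor
      · rintro ⟨⟨h1, h2⟩, ⟨h3, h4⟩, h5⟩; exact ⟨⟨⟨h1, h4.symm⟩, h2⟩, h3, h5⟩
      · rintro ⟨⟨⟨h1, h4⟩, h2⟩, h3, h5⟩; exact ⟨⟨h1, h2⟩, ⟨h3, h4.symm⟩, h5⟩

section Bound

variable {wb ws : Finset V → ℝ} {K : ℕ → ℝ} {M : ℝ} {m₀ : ℕ} {us : List ℕ}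

lemma wsum_small_le (hws : ∀ S, 0 ≤ ws S) (hM : 0 ≤ M)
    (hs : ∀ u ∈ us, ∀ R : Finset V, m₀ ≤ #R →
      ∑ S ∈ R.powersetCard u, ws S ≤ (#R).choose u * M)
    (R : Finset V) (hR : us.sum + m₀ ≤ #R) :
    wsum (us.map fun u => (u, ws)) R ≤ cntParts us #R * M ^ us.length := by
  induction us generalizing R with
  | nil => simp [wsum, cntParts]
  | cons u us ih =>
    rw [List.sum_cons] at hR
    simp only [List.map_cons, wsum, cntParts, List.length_cons]
    calc _ ≤ ∑ S ∈ R.powersetCard u, ws S * (cntParts us (#R - u) * M ^ us.length) := by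
          refine Finset.sum_le_sum fun S hS => mul_le_mul_of_nonneg_left ?_ (hws S)
          rw [Finset.mem_powersetCard] at hS
          have hc : #(R \ S) = #R - u := by rw [Finset.card_sdiff_of_subset hS.1, hS.2]
          rw [← hc]
          exact ih (fun u hu => hs u (List.mem_cons_of_mem _ hu)) _ (by omega)
      _ ≤ ((#R).choose u * M) * (cntParts us (#R - u) * M ^ us.length) := by
          rw [← Finset.sum_mul]
          exact mul_le_mul_of_nonneg_right (hs u List.mem_cons_self R (by omega)) (by positivity)
      _ = _ := by push_cast; ring

lemma wsum_big_append_small_le (hwb : ∀ S, 0 ≤ wb S) (hws : ∀ S, 0 ≤ ws S) (hM : 0 ≤ M)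
    (hK : ∀ u, 0 ≤ K u) (vs : List ℕ)
    (hb : ∀ u ∈ vs, ∀ R : Finset V, ∑ S ∈ R.powersetCard u, wb S ≤ K u)
    (hs : ∀ u ∈ us, ∀ R : Finset V, m₀ ≤ #R →
      ∑ S ∈ R.powersetCard u, ws S ≤ (#R).choose u * M)
    (R : Finset V) (hR : vs.sum + us.sum + m₀ ≤ #R) :
    wsum (vs.map (fun u => (u, wb)) ++ us.map fun u => (u, ws)) R ≤
      (vs.map K).prod * (cntParts us (#R - vs.sum) * M ^ us.length) := by
  induction vs generalizing R with
  | nil =>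
    simpa using wsum_small_le hws hM hs R (by simpa using hR)
  | cons u vs ih =>
    rw [List.sum_cons] at hR
    simp only [List.map_cons, List.cons_append, wsum, List.prod_cons, List.sum_cons]
    have hKn : 0 ≤ (vs.map K).prod := List.prod_nonneg (by
      intro a ha; obtain ⟨x, -, rfl⟩ := List.mem_map.1 ha; exact hK x)
    calc _ ≤ ∑ S ∈ R.powersetCard u, wb S *
            ((vs.map K).prod * (cntParts us (#R - u - vs.sum) * M ^ us.length)) := by
          refine Finset.sum_le_sum fun S hS => mul_le_mul_of_nonneg_left ?_ (hwb S)
          rw [Finset.mem_powersetCard] at hS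
          have hc : #(R \ S) = #R - u := by rw [Finset.card_sdiff_of_subset hS.1, hS.2]
          rw [← hc]
          exact ih (fun u hu => hb u (List.mem_cons_of_mem _ hu)) _ (by omega)
      _ ≤ K u * ((vs.map K).prod * (cntParts us (#R - u - vs.sum) * M ^ us.length)) := by
          rw [← Finset.sum_mul]
          exact mul_le_mul_of_nonneg_right (hb u List.mem_cons_self R) (by positivity)
      _ = _ := by rw [Nat.sub_add_eq]; ring

/-- Splitting every weight into a big and a small part and treating the big parts first. -/
lemma wsum_le_of_split {C₀ ζ : ℝ} (hwb : ∀ S, 0 ≤ wb S) (hws : ∀ S, 0 ≤ ws S) (hM : 1 ≤ M)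
    (hK : ∀ u, 0 ≤ K u) (hζ : 0 ≤ ζ) (hC : 0 ≤ C₀)
    (hb : ∀ u ∈ us, ∀ R : Finset V, ∑ S ∈ R.powersetCard u, wb S ≤ K u)
    (hs : ∀ u ∈ us, ∀ R : Finset V, m₀ ≤ #R →
      ∑ S ∈ R.powersetCard u, ws S ≤ (#R).choose u * M)
    (R : Finset V) (hR : us.sum + m₀ ≤ #R)
    (hJ : ∀ vs : List ℕ, vs.Subperm us →
      (vs.map fun u => K u * u.factorial).prod * (#R - vs.sum).factorial ≤
        C₀ * ζ ^ vs.length * (#R).factorial) :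
    wsum (us.map fun u => (u, fun S => wb S + ws S)) R ≤
      C₀ * M ^ us.length * (1 + ζ) ^ us.length * cntParts us #R := by
  set item : ℕ × Bool → ℕ × (Finset V → ℝ) := fun a => (a.1, if a.2 then wb else ws) with hitem
  set B : ℝ := C₀ * M ^ us.length * cntParts us #R with hB
  have hB0 : 0 ≤ B := by positivity
  have hflag : ∀ l : List (ℕ × Bool), (l.map Prod.fst).Perm us →
      wsum (l.map item) R ≤ B * ζ ^ (l.filter (·.2)).length := by
    intro l hl
    set vs := (l.filter (·.2)).map Prod.fst with hvs
    set ts := (l.filter (fun a => !a.2)).map Prod.fst with hts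
    have hperm : (l.filter (·.2) ++ l.filter (fun a => !a.2)).Perm l := List.filter_append_perm _ _
    have hus : (vs ++ ts).Perm us := by
      rw [hvs, hts, ← List.map_append]
      exact (hperm.map _).trans hl
    have h1 : wsum (l.map item) R =
        wsum (vs.map (fun u => (u, wb)) ++ ts.map fun u => (u, ws)) R := by
      rw [wsum_perm (hperm.map item).symm R, List.map_append, hvs, hts, List.map_map, List.map_map]
      congr 2
      · refine List.map_congr_left fun a ha => ?_
        have : a.2 = true := by simpa using (List.mem_filter.1 ha).2
        simp [hitem, this]
      · refine List.map_congr_left fun a ha => ?_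
        have : a.2 = false := by simpa using (List.mem_filter.1 ha).2
        simp [hitem, this]
    have hsum : vs.sum + ts.sum = us.sum := by rw [← List.sum_append]; exact hus.sum_eq
    have hmv : ∀ u ∈ vs, u ∈ us := fun u hu => hus.subset (List.mem_append_left _ hu)
    have hmt : ∀ u ∈ ts, u ∈ us := fun u hu => hus.subset (List.mem_append_right _ hu)
    have h2 := wsum_big_append_small_le hwb hws (by linarith : 0 ≤ M) hK vs
      (fun u hu => hb u (hmv u hu)) (fun u hu => hs u (hmt u hu)) R (by omega)
    have hlen : vs.length = (l.filter (·.2)).length := List.length_map _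
    have htl : ts.length ≤ us.length := by
      rw [← hus.length_eq, List.length_append]; omega
    rw [h1, ← hlen]
    refine h2.trans ?_
    have hJ' := hJ vs ((List.sublist_append_left vs ts).subperm.trans hus.subperm)
    have hc1 := cntParts_mul us #R (by omega)
    have hc2 := cntParts_mul ts (#R - vs.sum) (by omega)
    have hprod : (us.map Nat.factorial).prod =
        (vs.map Nat.factorial).prod * (ts.map Nat.factorial).prod := by
      rw [← List.prod_append, ← List.map_append]; exact ((hus.map _).prod_eq).symm
    have hsub : #R - vs.sum - ts.sum = #R - us.sum := by omega
    rw [hsub] at hc2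
    rw [hprod] at hc1
    have hpm : ∀ l' : List ℕ, (l'.map fun u => K u * (u.factorial : ℝ)).prod =
        (l'.map K).prod * ((l'.map Nat.factorial).prod : ℕ) := by
      intro l'
      induction l' with
      | nil => simp
      | cons a l' ih => simp only [List.map_cons, List.prod_cons, ih]; push_cast; ring
    rw [hpm vs] at hJ'
    set fv : ℕ := (vs.map Nat.factorial).prod with hfv
    set ft : ℕ := (ts.map Nat.factorial).prod with hft
    have hft0 : 0 < ft := by
      rw [hft]; refine List.prod_pos ?_
      intro a ha; obtain ⟨x, -, rfl⟩ := List.mem_map.1 ha; exact Nat.factorial_pos x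
    have hfv0 : 0 < fv := by
      rw [hfv]; refine List.prod_pos ?_
      intro a ha; obtain ⟨x, -, rfl⟩ := List.mem_map.1 ha; exact Nat.factorial_pos x
    set g : ℕ := (#R - us.sum).factorial with hg
    have hg0 : 0 < g := Nat.factorial_pos _
    have hc1' : (cntParts us #R : ℝ) * (fv * ft * g) = (#R).factorial := by exact_mod_cast hc1
    have hc2' : (cntParts ts (#R - vs.sum) : ℝ) * (ft * g) = (#R - vs.sum).factorial := by
      exact_mod_cast hc2
    rw [← hc1', ← hc2'] at hJ'
    have hpos : (0:ℝ) < fv * ft * g := by positivity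
    have hkey : (vs.map K).prod * cntParts ts (#R - vs.sum) ≤
        C₀ * ζ ^ vs.length * cntParts us #R := by
      refine le_of_mul_le_mul_right ?_ hpos
      calc _ = (vs.map K).prod * fv * (cntParts ts (#R - vs.sum) * (ft * g)) := by ring
        _ ≤ _ := hJ'
        _ = _ := by ring
    calc (vs.map K).prod * (cntParts ts (#R - vs.sum) * M ^ ts.length)
        = ((vs.map K).prod * cntParts ts (#R - vs.sum)) * M ^ ts.length := by ring
      _ ≤ (C₀ * ζ ^ vs.length * cntParts us #R) * M ^ us.length :=
          mul_le_mul hkey (pow_le_pow_right₀ hM htl) (by positivity) (by positivity)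
      _ = _ := by rw [hB]; ring
  have hind : ∀ (ts : List ℕ) (l : List (ℕ × Bool)), (l.map Prod.fst ++ ts).Perm us →
      wsum (l.map item ++ ts.map fun u => (u, fun S => wb S + ws S)) R ≤
        B * ζ ^ (l.filter (·.2)).length * (1 + ζ) ^ ts.length := by
    intro ts
    induction ts with
    | nil => intro l hl; simpa using hflag l (by simpa using hl)
    | cons u ts ih =>
      intro l hl
      have hp : ∀ f : Bool, (((u, f) :: l).map Prod.fst ++ ts).Perm us := fun f =>
        (List.perm_middle.symm).trans hl
      have hsplit : wsum (l.map item ++ (u :: ts).map fun u => (u, fun S => wb S + ws S)) R =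
          wsum (((u, true) :: l).map item ++ ts.map fun u => (u, fun S => wb S + ws S)) R +
          wsum (((u, false) :: l).map item ++ ts.map fun u => (u, fun S => wb S + ws S)) R := by
        rw [List.map_cons, wsum_perm List.perm_middle R]
        simp only [List.map_cons, List.cons_append, wsum, hitem, if_true, add_mul,
          Finset.sum_add_distrib, Bool.false_eq_true, if_false]
      rw [hsplit]
      have h1 := ih ((u, true) :: l) (hp true)
      have h2 := ih ((u, false) :: l) (hp false)
      simp only [List.filter_cons, if_true, List.length_cons, Bool.false_eq_true, if_false]
        at h1 h2
      refine (add_le_add h1 h2).trans_eq ?_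
      rw [List.length_cons]; ring
  have := hind us [] (by simp)
  simp only [List.map_nil, List.nil_append, List.filter_nil, List.length_nil, pow_zero,
    mul_one] at this
  refine this.trans_eq ?_
  rw [hB]; ring

end Bound

end Parts

section Weights

variable {V : Type*} [DecidableEq V]

lemma choose_two_add (a c : ℕ) : (a + c).choose 2 = a.choose 2 + c.choose 2 + a * c := by
  have h : (((a + c).choose 2 : ℕ) : ℚ) = ((a.choose 2 + c.choose 2 + a * c : ℕ) : ℚ) := by
    push_cast [Nat.cast_choose_two]; ring
  exact_mod_cast h

lemma sum_choose_two_le (l : List ℕ) : (l.map fun a => a.choose 2).sum ≤ l.sum.choose 2 := by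
  induction l with
  | nil => simp
  | cons a l ih =>
    rw [List.map_cons, List.sum_cons, List.sum_cons, choose_two_add]; omega

lemma sum_card_inter_le {l : List (Finset V)} (hl : l.Pairwise Disjoint) (S : Finset V) :
    (l.map fun T => #(S ∩ T)).sum ≤ #S := by
  induction l generalizing S with
  | nil => simp
  | cons T l ih =>
    rw [List.pairwise_cons] at hl
    have h1 := ih hl.2 (S \ T)
    have h2 : (l.map fun T' => #((S \ T) ∩ T')) = l.map fun T' => #(S ∩ T') := by
      refine List.map_congr_left fun T' hT' => ?_
      rw [sdiff_inter_right_comm, (hl.1 T' hT').symm.mono_left inter_subset_right |>.sdiff_eq_left]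
    rw [h2] at h1
    rw [List.map_cons, List.sum_cons]
    have := card_inter_add_card_sdiff S T
    omega

lemma overlap_le_choose {l : List (Finset V)} (hl : l.Pairwise Disjoint) (S : Finset V) :
    overlap l S ≤ (#S).choose 2 := by
  have h := sum_choose_two_le (l.map fun T => #(S ∩ T))
  rw [List.map_map] at h
  exact h.trans (Nat.choose_le_choose 2 (sum_card_inter_le hl S))

lemma overlap_le {l : List (Finset V)} (hl : l.Pairwise Disjoint) (S : Finset V)
    {T : Finset V} (hT : T ∈ l) :
    overlap l S ≤ (#(S ∩ T)).choose 2 + (#S - #(S ∩ T)).choose 2 := by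
  induction l with
  | nil => simp at hT
  | cons U l ih =>
    have hl' := List.pairwise_cons.1 hl
    have hperm : (U :: l).Perm (T :: (U :: l).erase T) := List.perm_cons_erase hT
    have hpw : (T :: (U :: l).erase T).Pairwise Disjoint :=
      (hperm.pairwise_iff fun h => h.symm).1 hl
    have h0 : overlap (U :: l) S = overlap (T :: (U :: l).erase T) S :=
      (hperm.map _).sum_eq
    rw [List.pairwise_cons] at hpw
    set l' := (U :: l).erase T
    have h1 : overlap l' S = overlap l' (S \ T) := by
      unfold overlap
      congr 1
      refine List.map_congr_left fun T' hT' => ?_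
      rw [sdiff_inter_right_comm, (hpw.1 T' hT').symm.mono_left inter_subset_right |>.sdiff_eq_left]
    have h2 := overlap_le_choose hpw.2 (S \ T)
    have h3 := card_inter_add_card_sdiff S T
    have h4 : #S - #(S ∩ T) = #(S \ T) := by omega
    rw [h0, h4]
    simp only [overlap, List.map_cons, List.sum_cons] at h1 h2 ⊢
    omega

lemma card_filter_inter_le (R T : Finset V) {u d : ℕ} :
    #{S ∈ R.powersetCard u | #(S ∩ T) = d} ≤ (#T).choose d * (#R).choose (u - d) := by
  rw [← card_powersetCard, ← card_powersetCard, ← card_product]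
  refine card_le_card_of_injOn (fun S => (S ∩ T, S \ T)) ?_ ?_
  · intro S hS
    simp only [coe_filter, mem_powersetCard, Set.mem_ofPred_eq, coe_product, Set.mem_prod,
      mem_coe] at hS ⊢
    have h3 := card_inter_add_card_sdiff S T
    exact ⟨⟨inter_subset_right, hS.2⟩, sdiff_subset.trans hS.1.1, by omega⟩
  · intro S _ S' _ h
    simp only [Prod.mk.injEq] at h
    rw [← sdiff_union_inter S T, ← sdiff_union_inter S' T, h.1, h.2]

/-- Contribution of the sets meeting one of the parts in more than `D` points. -/
lemma sum_big_overlap_le {b κ t : ℝ} {D u n : ℕ} {l : List (Finset V)} (hl : l.Pairwise Disjoint)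
    (hb : 1 ≤ b) (hκ : 0 ≤ κ) (ht : 0 ≤ t)
    (hT : ∀ T ∈ l, ∀ d ≤ u, ((#T).choose d : ℝ) ≤ κ * t ^ (u - d))
    (hD : 4 * (n * t) ≤ b ^ (D + 1)) {R : Finset V} (hR : #R ≤ n) :
    ∑ S ∈ R.powersetCard u, (if ∃ T ∈ l, D < #(S ∩ T) then b ^ overlap l S else 0) ≤
      l.length * κ * b ^ u.choose 2 * (4 / 3) := by
  have hb0 : 0 < b := by linarith
  have key : ∀ T ∈ l, ∑ S ∈ R.powersetCard u, (if D < #(S ∩ T) then b ^ overlap l S else 0) ≤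
      κ * b ^ u.choose 2 * (4 / 3) := by
    intro T hTl
    have hmaps : ∀ S ∈ R.powersetCard u, #(S ∩ T) ∈ range (u + 1) := by
      intro S hS
      rw [mem_range, Nat.lt_succ_iff, ← (mem_powersetCard.1 hS).2]
      exact card_le_card inter_subset_left
    rw [← sum_fiberwise_of_maps_to hmaps]
    have h1 : ∀ d ∈ range (u + 1),
        ∑ S ∈ R.powersetCard u with #(S ∩ T) = d,
          (if D < #(S ∩ T) then b ^ overlap l S else 0) ≤
        κ * b ^ u.choose 2 * (1 / 4) ^ (u + 1 - 1 - d) := by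
      intro d hd
      have hdu : d ≤ u := by simpa [Nat.lt_succ_iff] using hd
      rw [Nat.add_sub_cancel]
      by_cases hDd : D < d
      · obtain ⟨e, rfl⟩ := Nat.exists_eq_add_of_le hdu
        have hterm : ∀ S ∈ (R.powersetCard (d + e)).filter (fun S => #(S ∩ T) = d),
            (if D < #(S ∩ T) then b ^ overlap l S else 0) ≤ b ^ (d.choose 2 + e.choose 2) := by
          intro S hS
          rw [mem_filter, mem_powersetCard] at hS
          rw [hS.2, if_pos hDd]
          have := overlap_le hl S hTl
          rw [hS.2, hS.1.2, Nat.add_sub_cancel_left] at this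
          exact pow_le_pow_right₀ hb this
        refine (sum_le_card_nsmul _ _ _ hterm).trans ?_
        rw [nsmul_eq_mul, Nat.add_sub_cancel_left]
        have hc : (#{S ∈ R.powersetCard (d + e) | #(S ∩ T) = d} : ℝ) ≤ κ * t ^ e * n ^ e := by
          have h2 : (#{S ∈ R.powersetCard (d + e) | #(S ∩ T) = d} : ℝ) ≤
              (#T).choose d * (#R).choose e := by
            have := card_filter_inter_le R T (u := d + e) (d := d)
            rw [Nat.add_sub_cancel_left] at this
            exact_mod_cast this
          refine h2.trans (mul_le_mul ?_ ?_ (by positivity) (by positivity))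
          · have := hT T hTl d hdu
            rwa [Nat.add_sub_cancel_left] at this
          · have : (#R).choose e ≤ n ^ e :=
              (Nat.choose_le_pow _ _).trans (Nat.pow_le_pow_left hR e)
            exact_mod_cast this
        have hbd : (4 * (n * t)) ^ e ≤ b ^ (d * e) := by
          rw [pow_mul]
          exact pow_le_pow_left₀ (by positivity)
            (hD.trans (pow_le_pow_right₀ hb hDd)) e
        calc _ ≤ κ * t ^ e * n ^ e * b ^ (d.choose 2 + e.choose 2) :=
              mul_le_mul_of_nonneg_right hc (by positivity)
          _ = κ * b ^ (d.choose 2 + e.choose 2) * (1 / 4) ^ e * (4 * (n * t)) ^ e := by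
              rw [mul_pow 4, div_pow, one_pow, mul_pow]
              field_simp
          _ ≤ κ * b ^ (d.choose 2 + e.choose 2) * (1 / 4) ^ e * b ^ (d * e) :=
              mul_le_mul_of_nonneg_left hbd (by positivity)
          _ = _ := by rw [choose_two_add, pow_add b (_ + _)]; ring
      · rw [sum_eq_zero]
        · positivity
        · intro S hS
          rw [mem_filter] at hS
          rw [hS.2, if_neg hDd]
    refine (sum_le_sum h1).trans ?_
    rw [← mul_sum, sum_range_reflect (fun e => (1 / 4 : ℝ) ^ e)]
    refine mul_le_mul_of_nonneg_left ?_ (by positivity)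
    rw [geom_sum_eq (by norm_num), div_le_iff_of_neg (by norm_num)]
    have : (0:ℝ) ≤ (1 / 4) ^ (u + 1) := by positivity
    linarith
  have h2 : ∀ S, (if ∃ T ∈ l, D < #(S ∩ T) then b ^ overlap l S else 0) ≤
      (l.map fun T => if D < #(S ∩ T) then b ^ overlap l S else 0).sum := by
    intro S
    have hnn : ∀ x ∈ l.map fun T => if D < #(S ∩ T) then b ^ overlap l S else 0, 0 ≤ x := by
      intro x hx
      obtain ⟨T, -, rfl⟩ := List.mem_map.1 hx
      split_ifs <;> positivity
    split_ifs with h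
    · obtain ⟨T, hT, hD⟩ := h
      refine List.single_le_sum hnn _ (List.mem_map.2 ⟨T, hT, if_pos hD⟩)
    · exact List.sum_nonneg hnn
  refine (sum_le_sum fun S _ => h2 S).trans ?_
  have h3 : ∀ l' : List (Finset V), (∀ T ∈ l', T ∈ l) → ∑ S ∈ R.powersetCard u,
      (l'.map fun T => if D < #(S ∩ T) then b ^ overlap l S else 0).sum ≤
      l'.length * (κ * b ^ u.choose 2 * (4 / 3)) := by
    intro l' hl'
    induction l' with
    | nil => simp
    | cons T l' ih =>
      simp only [List.map_cons, List.sum_cons, sum_add_distrib, List.length_cons]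
      have := ih fun T' hT' => hl' T' (List.mem_cons_of_mem _ hT')
      have := key T (hl' T List.mem_cons_self)
      push_cast
      linarith
  refine (h3 l fun T h => h).trans_eq (by ring)

lemma choose_sub_mul_pow_le {m u : ℕ} (hu : u ≤ m) {t : ℕ} (ht : t ≤ u) :
    (m - t).choose (u - t) * m ^ t ≤ m.choose u * u ^ t := by
  induction t with
  | zero => simp
  | succ t ih =>
    have ih := ih (by omega)
    obtain ⟨u', rfl⟩ := Nat.exists_eq_add_of_lt (show t < u by omega)
    obtain ⟨m', rfl⟩ := Nat.exists_eq_add_of_lt (show t < m by omega)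
    have e1 : t + m' + 1 - (t + 1) = m' := by omega
    have e2 : t + u' + 1 - (t + 1) = u' := by omega
    have e3 : t + m' + 1 - t = m' + 1 := by omega
    have e4 : t + u' + 1 - t = u' + 1 := by omega
    rw [e1, e2]
    rw [e3, e4] at ih
    have h1 := Nat.add_one_mul_choose_eq m' u'
    have h2 : m'.choose u' * (t + m' + 1) ≤ (m' + 1).choose (u' + 1) * (t + u' + 1) := by
      refine Nat.le_of_mul_le_mul_left ?_ (Nat.succ_pos m')
      have h3 : (u' + 1) * (t + m' + 1) ≤ (m' + 1) * (t + u' + 1) := by nlinarith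
      calc (m' + 1) * (m'.choose u' * (t + m' + 1))
          = (m' + 1).choose (u' + 1) * ((u' + 1) * (t + m' + 1)) := by rw [← mul_assoc, h1]; ring
        _ ≤ (m' + 1).choose (u' + 1) * ((m' + 1) * (t + u' + 1)) := Nat.mul_le_mul_left _ h3
        _ = _ := by rw [Nat.succ_eq_add_one]; ring
    calc m'.choose u' * (t + m' + 1) ^ (t + 1)
        = (m'.choose u' * (t + m' + 1)) * (t + m' + 1) ^ t := by ring
      _ ≤ ((m' + 1).choose (u' + 1) * (t + u' + 1)) * (t + m' + 1) ^ t :=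
          Nat.mul_le_mul_right _ h2
      _ = ((m' + 1).choose (u' + 1) * (t + m' + 1) ^ t) * (t + u' + 1) := by ring
      _ ≤ ((t + m' + 1).choose (t + u' + 1) * (t + u' + 1) ^ t) * (t + u' + 1) :=
          Nat.mul_le_mul_right _ ih
      _ = _ := by ring

lemma card_filter_superset_le (R T : Finset V) (u : ℕ) (hu : u ≤ #R) (hR : 0 < #R) :
    (#{S ∈ R.powersetCard u | T ⊆ S} : ℝ) ≤ (#R).choose u * (u / #R) ^ #T := by
  rcases (filter (fun S => T ⊆ S) (R.powersetCard u)).eq_empty_or_nonempty with h | ⟨S₀, hS₀⟩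
  · rw [h]; simp; positivity
  · rw [mem_filter, mem_powersetCard] at hS₀
    have hTR : T ⊆ R := hS₀.2.trans hS₀.1.1
    have hTu : #T ≤ u := hS₀.1.2 ▸ card_le_card hS₀.2
    have h1 : #{S ∈ R.powersetCard u | T ⊆ S} ≤ (#R - #T).choose (u - #T) := by
      rw [← card_sdiff_of_subset hTR, ← card_powersetCard]
      refine card_le_card_of_injOn (fun S => S \ T) ?_ ?_
      · intro S hS
        simp only [coe_filter, mem_powersetCard, Set.mem_ofPred_eq, mem_coe] at hS ⊢
        exact ⟨sdiff_subset_sdiff hS.1.1 le_rfl, by rw [card_sdiff_of_subset hS.2, hS.1.2]⟩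
      · intro S hS S' hS' h
        simp only [coe_filter, mem_powersetCard, Set.mem_ofPred_eq] at hS hS' h
        rw [← sdiff_union_of_subset hS.2, ← sdiff_union_of_subset hS'.2, h]
    have h2 := (Nat.mul_le_mul_right (#R ^ #T) h1).trans (choose_sub_mul_pow_le hu hTu)
    rw [div_pow, ← mul_div_assoc, le_div_iff₀ (by positivity)]
    exact_mod_cast h2

/-- Contribution of the sets meeting every part in at most `D` points. -/
lemma sum_small_overlap_le {b g : ℝ} {D u : ℕ} {l : List (Finset V)} (hl : l.Pairwise Disjoint)
    (hb : 1 ≤ b) {R : Finset V} (hu : u ≤ #R) (hR : 0 < #R)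
    (hg : ∀ T ∈ l, ∑ e ∈ Icc 2 D, ((#T).choose e : ℝ) * b ^ e.choose 2 * (u / #R) ^ e ≤ g) :
    ∑ S ∈ R.powersetCard u, (if ∃ T ∈ l, D < #(S ∩ T) then 0 else b ^ overlap l S) ≤
      (#R).choose u * (1 + g) ^ l.length := by
  have hb0 : 0 < b := by linarith
  set f : Finset V → Finset V → ℝ := fun T S => 1 + ∑ e ∈ Icc 2 D, ∑ T' ∈ T.powersetCard e,
    b ^ e.choose 2 * (if T' ⊆ S then 1 else 0) with hf
  have hf1 : ∀ T S, 1 ≤ f T S := by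
    intro T S
    have : 0 ≤ ∑ e ∈ Icc 2 D, ∑ T' ∈ T.powersetCard e,
      b ^ e.choose 2 * (if T' ⊆ S then (1:ℝ) else 0) :=
      sum_nonneg fun e _ => sum_nonneg fun T' _ => by positivity
    simp only [hf]; linarith
  have hfT : ∀ T S, #(S ∩ T) ≤ D → b ^ (#(S ∩ T)).choose 2 ≤ f T S := by
    intro T S hST
    by_cases h2 : 2 ≤ #(S ∩ T)
    · have h3 : b ^ (#(S ∩ T)).choose 2 ≤ ∑ T' ∈ T.powersetCard #(S ∩ T),
          b ^ (#(S ∩ T)).choose 2 * (if T' ⊆ S then (1:ℝ) else 0) := by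
        refine le_trans ?_ (single_le_sum (fun T' _ => by positivity)
          (show S ∩ T ∈ T.powersetCard #(S ∩ T) from mem_powersetCard.2 ⟨inter_subset_right, rfl⟩))
        rw [if_pos inter_subset_left, mul_one]
      have h4 := h3.trans (single_le_sum (f := fun e => ∑ T' ∈ T.powersetCard e,
        b ^ e.choose 2 * (if T' ⊆ S then (1:ℝ) else 0))
        (fun e _ => sum_nonneg fun T' _ => by positivity) (mem_Icc.2 ⟨h2, hST⟩))
      simp only [hf]; linarith
    · rw [Nat.choose_eq_zero_of_lt (by omega), pow_zero]; exact hf1 T S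
  have h1 : ∀ S, (if ∃ T ∈ l, D < #(S ∩ T) then 0 else b ^ overlap l S) ≤
      (l.map fun T => f T S).prod := by
    intro S
    have : ∀ l' : List (Finset V), (∀ T ∈ l', #(S ∩ T) ≤ D) →
        b ^ overlap l' S ≤ (l'.map fun T => f T S).prod := by
      intro l' h'
      induction l' with
      | nil => simp [overlap]
      | cons T l' ih =>
        have ih := ih fun T' h => h' T' (List.mem_cons_of_mem _ h)
        simp only [overlap, List.map_cons, List.sum_cons, List.prod_cons, pow_add] at ih ⊢
        exact mul_le_mul (hfT T S (h' T List.mem_cons_self)) ih (by positivity)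
          (by linarith [hf1 T S])
    split_ifs with h
    · refine List.prod_nonneg fun x hx => ?_
      obtain ⟨T, -, rfl⟩ := List.mem_map.1 hx
      linarith [hf1 T S]
    · push Not at h
      exact this l h
  refine (sum_le_sum fun S _ => h1 S).trans ?_
  have h2 : ∀ l' : List (Finset V), (∀ T ∈ l', T ∈ l) → l'.Pairwise Disjoint → ∀ T₀ : Finset V,
      (∀ T ∈ l', Disjoint T₀ T) →
      ∑ S ∈ R.powersetCard u, (if T₀ ⊆ S then 1 else 0) * (l'.map fun T => f T S).prod ≤
        (#R).choose u * (u / #R) ^ #T₀ * (1 + g) ^ l'.length := by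
    intro l'
    induction l' with
    | nil =>
      intro _ _ T₀ _
      simpa using card_filter_superset_le R T₀ u hu hR
    | cons T l' ih =>
      intro hsub hpw T₀ hd
      rw [List.pairwise_cons] at hpw
      have ih := ih (fun T' h => hsub T' (List.mem_cons_of_mem _ h)) hpw.2
      have hsplit : ∀ S, (if T₀ ⊆ S then (1:ℝ) else 0) * ((T :: l').map fun T => f T S).prod =
          (if T₀ ⊆ S then 1 else 0) * (l'.map fun T => f T S).prod +
          ∑ e ∈ Icc 2 D, ∑ T' ∈ T.powersetCard e, b ^ e.choose 2 *
            ((if T₀ ∪ T' ⊆ S then 1 else 0) * (l'.map fun T => f T S).prod) := by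
        intro S
        simp only [List.map_cons, List.prod_cons]
        rw [show f T S = 1 + ∑ e ∈ Icc 2 D, ∑ T' ∈ T.powersetCard e,
          b ^ e.choose 2 * (if T' ⊆ S then 1 else 0) from rfl, add_mul, mul_add, one_mul, sum_mul,
          mul_sum]
        congr 1
        refine sum_congr rfl fun e _ => ?_
        rw [sum_mul, mul_sum]
        refine sum_congr rfl fun T' _ => ?_
        by_cases h1 : T₀ ⊆ S <;> by_cases h2 : T' ⊆ S <;> simp [union_subset_iff, h1, h2]
      simp only [hsplit]
      rw [sum_add_distrib, sum_comm]
      have hpart : ∀ e ∈ Icc 2 D, ∑ S ∈ R.powersetCard u, ∑ T' ∈ T.powersetCard e,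
          b ^ e.choose 2 * ((if T₀ ∪ T' ⊆ S then 1 else 0) * (l'.map fun T => f T S).prod) ≤
          ((#T).choose e : ℝ) * b ^ e.choose 2 * (u / #R) ^ e *
            ((#R).choose u * (u / #R) ^ #T₀ * (1 + g) ^ l'.length) := by
        intro e _
        rw [sum_comm]
        have : ∀ T' ∈ T.powersetCard e, ∑ S ∈ R.powersetCard u,
            b ^ e.choose 2 * ((if T₀ ∪ T' ⊆ S then 1 else 0) * (l'.map fun T => f T S).prod) ≤
            b ^ e.choose 2 * (u / #R) ^ e *
              ((#R).choose u * (u / #R) ^ #T₀ * (1 + g) ^ l'.length) := by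
          intro T' hT'
          rw [mem_powersetCard] at hT'
          have hdT : Disjoint T₀ T' := (hd T List.mem_cons_self).mono_right hT'.1
          have := ih (T₀ ∪ T') (fun U hU => disjoint_union_left.2
            ⟨hd U (List.mem_cons_of_mem _ hU), (hpw.1 U hU).mono_left hT'.1⟩)
          rw [card_union_of_disjoint hdT, hT'.2] at this
          rw [← mul_sum]
          refine (mul_le_mul_of_nonneg_left this (by positivity)).trans_eq ?_
          rw [pow_add]; ring
        refine (sum_le_card_nsmul _ _ _ this).trans_eq ?_
        rw [card_powersetCard, nsmul_eq_mul]; ring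
      have hg0 : 0 ≤ g := le_trans (sum_nonneg fun e _ => by positivity)
        (hg T (hsub T List.mem_cons_self))
      have h3 := ih T₀ fun U hU => hd U (List.mem_cons_of_mem _ hU)
      have h4 := sum_le_sum hpart
      rw [← sum_mul] at h4
      have h5 := h4.trans (mul_le_mul_of_nonneg_right (hg T (hsub T List.mem_cons_self))
        (by positivity))
      refine (add_le_add h3 h5).trans_eq ?_
      rw [List.length_cons]; ring
  simpa using h2 l (fun T h => h) hl ∅ (fun T _ => disjoint_empty_left T)

end Weights

section SecondMoment

/-- The number of ordered families of disjoint independent sets with the prescribed sizes. -/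
noncomputable def indepCount (n : ℕ) (us : List ℕ) (A : Finset (Sym2 (Fin n))) : ℝ :=
  sumParts us univ fun l => if Disjoint (partPairs l) A then 1 else 0

lemma sumParts_nonneg {V : Type*} [DecidableEq V] {us : List ℕ} {R : Finset V}
    {F : List (Finset V) → ℝ} (h : ∀ l, 0 ≤ F l) : 0 ≤ sumParts us R F := by
  have := sumParts_mono (us := us) (R := R) (F := fun _ => 0) (G := F) fun l _ => h l
  rwa [sumParts_const, mul_zero] at this

lemma indepCount_nonneg (n : ℕ) (us : List ℕ) (A : Finset (Sym2 (Fin n))) :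
    0 ≤ indepCount n us A :=
  sumParts_nonneg fun l => by positivity

lemma ev_indepCount (p : ℝ) (n : ℕ) (us : List ℕ) :
    ev p (pairs univ) (indepCount n us) =
      cntParts us n * (1 - p) ^ (us.map fun u => u.choose 2).sum := by
  unfold indepCount
  rw [ev_sumParts p _ us univ fun A l => if Disjoint (partPairs l) A then 1 else 0]
  rw [sumParts_congr (G := fun _ => (1 - p) ^ (us.map fun u => u.choose 2).sum), sumParts_const,
    card_univ, Fintype.card_fin]
  intro l hl
  rw [ev_disjoint p (partPairs_subset hl.subset), hl.card_partPairs]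

lemma prod_map_pow_eq {α : Type*} (b : ℝ) (f : α → ℕ) (l : List α) :
    (l.map fun a => b ^ f a).prod = b ^ (l.map f).sum := by
  induction l with
  | nil => simp
  | cons a l ih => simp [ih, pow_add]

lemma ev_indepCount_sq_le {p B : ℝ} (hp0 : 0 < p) (hp1 : p < 1) (n : ℕ) (us : List ℕ)
    (hB : ∀ l, IsParts us (univ : Finset (Fin n)) l →
      wsum (us.map fun u => (u, fun S => (1 / (1 - p)) ^ overlap l S)) univ ≤
        B * cntParts us n) :
    ev p (pairs univ) (fun A => indepCount n us A ^ 2) ≤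
      B * (ev p (pairs univ) (indepCount n us)) ^ 2 := by
  have hq : 0 < 1 - p := by linarith
  set b := 1 / (1 - p) with hb
  have hb1 : 1 ≤ b := by rw [hb, le_div_iff₀ hq]; linarith
  have hqb : (1 - p) * b = 1 := by rw [hb]; field_simp
  set m := (us.map fun u => u.choose 2).sum with hm
  have hsq : ∀ A : Finset (Sym2 (Fin n)), indepCount n us A ^ 2 =
      sumParts us univ fun l => sumParts us univ fun l' =>
        if Disjoint (partPairs l ∪ partPairs l') A then 1 else 0 := by
    intro A
    have h1 : ∀ l l' : List (Finset (Fin n)),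
        (if Disjoint (partPairs l ∪ partPairs l') A then (1:ℝ) else 0) =
        (if Disjoint (partPairs l) A then 1 else 0) *
        (if Disjoint (partPairs l') A then 1 else 0) := by
      intro l l'
      by_cases h1 : Disjoint (partPairs l) A <;> by_cases h2 : Disjoint (partPairs l') A <;>
        simp [disjoint_union_left, h1, h2]
    simp only [h1, sumParts_mul_left]
    have h2 : ∀ l : List (Finset (Fin n)), (if Disjoint (partPairs l) A then (1:ℝ) else 0) *
        (sumParts us univ fun l' => if Disjoint (partPairs l') A then 1 else 0) =
        indepCount n us A * if Disjoint (partPairs l) A then (1:ℝ) else 0 :=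
      fun l => mul_comm _ _
    simp only [h2, sumParts_mul_left]
    rw [sq]; rfl
  simp only [hsq]
  rw [ev_sumParts p _ us univ fun A l => sumParts us univ fun l' =>
        if Disjoint (partPairs l ∪ partPairs l') A then 1 else 0]
  refine (sumParts_mono (G := fun _ => ((1 - p) ^ m) ^ 2 * (B * cntParts us n))
    fun l hl => ?_).trans ?_
  · rw [ev_sumParts p _ us univ fun A l' =>
        if Disjoint (partPairs l ∪ partPairs l') A then 1 else 0]
    refine (sumParts_mono (G := fun l' => ((1 - p) ^ m) ^ 2 * (l'.map fun S => b ^ overlap l S).prod)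
      fun l' hl' => ?_).trans ?_
    · rw [ev_disjoint p (union_subset (partPairs_subset hl.subset) (partPairs_subset hl'.subset)),
        prod_map_pow_eq]
      have h1 := card_union_add_card_inter (partPairs l) (partPairs l')
      rw [hl.card_partPairs, hl'.card_partPairs, ← hm] at h1
      have h2 := card_partPairs_inter_le l l'
      rw [inter_comm] at h2
      calc (1 - p) ^ #(partPairs l ∪ partPairs l')
          = (1 - p) ^ #(partPairs l ∪ partPairs l') *
              ((1 - p) * b) ^ #(partPairs l ∩ partPairs l') := by rw [hqb, one_pow, mul_one]
        _ = (1 - p) ^ (m + m) * b ^ #(partPairs l ∩ partPairs l') := by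
            rw [← h1, pow_add, mul_pow]; ring
        _ ≤ (1 - p) ^ (m + m) * b ^ (l'.map (overlap l)).sum :=
            mul_le_mul_of_nonneg_left (pow_le_pow_right₀ hb1 h2) (by positivity)
        _ = _ := by rw [pow_add, ← sq]
    · rw [sumParts_mul_left, sumParts_prod_eq_wsum]
      exact mul_le_mul_of_nonneg_left (hB l hl) (by positivity)
  · rw [sumParts_const, ev_indepCount, card_univ, Fintype.card_fin]
    exact le_of_eq (by ring)

/-- Second moment bound for families of disjoint independent sets. -/
theorem indepCount_second_moment {p κ t g ζ C₀ : ℝ} {D m₀ n : ℕ} {us : List ℕ}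
    (hp0 : 0 < p) (hp1 : p < 1) (hκ : 0 ≤ κ) (ht : 0 ≤ t) (hζ : 0 ≤ ζ) (hC : 0 ≤ C₀)
    (hg0 : 0 ≤ g) (hm₀ : 0 < m₀) (hum : ∀ u ∈ us, u ≤ m₀)
    (hT : ∀ v ∈ us, ∀ u ∈ us, ∀ d ≤ u, (v.choose d : ℝ) ≤ κ * t ^ (u - d))
    (hD : 4 * (n * t) ≤ (1 / (1 - p)) ^ (D + 1))
    (hg : ∀ v ∈ us, ∀ u ∈ us,
      ∑ e ∈ Icc 2 D, (v.choose e : ℝ) * (1 / (1 - p)) ^ e.choose 2 * (u / m₀) ^ e ≤ g)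
    (hn : us.sum + m₀ ≤ n)
    (hJ : ∀ vs : List ℕ, vs.Subperm us →
      (vs.map fun u => us.length * κ * (1 / (1 - p)) ^ u.choose 2 * (4 / 3) * u.factorial).prod *
        (n - vs.sum).factorial ≤ C₀ * ζ ^ vs.length * n.factorial) :
    ev p (pairs univ) (fun A => indepCount n us A ^ 2) ≤
      (C₀ * ((1 + g) ^ us.length) ^ us.length * (1 + ζ) ^ us.length) *
        (ev p (pairs univ) (indepCount n us)) ^ 2 := by
  have hq : 0 < 1 - p := by linarith
  set b := 1 / (1 - p) with hb
  have hb1 : 1 ≤ b := by rw [hb, le_div_iff₀ hq]; linarith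
  refine ev_indepCount_sq_le hp0 hp1 n us fun l hl => ?_
  have hsplit : ∀ S : Finset (Fin n), b ^ overlap l S =
      (if ∃ T ∈ l, D < #(S ∩ T) then b ^ overlap l S else 0) +
      (if ∃ T ∈ l, D < #(S ∩ T) then 0 else b ^ overlap l S) := by
    intro S; split_ifs <;> simp
  simp only [← hb]
  rw [show (fun S : Finset (Fin n) => b ^ overlap l S) = _ from funext hsplit]
  have := wsum_le_of_split (us := us) (m₀ := m₀) (M := (1 + g) ^ us.length)
    (K := fun u => us.length * κ * b ^ u.choose 2 * (4 / 3)) (C₀ := C₀) (ζ := ζ)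
    (wb := fun S => if ∃ T ∈ l, D < #(S ∩ T) then b ^ overlap l S else 0)
    (ws := fun S => if ∃ T ∈ l, D < #(S ∩ T) then 0 else b ^ overlap l S)
    (fun S => by positivity) (fun S => by positivity) (one_le_pow₀ (by linarith))
    (fun u => by positivity) hζ hC ?_ ?_ (univ : Finset (Fin n)) (by simpa using hn)
    (by simpa using hJ)
  · simpa using this
  · intro u hu R
    rw [← hl.length_eq]
    exact sum_big_overlap_le hl.pairwise hb1 hκ ht
      (fun T hT' d hd => hT _ (hl.card_mem T hT') u hu d hd) hD (by simpa using card_le_univ R)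
  · intro u hu R hR
    rw [← hl.length_eq]
    refine sum_small_overlap_le hl.pairwise hb1 ((hum u hu).trans hR) (hm₀.trans_le hR)
      fun T hT' => (sum_le_sum fun e _ => ?_).trans (hg _ (hl.card_mem T hT') u hu)
    have : (0:ℝ) < m₀ := by exact_mod_cast hm₀
    have : (m₀:ℝ) ≤ #R := by exact_mod_cast hR
    gcongr

end SecondMoment

section Coupling

/-- The probability that the chromatic number of `G_{n,p}` is at most `x`. -/
noncomputable def probLe (p : ℝ) (n : ℕ) (x : ℝ) : ℝ :=
  ev p (pairs (univ : Finset (Fin n))) fun A => if (chi A : ℝ) ≤ x then 1 else 0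

/-- The probability that the chromatic number of `G_{n,p}` is at least `x`. -/
noncomputable def probGe (p : ℝ) (n : ℕ) (x : ℝ) : ℝ :=
  ev p (pairs (univ : Finset (Fin n))) fun A => if x ≤ (chi A : ℝ) then 1 else 0

lemma sym2_map_notMem_pairs_iff {V : Type*} [DecidableEq V] {S : Finset V} {A : Finset (Sym2 V)}
    (h : Disjoint (pairs S) A) {a b : V} (ha : a ∈ S) (hb : b ∈ S) (hab : a ≠ b) : s(a, b) ∉ A :=
  fun h' => disjoint_left.1 h (mem_pairs.2 ⟨ha, hb, hab⟩) h'

lemma pairs_subset_partPairs {V : Type*} [DecidableEq V] {l : List (Finset V)} {S : Finset V}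
    (h : S ∈ l) : pairs S ⊆ partPairs l := by
  induction l with
  | nil => simp at h
  | cons T l ih =>
    rw [partPairs_cons]
    rcases List.mem_cons.1 h with rfl | h
    · exact subset_union_left
    · exact (ih h).trans subset_union_right

/-- Colour the vertices outside the independent sets of `l` through `f`, and every set of `l` with a
new colour. -/
lemma chi_le_add_of_embedding {n m a : ℕ} {A : Finset (Sym2 (Fin n))} {l : List (Finset (Fin n))}
    (f : Fin m ↪ Fin n) (hf : ∀ v, (∀ T ∈ l, v ∉ T) → v ∈ Set.range f)
    (hA : Disjoint (partPairs l) A)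
    (hcol : ((SimpleGraph.fromEdgeSet (A : Set (Sym2 (Fin n)))).comap f).Colorable a) :
    chi A ≤ a + l.length := by
  classical
  unfold chi
  rw [chrom_le_iff]
  obtain ⟨c⟩ := hcol
  have hex : ∀ v, ∃ x : Fin a ⊕ Fin l.length,
      (∃ i, x = Sum.inr i ∧ v ∈ l[i]) ∨ (∃ w, f w = v ∧ x = Sum.inl (c w)) := by
    intro v
    by_cases h : ∃ T ∈ l, v ∈ T
    · obtain ⟨T, hT, hv⟩ := h
      obtain ⟨i, hi, rfl⟩ := List.mem_iff_getElem.1 hT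
      exact ⟨Sum.inr ⟨i, hi⟩, Or.inl ⟨⟨i, hi⟩, rfl, hv⟩⟩
    · push Not at h
      obtain ⟨w, hw⟩ := hf v h
      exact ⟨Sum.inl (c w), Or.inr ⟨w, hw, rfl⟩⟩
  choose d hd using hex
  have : (SimpleGraph.fromEdgeSet (A : Set (Sym2 (Fin n)))).Coloring (Fin a ⊕ Fin l.length) := by
    refine SimpleGraph.Coloring.mk d ?_
    intro v w hvw hdvw
    rcases hd v with ⟨i, hi, hvi⟩ | ⟨x, hx, hxc⟩ <;> rcases hd w with ⟨j, hj, hwj⟩ | ⟨y, hy, hyc⟩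
    · rw [hi, hj, Sum.inr.injEq] at hdvw
      subst hdvw
      rw [SimpleGraph.fromEdgeSet_adj] at hvw
      exact sym2_map_notMem_pairs_iff (hA.mono_left (pairs_subset_partPairs (List.getElem_mem _)))
        hvi hwj hvw.2 hvw.1
    · rw [hi, hyc] at hdvw; simp at hdvw
    · rw [hxc, hj] at hdvw; simp at hdvw
    · rw [hxc, hyc, Sum.inl.injEq] at hdvw
      subst hx hy
      exact c.valid (v := x) (w := y) hvw hdvw
  have h2 := this.colorable
  simpa using h2

lemma IsParts.exists_complement {V : Type*} [DecidableEq V] {us : List ℕ} {R : Finset V}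
    {l : List (Finset V)} (h : IsParts us R l) :
    ∃ W ⊆ R, #W + us.sum = #R ∧ (∀ T ∈ l, Disjoint W T) ∧ ∀ v ∈ R, (∀ T ∈ l, v ∉ T) → v ∈ W := by
  induction us generalizing R l with
  | nil => cases l with
    | nil => exact ⟨R, Subset.rfl, by simp, by simp, fun v hv _ => hv⟩
    | cons => exact h.elim
  | cons u us ih => cases l with
    | nil => exact h.elim
    | cons S l =>
      obtain ⟨W, hW, hc, hd, hv⟩ := ih h.2
      have hS := mem_powersetCard.1 h.1
      refine ⟨W, hW.trans sdiff_subset, ?_, ?_, ?_⟩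
      · rw [card_sdiff_of_subset hS.1, hS.2] at hc
        have := card_le_card hS.1
        rw [hS.2] at this
        rw [List.sum_cons]; omega
      · intro T hT
        rcases List.mem_cons.1 hT with rfl | hT
        · exact disjoint_sdiff.symm.mono_left hW
        · exact hd T hT
      · intro v hvR hvT
        exact hv v (mem_sdiff.2 ⟨hvR, hvT S List.mem_cons_self⟩)
          fun T hT => hvT T (List.mem_cons_of_mem _ hT)

lemma IsParts.exists_embedding {n m : ℕ} {us : List ℕ} (hn : n = m + us.sum)
    {l : List (Finset (Fin n))} (h : IsParts us univ l) :
    ∃ f : Fin m ↪ Fin n, (∀ x, ∀ T ∈ l, f x ∉ T) ∧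
      ∀ v, (∀ T ∈ l, v ∉ T) → v ∈ Set.range f := by
  obtain ⟨W, -, hc, hd, hv⟩ := h.exists_complement
  rw [card_univ, Fintype.card_fin] at hc
  have hWm : #W = m := by omega
  refine ⟨(W.orderEmbOfFin hWm).toEmbedding, fun x T hT => ?_, fun v hvT => ?_⟩
  · exact disjoint_left.1 (hd T hT) (orderEmbOfFin_mem W hWm x)
  · have := hv v (mem_univ v) hvT
    simpa using this

lemma chi_le_of_indepCount_pos {n m : ℕ} {us : List ℕ} (hn : n = m + us.sum)
    {A : Finset (Sym2 (Fin n))} (h : 0 < indepCount n us A) : chi A ≤ m + us.length := by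
  classical
  have hex : ∃ l, IsParts us (univ : Finset (Fin n)) l ∧ Disjoint (partPairs l) A := by
    by_contra! hcon
    have : indepCount n us A = 0 := by
      unfold indepCount
      rw [sumParts_congr (G := fun _ => 0), sumParts_const, mul_zero]
      intro l hl
      rw [if_neg (hcon l hl)]
    linarith
  obtain ⟨l, hl, hd⟩ := hex
  obtain ⟨f, -, hf⟩ := hl.exists_embedding hn
  rw [← hl.length_eq]
  exact chi_le_add_of_embedding f hf hd (by
    simpa using SimpleGraph.colorable_of_fintype
      ((SimpleGraph.fromEdgeSet (A : Set (Sym2 (Fin n)))).comap f))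

lemma disjoint_partPairs_iff {V : Type*} [DecidableEq V] {l : List (Finset V)}
    {F : Finset (Sym2 V)} : Disjoint (partPairs l) F ↔ ∀ T ∈ l, Disjoint (pairs T) F := by
  induction l with
  | nil => simp
  | cons T l ih => rw [partPairs_cons, disjoint_union_left, ih]; simp

open scoped Classical in
lemma ev_colorable_comap {n m a : ℕ} (p : ℝ) (f : Fin m ↪ Fin n) {E : Finset (Sym2 (Fin n))}
    (hE : (pairs (univ : Finset (Fin m))).map f.sym2Map ⊆ E) :
    ev p E (fun A => if ((SimpleGraph.fromEdgeSet (A : Set (Sym2 (Fin n)))).comap f).Colorable a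
      then 1 else 0) = probLe p m a := by
  set P := (pairs (univ : Finset (Fin m))).map f.sym2Map with hP
  have hmem : ∀ x y : Fin m, x ≠ y → s(f x, f y) ∈ P := fun x y hxy =>
    mem_map.2 ⟨s(x, y), mem_pairs.2 ⟨mem_univ _, mem_univ _, hxy⟩, rfl⟩
  conv_lhs => rw [← union_sdiff_of_subset hE, ev_union p disjoint_sdiff]
  have h1 : ∀ A ⊆ P, ev p (E \ P) (fun B => if ((SimpleGraph.fromEdgeSet
      ((A ∪ B : Finset (Sym2 (Fin n))) : Set (Sym2 (Fin n)))).comap f).Colorable a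
      then (1:ℝ) else 0) = if ((SimpleGraph.fromEdgeSet (A : Set (Sym2 (Fin n)))).comap f).Colorable a
      then 1 else 0 := by
    intro A _
    refine (ev_congr p fun B hB => ?_).trans (ev_const p (E \ P) _)
    have : (SimpleGraph.fromEdgeSet ((A ∪ B : Finset (Sym2 (Fin n))) : Set (Sym2 (Fin n)))).comap f
        = (SimpleGraph.fromEdgeSet (A : Set (Sym2 (Fin n)))).comap f := by
      ext x y
      simp only [SimpleGraph.comap_adj, SimpleGraph.fromEdgeSet_adj, mem_coe, mem_union]
      refine ⟨fun h => ⟨h.1.resolve_right fun h' => ?_, h.2⟩, fun h => ⟨Or.inl h.1, h.2⟩⟩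
      exact (mem_sdiff.1 (hB h')).2 (hmem x y fun hxy => h.2 (hxy ▸ rfl))
    rw [this]
  rw [ev_congr p h1, hP, ev_map]
  unfold probLe
  refine ev_congr p fun A _ => ?_
  have : (SimpleGraph.fromEdgeSet ((A.map f.sym2Map : Finset (Sym2 (Fin n))) :
      Set (Sym2 (Fin n)))).comap f = SimpleGraph.fromEdgeSet (A : Set (Sym2 (Fin m))) := by
    ext x y
    simp only [SimpleGraph.comap_adj, SimpleGraph.fromEdgeSet_adj, mem_coe]
    rw [show s(f x, f y) = f.sym2Map s(x, y) from rfl, Finset.mem_map']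
    simp
  rw [this, ← chrom_le_iff]
  simp [chi]

/-- Adding independent sets to a graph with small chromatic number. -/
lemma probLe_mul_ev_indepCount_le {p : ℝ} (hp0 : 0 ≤ p) (hp1 : p ≤ 1) {n m : ℕ} {us : List ℕ}
    (hn : n = m + us.sum) (a : ℕ) :
    probLe p m a * ev p (pairs univ) (indepCount n us) ≤
      ev p (pairs univ) fun A => indepCount n us A *
        if (chi A : ℝ) ≤ (a + us.length : ℕ) then 1 else 0 := by
  classical
  have h1 : ∀ A : Finset (Sym2 (Fin n)),
      indepCount n us A * (if (chi A : ℝ) ≤ (a + us.length : ℕ) then 1 else 0) =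
      sumParts us univ fun l => (if (chi A : ℝ) ≤ (a + us.length : ℕ) then 1 else 0) *
        if Disjoint (partPairs l) A then 1 else 0 := by
    intro A
    rw [sumParts_mul_left, mul_comm]; rfl
  simp only [h1]
  rw [ev_sumParts p _ us univ fun A l => (if (chi A : ℝ) ≤ (a + us.length : ℕ) then 1 else 0) *
        if Disjoint (partPairs l) A then 1 else 0, ev_indepCount]
  refine le_trans (le_of_eq ?_) (sumParts_mono (F := fun _ =>
    (1 - p) ^ (us.map fun u => u.choose 2).sum * probLe p m a) fun l hl => ?_)
  · rw [sumParts_const, card_univ, Fintype.card_fin]; ring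
  · obtain ⟨f, hf1, hf2⟩ := hl.exists_embedding hn
    have hsub := partPairs_subset hl.subset
    rw [← hl.card_partPairs, ← ev_colorable_comap p f (E := pairs univ \ partPairs l),
      ← ev_disjoint_mul p hsub]
    · refine ev_mono hp0 hp1 fun A _ => ?_
      by_cases hA : Disjoint (partPairs l) A
      · rw [if_pos hA, one_mul, mul_one, sdiff_eq_self_of_disjoint hA.symm]
        split_ifs with h2 h3
        · exact le_rfl
        · refine absurd ?_ h3
          have := chi_le_add_of_embedding f hf2 hA h2
          rw [hl.length_eq] at this
          exact_mod_cast this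
        · exact zero_le_one
        · exact le_rfl
      · simp [hA]
    · intro e he
      obtain ⟨e', he', rfl⟩ := mem_map.1 he
      induction e' with
      | h x y =>
        have hxy := (mem_pairs.1 he').2.2
        refine Finset.mem_sdiff.2 ⟨mem_pairs.2 ⟨mem_univ _, mem_univ _, f.injective.ne hxy⟩, ?_⟩
        rw [show f.sym2Map s(x, y) = s(f x, f y) from rfl, ← disjoint_singleton_right,
          disjoint_partPairs_iff]
        intro T hT
        rw [disjoint_singleton_right, mem_pairs]
        exact fun h => hf1 x T hT h.1

lemma probLe_add_probGe {p : ℝ} (n : ℕ) {a b : ℝ} (hp0 : 0 ≤ p) (hp1 : p ≤ 1) (hab : a < b) :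
    probLe p n a + probGe p n b ≤ 1 := by
  unfold probLe probGe
  rw [← ev_add]
  refine (ev_mono hp0 hp1 fun A _ => ?_).trans_eq (ev_const p _ 1)
  split_ifs <;> linarith

/-- If the second moment of the number of families of independent sets is small, then the typical
range of the chromatic number moves by at most the number of independent sets. -/
theorem le_add_length_of_second_moment {p B : ℝ} (hp0 : 0 < p) (hp1 : p < 1) {n m : ℕ}
    {us : List ℕ} (hn : n = m + us.sum)
    (hX : ev p (pairs univ) (fun A => indepCount n us A ^ 2) ≤
        B * (ev p (pairs univ) (indepCount n us)) ^ 2) (hB : B < 8.1)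
    {s t : ℝ} (hs : 0.9 ≤ probGe p n s) (ht : 0.9 ≤ probLe p m t) : s ≤ t + us.length := by
  by_contra! hlt
  have ht0 : 0 ≤ t := by
    by_contra! h
    have : probLe p m t = 0 := by
      unfold probLe
      rw [ev_congr (ψ := fun _ => 0), ev_const]
      intro A _
      rw [if_neg]
      have : (0:ℝ) ≤ chi A := by positivity
      linarith
    norm_num [this] at ht
  have hfl : probLe p m t = probLe p m (⌊t⌋₊ : ℕ) := by
    unfold probLe
    refine ev_congr p fun A _ => ?_
    simp only [Nat.cast_le, Nat.le_floor_iff ht0]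
  set X := indepCount n us with hXd
  have hq : 0 < 1 - p := by linarith
  set I := ev p (pairs univ) X with hI
  have hIpos : 0 < I := by
    rw [hI, ev_indepCount]
    have : cntParts us n ≠ 0 := by
      intro h0
      have h1 := cntParts_mul us n (by omega)
      rw [h0, zero_mul] at h1
      exact (Nat.factorial_pos n).ne h1
    have : (0:ℝ) < cntParts us n := by positivity
    positivity
  have h1 := probLe_mul_ev_indepCount_le hp0.le hp1.le hn ⌊t⌋₊
  rw [← hfl] at h1
  have h2 := ev_cauchy_schwarz hp0.le hp1.le (pairs univ) X
    fun A => if (chi A : ℝ) ≤ (⌊t⌋₊ + us.length : ℕ) then 1 else 0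
  have h3 : ev p (pairs univ) (fun A : Finset (Sym2 (Fin n)) =>
      (if (chi A : ℝ) ≤ (⌊t⌋₊ + us.length : ℕ) then (1:ℝ) else 0) ^ 2) ≤ 0.1 := by
    have h4 := probLe_add_probGe (p := p) n (a := (⌊t⌋₊ + us.length : ℕ)) (b := s) hp0.le hp1.le (by
      push_cast
      have := Nat.floor_le ht0
      linarith)
    have h5 : ev p (pairs univ) (fun A : Finset (Sym2 (Fin n)) =>
      (if (chi A : ℝ) ≤ (⌊t⌋₊ + us.length : ℕ) then (1:ℝ) else 0) ^ 2) =
        probLe p n (⌊t⌋₊ + us.length : ℕ) := by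
      unfold probLe
      refine ev_congr p fun A _ => ?_
      split_ifs <;> norm_num
    rw [h5]
    linarith
  have h6 : 0.9 * I ≤ ev p (pairs univ) (fun A => X A *
        if (chi A : ℝ) ≤ (⌊t⌋₊ + us.length : ℕ) then 1 else 0) :=
    (mul_le_mul_of_nonneg_right ht hIpos.le).trans h1
  have h7 : (0.9 * I) ^ 2 ≤ B * I ^ 2 * 0.1 :=
    (pow_le_pow_left₀ (by positivity) h6 2).trans (h2.trans
      (mul_le_mul hX h3 (ev_nonneg hp0.le hp1.le fun A _ => by positivity)
        (le_trans (ev_nonneg hp0.le hp1.le fun A _ => by positivity) hX)))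
  have : 0 < I ^ 2 := by positivity
  norm_num at h7 hB
  nlinarith

/-- Paley--Zygmund lower bound for the existence of a family of independent sets. -/
theorem one_le_mul_probLe_of_second_moment {p B : ℝ} (hp0 : 0 < p) (hp1 : p < 1) {n m : ℕ}
    {us : List ℕ} (hn : n = m + us.sum)
    (hX : ev p (pairs univ) (fun A => indepCount n us A ^ 2) ≤
        B * (ev p (pairs univ) (indepCount n us)) ^ 2) :
    1 ≤ B * probLe p n (m + us.length : ℕ) := by
  set X := indepCount n us with hXd
  have hq : 0 < 1 - p := by linarith
  set I := ev p (pairs univ) X with hI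
  have hIpos : 0 < I := by
    rw [hI, ev_indepCount]
    have : cntParts us n ≠ 0 := by
      intro h0
      have h1 := cntParts_mul us n (by omega)
      rw [h0, zero_mul] at h1
      exact (Nat.factorial_pos n).ne h1
    have : (0:ℝ) < cntParts us n := by positivity
    positivity
  have h2 := ev_cauchy_schwarz hp0.le hp1.le (pairs univ) X
    fun A => if (chi A : ℝ) ≤ (m + us.length : ℕ) then 1 else 0
  have h3 : ev p (pairs univ) (fun A => X A *
      (if (chi A : ℝ) ≤ (m + us.length : ℕ) then 1 else 0)) = I := by
    refine ev_congr p fun A _ => ?_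
    rcases (indepCount_nonneg n us A).lt_or_eq with h | h
    · have := chi_le_of_indepCount_pos hn h
      rw [if_pos (by exact_mod_cast this), mul_one]
    · simp [hXd, ← h]
  have h5 : ev p (pairs univ) (fun A : Finset (Sym2 (Fin n)) =>
      (if (chi A : ℝ) ≤ (m + us.length : ℕ) then (1:ℝ) else 0) ^ 2) =
        probLe p n (m + us.length : ℕ) := by
    unfold probLe
    refine ev_congr p fun A _ => ?_
    split_ifs <;> norm_num
  rw [h3, h5] at h2
  have hP : 0 ≤ probLe p n (m + us.length : ℕ) :=
    ev_nonneg hp0.le hp1.le fun A _ => by positivity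
  have h4 := h2.trans (mul_le_mul_of_nonneg_right hX hP)
  have : 0 < I ^ 2 := by positivity
  nlinarith

lemma probLe_mul_probGe_le {p : ℝ} (hp0 : 0 ≤ p) (hp1 : p ≤ 1) (n : ℕ) {l : ℝ} (hl0 : 0 ≤ l)
    (hl : l ≤ 1) (a w : ℝ) :
    probLe p n a * probGe p n (a + w) ≤ exp (2 * l ^ 2 * n - l * w) := by
  have := ev_le_mul_ev_ge_le hp0 hp1 (univ : Finset (Fin n)) (vertexLipschitz_chi n) hl0 hl a w
  simpa [probLe, probGe] using this

lemma probGe_of_gnpProb {p : ℝ} (hp0 : 0 ≤ p) (hp1 : p ≤ 1) {n : ℕ} {s t c : ℝ}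
    (h : c ≤ gnpProb n p {G | (chrom G : ℝ) ∈ Set.Icc s t}) :
    c ≤ probGe p n s ∧ c ≤ probLe p n t := by
  rw [gnpProb_eq_ev] at h
  constructor <;> refine h.trans (ev_mono hp0 hp1 fun A _ => ?_)
  · by_cases h1 : s ≤ (chi A : ℝ)
    · rw [if_pos h1]; split_ifs <;> norm_num
    · rw [if_neg h1]; split_ifs with h; exacts [absurd (Set.mem_Icc.1 h).1 h1, le_rfl]
  · by_cases h1 : (chi A : ℝ) ≤ t
    · rw [if_pos h1]; split_ifs <;> norm_num
    · rw [if_neg h1]; split_ifs with h; exacts [absurd (Set.mem_Icc.1 h).2 h1, le_rfl]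

end Coupling

section FirstMoment

variable {V : Type*} [DecidableEq V] [Fintype V]

/-- The pairs of vertices receiving the same colour. -/
def monoPairs {k : ℕ} (c : V → Fin k) : Finset (Sym2 V) :=
  univ.biUnion fun i => pairs (univ.filter fun v => c v = i)

lemma mem_monoPairs {k : ℕ} (c : V → Fin k) {v w : V} :
    s(v, w) ∈ monoPairs c ↔ v ≠ w ∧ c v = c w := by
  simp only [monoPairs, mem_biUnion, mem_univ, true_and, mem_pairs, mem_filter]
  constructor
  · rintro ⟨i, h1, h2, h3⟩; exact ⟨h3, h1.trans h2.symm⟩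
  · rintro ⟨h1, h2⟩; exact ⟨_, rfl, h2.symm, h1⟩

lemma card_monoPairs {k : ℕ} (hk : 0 < k) (c : V → Fin k) :
    (Fintype.card V : ℝ) * (Fintype.card V / k - 1) / 2 ≤ #(monoPairs c) := by
  have h1 : #(monoPairs c) = ∑ i : Fin k, (#(univ.filter fun v => c v = i)).choose 2 := by
    unfold monoPairs
    rw [card_biUnion]
    · simp [card_pairs]
    · intro i _ j _ hij
      refine pairs_disjoint (disjoint_left.2 fun v hv hv' => hij ?_)
      rw [mem_filter] at hv hv'
      exact hv.2.symm.trans hv'.2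
  have h2 : (Fintype.card V : ℝ) = ∑ i : Fin k, (#(univ.filter fun v => c v = i) : ℝ) := by
    rw [← Nat.cast_sum, ← card_eq_sum_card_fiberwise (fun _ _ => mem_univ _), card_univ]
  have hk' : (0:ℝ) < k := by exact_mod_cast hk
  have h3 := sq_sum_le_card_mul_sum_sq (s := (univ : Finset (Fin k)))
    (f := fun i => (#(univ.filter fun v => c v = i) : ℝ))
  rw [← h2, card_univ, Fintype.card_fin] at h3
  rw [h1, Nat.cast_sum]
  simp only [Nat.cast_choose_two]
  have h4 : ∑ i : Fin k, (#(univ.filter fun v => c v = i) : ℝ) *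
      ((#(univ.filter fun v => c v = i) : ℝ) - 1) / 2 =
      (∑ i : Fin k, (#(univ.filter fun v => c v = i) : ℝ) ^ 2 - Fintype.card V) / 2 := by
    rw [h2, ← sum_sub_distrib, sum_div]
    exact sum_congr rfl fun i _ => by ring
  rw [h4, mul_sub, mul_one, ← mul_div_assoc, ← sq]
  have : (Fintype.card V : ℝ) ^ 2 / k ≤ ∑ i : Fin k, (#(univ.filter fun v => c v = i) : ℝ) ^ 2 := by
    rw [div_le_iff₀ hk']; linarith
  linarith

lemma exists_surjective_coloring {k : ℕ} (hk : k ≤ Fintype.card V) {G : SimpleGraph V}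
    (h : G.Colorable k) : ∃ c : G.Coloring (Fin k), Function.Surjective c := by
  classical
  obtain ⟨c₀⟩ := h
  obtain ⟨c, hc⟩ : ∃ c : G.Coloring (Fin k), ∀ d : G.Coloring (Fin k),
      #(univ.image d) ≤ #(univ.image c) := by
    have hbdd : BddAbove (Set.range fun d : G.Coloring (Fin k) => #(univ.image d)) :=
      ⟨k, by rintro _ ⟨d, rfl⟩; exact (card_le_univ _).trans_eq (Fintype.card_fin k)⟩
    obtain ⟨c, hc⟩ := Nat.sSup_mem (Set.range_nonempty_iff_nonempty.2 ⟨c₀⟩) hbdd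
    exact ⟨c, fun d => by
      simp only at hc
      rw [hc]; exact le_csSup hbdd ⟨d, rfl⟩⟩
  refine ⟨c, ?_⟩
  by_contra hns
  simp only [Function.Surjective, not_forall, not_exists] at hns
  obtain ⟨i, hi⟩ := hns
  have hlt : #(univ.image c) < k := by
    conv_rhs => rw [← Fintype.card_fin k, ← card_univ]
    refine card_lt_card ((ssubset_univ_iff).2 fun h => ?_)
    have := h.symm ▸ mem_univ i
    obtain ⟨v, -, hv⟩ := mem_image.1 this
    exact hi v hv
  obtain ⟨v, -, w, -, hvw, hcvw⟩ := exists_ne_map_eq_of_card_lt_of_maps_to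
    (s := (univ : Finset V)) (t := univ.image c) (f := c) (by rw [card_univ]; omega)
    (fun v hv => mem_image_of_mem _ hv)
  let d : G.Coloring (Fin k) := SimpleGraph.Coloring.mk (Function.update c v i) (by
    intro x y hxy hd
    by_cases hx : x = v <;> by_cases hy : y = v
    · subst hx hy; exact hxy.ne rfl
    · subst hx
      rw [Function.update_self, Function.update_of_ne hy] at hd
      exact hi y hd.symm
    · subst hy
      rw [Function.update_self, Function.update_of_ne hx] at hd
      exact hi x hd
    · rw [Function.update_of_ne hx, Function.update_of_ne hy] at hd
      exact c.valid hxy hd)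
  have hd : ∀ x, d x = Function.update c v i x := fun x => rfl
  have hsub : insert i (univ.image c) ⊆ univ.image d := by
    intro x hx
    rcases mem_insert.1 hx with rfl | hx
    · exact mem_image.2 ⟨v, mem_univ _, by rw [hd, Function.update_self]⟩
    · obtain ⟨y, -, rfl⟩ := mem_image.1 hx
      by_cases hy : y = v
      · subst hy
        exact mem_image.2 ⟨w, mem_univ _, by rw [hd, Function.update_of_ne hvw.symm, ← hcvw]⟩
      · exact mem_image.2 ⟨y, mem_univ _, by rw [hd, Function.update_of_ne hy]⟩
  have h1 := card_le_card hsub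
  rw [card_insert_of_notMem (fun h => by
    obtain ⟨y, -, hy⟩ := mem_image.1 h; exact hi y hy)] at h1
  have := hc d
  omega

/-- First moment bound for the number of proper colourings. -/
theorem factorial_mul_probLe_le {p : ℝ} (hp0 : 0 < p) (hp1 : p < 1) {n k : ℕ} (hk : 0 < k)
    (hkn : k ≤ n) :
    k.factorial * probLe p n k ≤
      (k : ℝ) ^ n * (1 - p) ^ ((n : ℝ) * (n / k - 1) / 2) := by
  classical
  have hq : 0 < 1 - p := by linarith
  have h1 : k.factorial * probLe p n k ≤ ev p (pairs (univ : Finset (Fin n))) fun A =>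
      ∑ c : Fin n → Fin k, if Disjoint (monoPairs c) A then 1 else 0 := by
    unfold probLe
    rw [← ev_mul_left]
    refine ev_mono hp0.le hp1.le fun A _ => ?_
    split_ifs with hA
    · have hcol : (SimpleGraph.fromEdgeSet (A : Set (Sym2 (Fin n)))).Colorable k :=
        (chrom_le_iff _ _).1 (by exact_mod_cast hA)
      obtain ⟨c, hc⟩ := exists_surjective_coloring (by simpa using hkn) hcol
      rw [mul_one, sum_boole, ← Fintype.card_fin k, ← Fintype.card_perm, Fintype.card_fin]
      have : Fintype.card (Equiv.Perm (Fin k)) ≤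
          #{c : Fin n → Fin k | Disjoint (monoPairs c) A} := by
        rw [← card_univ]
        refine card_le_card_of_injOn (fun σ => σ ∘ c) ?_ ?_
        · intro σ _
          simp only [coe_filter, Set.mem_ofPred_eq, mem_univ, true_and]
          rw [disjoint_left]
          intro e he heA
          induction e with
          | h v w =>
            rw [mem_monoPairs] at he
            exact c.valid (SimpleGraph.fromEdgeSet_adj _ |>.2 ⟨heA, he.1⟩) (σ.injective he.2)
        · intro σ _ τ _ h
          ext1 x
          obtain ⟨v, rfl⟩ := hc x
          exact congrFun h v
      exact_mod_cast this
    · rw [mul_zero]; positivity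
  refine h1.trans ?_
  rw [ev_sum]
  have h2 : ∀ c ∈ (univ : Finset (Fin n → Fin k)), ev p (pairs (univ : Finset (Fin n)))
      (fun A => if Disjoint (monoPairs c) A then 1 else 0) ≤
      (1 - p) ^ ((n : ℝ) * (n / k - 1) / 2) := by
    intro c _
    rw [ev_disjoint, ← rpow_natCast]
    · refine rpow_le_rpow_of_exponent_ge hq (by linarith) ?_
      simpa using card_monoPairs hk c
    · intro e he
      induction e with
      | h v w => exact mem_pairs.2 ⟨mem_univ _, mem_univ _, ((mem_monoPairs c).1 he).1⟩
  refine (sum_le_card_nsmul _ _ _ h2).trans_eq ?_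
  rw [card_univ, Fintype.card_fun, Fintype.card_fin, Fintype.card_fin, nsmul_eq_mul]
  push_cast; rfl

end FirstMoment

section Asymptotics

/-- `α₀(x) − 1 − 2 / log b`, the asymptotic average size of the colour classes. -/
noncomputable def tau0 (b x : ℝ) : ℝ := alpha0 b x - 1 - 2 / log b

lemma alpha0_eq {b x : ℝ} (hb : 1 < b) :
    alpha0 b x = 2 / log b * (log x - log (log x / log b) + 1 - log 2) + 1 := by
  have hb' : 0 < log b := log_pos hb
  unfold alpha0 Real.logb
  rw [log_div (exp_pos 1).ne' two_ne_zero, log_exp]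
  field_simp
  ring

lemma tau0_eq {b x : ℝ} (hb : 1 < b) :
    tau0 b x = 2 / log b * (log x - log (log x / log b) - log 2) := by
  rw [tau0, alpha0_eq hb]; ring

lemma tendsto_log_nat : Tendsto (fun n : ℕ => log (n : ℝ)) atTop atTop :=
  tendsto_log_atTop.comp tendsto_natCast_atTop_atTop

lemma tendsto_log_log_div_log {c : ℝ} (hc : 0 < c) :
    Tendsto (fun x : ℝ => log (log x / c) / log x) atTop (nhds 0) := by
  have h1 : Tendsto (fun y : ℝ => log (y / c) / y) atTop (nhds 0) := by
    have h2 : Tendsto (fun y : ℝ => log y / y) atTop (nhds 0) := by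
      simpa using tendsto_pow_log_div_mul_add_atTop 1 0 1 one_ne_zero
    have h3 := (h2.comp (tendsto_id.atTop_div_const hc)).mul_const (1 / c)
    rw [zero_mul] at h3
    refine h3.congr' ?_
    filter_upwards [eventually_gt_atTop 0] with y hy
    simp only [Function.comp, id]
    field_simp
  exact h1.comp tendsto_log_atTop

lemma tendsto_alpha0_div_log {b : ℝ} (hb : 1 < b) :
    Tendsto (fun n : ℕ => alpha0 b n / log n) atTop (nhds (2 / log b)) := by
  have hb' : 0 < log b := log_pos hb
  have h1 : Tendsto (fun n : ℕ => log (log (n:ℝ) / log b) / log n) atTop (nhds 0) :=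
    (tendsto_log_log_div_log hb').comp tendsto_natCast_atTop_atTop
  have h2 : Tendsto (fun n : ℕ => (log (n:ℝ))⁻¹) atTop (nhds 0) :=
    tendsto_inv_atTop_zero.comp tendsto_log_nat
  have h3 : Tendsto (fun n : ℕ => 2 / log b * (1 - log (log (n:ℝ) / log b) / log n) +
      (2 / log b * (1 - log 2) + 1) * (log (n:ℝ))⁻¹) atTop
      (nhds (2 / log b * (1 - 0) + (2 / log b * (1 - log 2) + 1) * 0)) :=
    ((h1.const_sub 1).const_mul _).add (h2.const_mul _)
  rw [sub_zero, mul_one, mul_zero, add_zero] at h3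
  refine h3.congr' ?_
  filter_upwards [tendsto_log_nat.eventually_gt_atTop 0] with n hn
  rw [alpha0_eq hb]
  field_simp
  ring

lemma tendsto_tau0_add_div_log {b : ℝ} (hb : 1 < b) (c : ℝ) :
    Tendsto (fun n : ℕ => (tau0 b n + c) / log n) atTop (nhds (2 / log b)) := by
  have h2 : Tendsto (fun n : ℕ => (log (n:ℝ))⁻¹) atTop (nhds 0) :=
    tendsto_inv_atTop_zero.comp tendsto_log_nat
  have h3 := (tendsto_alpha0_div_log hb).add (h2.const_mul (c - 1 - 2 / log b))
  rw [mul_zero, add_zero] at h3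
  refine h3.congr fun n => ?_
  unfold tau0
  rw [div_eq_mul_inv, div_eq_mul_inv]
  ring

lemma tendsto_tau0_add {b : ℝ} (hb : 1 < b) (c : ℝ) :
    Tendsto (fun n : ℕ => tau0 b n + c) atTop atTop := by
  have h := (tendsto_tau0_add_div_log hb c).pos_mul_atTop (by have := log_pos hb; positivity)
    tendsto_log_nat
  refine h.congr' ?_
  filter_upwards [tendsto_log_nat.eventually_gt_atTop 0] with n hn
  field_simp

lemma tendsto_log_pow_div_nat (k : ℕ) :
    Tendsto (fun n : ℕ => log (n:ℝ) ^ k / n) atTop (nhds 0) := by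
  have h := tendsto_pow_log_div_mul_add_atTop 1 0 k one_ne_zero
  simp only [one_mul, add_zero] at h
  exact h.comp tendsto_natCast_atTop_atTop

lemma tendsto_tau0_add_div_nat {b : ℝ} (hb : 1 < b) (c : ℝ) :
    Tendsto (fun n : ℕ => (tau0 b n + c) / n) atTop (nhds 0) := by
  have h := (tendsto_tau0_add_div_log hb c).mul (tendsto_log_pow_div_nat 1)
  rw [mul_zero] at h
  refine h.congr' ?_
  filter_upwards [tendsto_log_nat.eventually_gt_atTop 0] with n hn
  rw [pow_one]
  field_simp

lemma pow_div_exp_le_factorial (k : ℕ) (hk : 0 < k) : (k:ℝ) * log k - k ≤ log (k.factorial) := by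
  have h := exp_pos (k:ℝ)
  have h1 : (k:ℝ) ^ k / k.factorial ≤ exp k := Real.pow_div_factorial_le_exp k (by positivity) k
  have hf : (0:ℝ) < k.factorial := by positivity
  have hk' : (0:ℝ) < k := by exact_mod_cast hk
  rw [div_le_iff₀ hf] at h1
  have h2 := log_le_log (by positivity) h1
  rw [log_mul h.ne' hf.ne', log_exp, log_pow] at h2
  linarith

lemma tendsto_log_tau0_add {b : ℝ} (hb : 1 < b) (c : ℝ) :
    Tendsto (fun n : ℕ => log (tau0 b n + c) - log (log n / log b) - log 2) atTop (nhds 0) := by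
  have hb' := log_pos hb
  have h1 := ((tendsto_tau0_add_div_log hb c).mul_const (log b / 2)).log (by positivity)
  rw [show 2 / log b * (log b / 2) = 1 by field_simp, log_one] at h1
  refine h1.congr' ?_
  filter_upwards [tendsto_log_nat.eventually_gt_atTop 0,
    (tendsto_tau0_add hb c).eventually_gt_atTop 0] with n hn hc
  rw [log_mul (by positivity) (by positivity), log_div hc.ne' hn.ne', log_div hb'.ne' two_ne_zero,
    log_div hn.ne' hb'.ne']
  ring

lemma probLe_mono {p : ℝ} (hp0 : 0 ≤ p) (hp1 : p ≤ 1) (n : ℕ) {a c : ℝ} (h : a ≤ c) :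
    probLe p n a ≤ probLe p n c := by
  refine ev_mono hp0 hp1 fun A _ => ?_
  split_ifs <;> linarith

/-- Lower bound on the chromatic number. -/
theorem eventually_lower_bound {p η : ℝ} (hp0 : 0 < p) (hp1 : p < 1) (hη : 0 < η) :
    ∀ᶠ n : ℕ in atTop, ∀ t : ℝ, 0.9 ≤ probLe p n t → n / (tau0 (1 / (1 - p)) n + η) ≤ t := by
  have hq : 0 < 1 - p := by linarith
  set b := 1 / (1 - p) with hbd
  have hb : 1 < b := by rw [hbd, lt_div_iff₀ hq]; linarith
  have hlb := log_pos hb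
  have hlq : log (1 - p) = -log b := by rw [hbd, one_div, log_inv, neg_neg]
  have hηb : 0 < η * log b / 4 := by positivity
  filter_upwards [tendsto_log_nat.eventually_gt_atTop 0,
    (tendsto_tau0_add hb η).eventually_ge_atTop (1 + 3 * (4 / (η * log b))),
    (tendsto_tau0_add_div_nat hb η).eventually_le_const (show (0:ℝ) < 1 by norm_num),
    (tendsto_log_tau0_add hb η).eventually_const_le (show -(η * log b / 4) < 0 by linarith),
    eventually_gt_atTop 0] with n hL hT hTn hE hn t ht
  by_contra! hlt
  have hn' : (0:ℝ) < n := by exact_mod_cast hn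
  set T := tau0 b n + η with hTd
  have hT1 : 1 ≤ T := le_trans (by have : 0 < 3 * (4 / (η * log b)) := by positivity
                                   linarith) hT
  rw [div_le_one hn'] at hTn
  set k := ⌊n / T⌋₊ with hkd
  have hk : 0 < k := Nat.floor_pos.2 ((one_le_div (by linarith)).2 hTn)
  have hkT : (k:ℝ) ≤ n / T := Nat.floor_le (by positivity)
  have hkn : k ≤ n := by
    have : (k:ℝ) ≤ n := hkT.trans (div_le_self hn'.le hT1)
    exact_mod_cast this
  have hk' : (0:ℝ) < k := by exact_mod_cast hk
  have h1 : 0.9 ≤ probLe p n k := by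
    refine ht.trans ?_
    have : probLe p n t ≤ probLe p n (n / T) := probLe_mono hp0.le hp1.le n hlt.le
    refine this.trans (le_of_eq ?_)
    unfold probLe
    refine ev_congr p fun A _ => ?_
    simp only [Nat.cast_le, hkd, Nat.le_floor_iff (show 0 ≤ (n:ℝ) / T by positivity)]
  have h2 := factorial_mul_probLe_le hp0 hp1 hk hkn
  have h3 : (k.factorial : ℝ) * exp (-1) ≤ k ^ n * (1 - p) ^ ((n : ℝ) * (n / k - 1) / 2) := by
    refine le_trans (mul_le_mul_of_nonneg_left (le_trans ?_ h1) (by positivity)) h2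
    have := Real.exp_neg_one_lt_d9
    norm_num at this ⊢
    linarith
  have h4 := log_le_log (by positivity) h3
  rw [log_mul (by positivity) (exp_pos _).ne', log_exp, log_mul (by positivity) (by positivity),
    log_pow, log_rpow hq, hlq] at h4
  have h5 := pow_div_exp_le_factorial k hk
  set z := (n:ℝ) / k with hz
  have hnz : (n:ℝ) = k * z := by rw [hz]; field_simp
  have hzT : T ≤ z := by
    rw [hz, le_div_iff₀ hk', mul_comm]
    exact (le_div_iff₀ (by linarith)).1 hkT
  have hlk : log k = log n - log z := by
    rw [hz, log_div hn'.ne' hk'.ne']; ring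
  have hlz : log T ≤ log z := log_le_log (by linarith) hzT
  have hTe : T * log b / 2 = log n - log (log n / log b) - log 2 + η * log b / 2 := by
    rw [hTd, tau0_eq hb]; field_simp
  have hbr : log k - z * log b / 2 ≤ -(η * log b / 4) := by
    have : T * log b ≤ z * log b := mul_le_mul_of_nonneg_right hzT hlb.le
    rw [hlk]; linarith
  have h6 : k * ((z - 1) * (log k - z * log b / 2) + 2) ≤ k * ((z - 1) * -(η * log b / 4) + 2) := by
    gcongr; linarith
  have h7 : 3 * (4 / (η * log b)) ≤ z - 1 := by linarith
  have h8 : 3 ≤ (z - 1) * (η * log b / 4) := by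
    have := mul_le_mul_of_nonneg_right h7 hηb.le
    have h9 : 3 * (4 / (η * log b)) * (η * log b / 4) = 3 := by field_simp
    linarith
  have hk1 : (1:ℝ) ≤ k := by exact_mod_cast hk
  rw [hnz] at h4
  have h10 : k * ((z - 1) * -(η * log b / 4) + 2) ≤ k * (-1) := by gcongr; linarith
  linarith

end Asymptotics

section Exponent

lemma log_factorial_le (k : ℕ) (hk : 0 < k) :
    log (k.factorial) ≤ (k:ℝ) * log k - k + (log k + 1) := by
  induction k, hk using Nat.le_induction with
  | base => simp
  | succ k hk ih =>
    have hk' : (0:ℝ) < k := by exact_mod_cast hk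
    rw [Nat.factorial_succ]
    push_cast
    rw [log_mul (by positivity) (by positivity)]
    have h := one_sub_inv_le_log_of_pos (show (0:ℝ) < (k + 1) / k by positivity)
    rw [log_div (by positivity) hk'.ne', inv_div] at h
    have h2 : (1:ℝ) - k / (k + 1) = 1 / (k + 1) := by field_simp; ring
    rw [h2, div_le_iff₀ (by positivity)] at h
    linarith

/-- Logarithm of the expected number of independent `u`-sets, up to lower order terms. -/
noncomputable def expo (b x : ℝ) (u : ℕ) : ℝ :=
  u * log x - log (u.factorial) - (u * (u - 1) / 2) * log b

/-- Pairs `(n, u)` with `n → ∞` and `u` within `K` of `α₀(n)`. -/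
noncomputable def nearAlpha (b K : ℝ) : Filter (ℕ × ℕ) :=
  comap Prod.fst atTop ⊓ 𝓟 {x | |(x.2:ℝ) - alpha0 b x.1| ≤ K}

lemma eventually_nearAlpha {b K : ℝ} {P : ℕ × ℕ → Prop} :
    (∀ᶠ x in nearAlpha b K, P x) ↔
      ∀ᶠ n : ℕ in atTop, ∀ u : ℕ, |(u:ℝ) - alpha0 b n| ≤ K → P (n, u) := by
  rw [nearAlpha, eventually_inf_principal, eventually_comap]
  refine eventually_congr (Eventually.of_forall fun n => ⟨fun h u hu => h (n, u) rfl hu, ?_⟩)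
  rintro h ⟨m, u⟩ rfl hu
  exact h u hu

lemma tendsto_fst_nearAlpha (b K : ℝ) : Tendsto Prod.fst (nearAlpha b K) atTop :=
  tendsto_comap.mono_left inf_le_left

lemma tendsto_snd_div_log {b : ℝ} (hb : 1 < b) (K : ℝ) :
    Tendsto (fun x : ℕ × ℕ => (x.2:ℝ) / log x.1) (nearAlpha b K) (nhds (2 / log b)) := by
  have h1 := (tendsto_alpha0_div_log hb).comp (tendsto_fst_nearAlpha b K)
  have hL := tendsto_log_nat.comp (tendsto_fst_nearAlpha b K)
  have h2 : Tendsto (fun x : ℕ × ℕ => ((x.2:ℝ) - alpha0 b x.1) / log x.1)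
      (nearAlpha b K) (nhds 0) := by
    have h3 : Tendsto (fun x : ℕ × ℕ => K * (log (x.1:ℝ))⁻¹) (nearAlpha b K) (nhds 0) := by
      simpa using (tendsto_inv_atTop_zero.comp hL).const_mul K
    refine squeeze_zero_norm' ?_ h3
    have h4 : ∀ᶠ x : ℕ × ℕ in nearAlpha b K, |(x.2:ℝ) - alpha0 b x.1| ≤ K :=
      eventually_inf_principal.2 (Eventually.of_forall fun x hx => hx)
    filter_upwards [h4, hL.eventually_gt_atTop 0] with x hx hx0
    simp only [Function.comp] at hx0
    rw [norm_div, norm_eq_abs, norm_eq_abs, abs_of_pos hx0, div_eq_mul_inv]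
    gcongr
  have h3 := h1.add h2
  rw [add_zero] at h3
  refine h3.congr fun x => ?_
  simp only [Function.comp, div_eq_mul_inv]
  ring

lemma tendsto_expo {b : ℝ} (hb : 1 < b) (K : ℝ) :
    Tendsto (fun x : ℕ × ℕ => (expo b x.1 x.2 - (alpha0 b x.1 - x.2) * log x.1) / log x.1)
      (nearAlpha b K) (nhds 0) := by
  have hlb := log_pos hb
  have hu := tendsto_snd_div_log hb K
  have hL : Tendsto (fun x : ℕ × ℕ => log (x.1:ℝ)) (nearAlpha b K) atTop :=
    tendsto_log_nat.comp (tendsto_fst_nearAlpha b K)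
  have hLinv := tendsto_inv_atTop_zero.comp hL
  have hLL : Tendsto (fun x : ℕ × ℕ => log (log (x.1:ℝ)) / log x.1) (nearAlpha b K) (nhds 0) := by
    have := (tendsto_log_log_div_log one_pos).comp
      (tendsto_natCast_atTop_atTop.comp (tendsto_fst_nearAlpha b K))
    simpa [Function.comp_def] using this
  have hu0 : Tendsto (fun x : ℕ × ℕ => (x.2:ℝ)) (nearAlpha b K) atTop := by
    refine (hu.pos_mul_atTop (by positivity) hL).congr' ?_
    filter_upwards [hL.eventually_gt_atTop 0] with x hx
    field_simp
  have hlog : Tendsto (fun x : ℕ × ℕ => log ((x.2:ℝ) / log x.1)) (nearAlpha b K)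
      (nhds (log (2 / log b))) := hu.log (by positivity)
  have hlu : Tendsto (fun x : ℕ × ℕ => (log (x.2:ℝ) + 1) / log x.1) (nearAlpha b K) (nhds 0) := by
    have := ((hlog.add_const 1).mul hLinv).add hLL
    rw [mul_zero, add_zero] at this
    refine this.congr' ?_
    filter_upwards [hL.eventually_gt_atTop 0, hu0.eventually_gt_atTop 0] with x hx hx2
    simp only [Function.comp]
    rw [log_div hx2.ne' hx.ne']
    field_simp
    ring
  have herr : Tendsto (fun x : ℕ × ℕ =>
      (log (x.2.factorial) - ((x.2:ℝ) * log x.2 - x.2)) / log x.1) (nearAlpha b K) (nhds 0) := by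
    refine tendsto_of_tendsto_of_tendsto_of_le_of_le' tendsto_const_nhds hlu ?_ ?_
    · filter_upwards [hL.eventually_gt_atTop 0, hu0.eventually_gt_atTop 0] with x hx hx2
      have := pow_div_exp_le_factorial x.2 (by exact_mod_cast hx2)
      apply div_nonneg _ hx.le
      linarith
    · filter_upwards [hL.eventually_gt_atTop 0, hu0.eventually_gt_atTop 0] with x hx hx2
      have := log_factorial_le x.2 (by exact_mod_cast hx2)
      gcongr
      linarith
  have hmain : Tendsto (fun x : ℕ × ℕ => (x.2:ℝ) / log x.1 *
      (log (2 / log b) - log ((x.2:ℝ) / log x.1))) (nearAlpha b K) (nhds 0) := by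
    have := hu.mul (hlog.const_sub (log (2 / log b)))
    rwa [sub_self, mul_zero] at this
  have hsec : Tendsto (fun x : ℕ × ℕ => (alpha0 b x.1 - x.2) *
      ((x.2:ℝ) / log x.1 * (log b / 2) - 1)) (nearAlpha b K) (nhds 0) := by
    have h3 := ((hu.mul_const (log b / 2)).sub_const 1).abs.const_mul K
    rw [show 2 / log b * (log b / 2) - 1 = 0 by field_simp; norm_num, abs_zero, mul_zero] at h3
    refine squeeze_zero_norm' ?_ h3
    have h4 : ∀ᶠ x : ℕ × ℕ in nearAlpha b K, |(x.2:ℝ) - alpha0 b x.1| ≤ K :=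
      eventually_inf_principal.2 (Eventually.of_forall fun x hx => hx)
    filter_upwards [h4] with x hx
    rw [norm_mul, norm_eq_abs, norm_eq_abs, abs_sub_comm]
    gcongr
  have h := (hmain.add hsec).sub herr
  rw [add_zero, sub_zero] at h
  refine h.congr' ?_
  filter_upwards [hL.eventually_gt_atTop 0, hu0.eventually_gt_atTop 0] with x hx hx2
  rw [expo, alpha0_eq hb, log_div hx2.ne' hx.ne', log_div two_ne_zero hlb.ne',
    log_div hx.ne' hlb.ne']
  field_simp
  ring

lemma eventually_expo {b : ℝ} (hb : 1 < b) (K : ℝ) {ξ : ℝ} (hξ : 0 < ξ) :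
    ∀ᶠ n : ℕ in atTop, ∀ u : ℕ, |(u:ℝ) - alpha0 b n| ≤ K →
      |expo b n u - (alpha0 b n - u) * log n| ≤ ξ * log n := by
  have h := (tendsto_expo hb K).abs
  rw [abs_zero] at h
  have h2 := eventually_nearAlpha.1 (h.eventually_le_const hξ)
  filter_upwards [h2, tendsto_log_nat.eventually_gt_atTop 0] with n hn hL u hu
  have := hn u hu
  rwa [abs_div, abs_of_pos hL, div_le_iff₀ hL] at this

lemma eventually_near_alpha0 {b : ℝ} (hb : 1 < b) (K : ℝ) {ξ : ℝ} (hξ : 0 < ξ) :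
    ∀ᶠ n : ℕ in atTop, ∀ u : ℕ, |(u:ℝ) - alpha0 b n| ≤ K →
      (2 / log b - ξ) * log n ≤ u ∧ (u:ℝ) ≤ (2 / log b + ξ) * log n := by
  have h := tendsto_snd_div_log hb K
  have h2 := eventually_nearAlpha.1 ((h.eventually_le_const (lt_add_of_pos_right _ hξ)).and
    (h.eventually_const_le (sub_lt_self _ hξ)))
  filter_upwards [h2, tendsto_log_nat.eventually_gt_atTop 0] with n hn hL u hu
  have := hn u hu
  rwa [div_le_iff₀ hL, le_div_iff₀ hL, and_comm] at this

lemma muNat_pos {q : ℝ} (hq : 0 < q) {n u : ℕ} (hu : u ≤ n) : 0 < muNat n u q :=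
  mul_pos (by exact_mod_cast Nat.choose_pos hu) (by positivity)

lemma log_muNat {q : ℝ} (hq : 0 < q) {n u : ℕ} (hu : u ≤ n) :
    log (muNat n u q) = log (n.choose u) - (u * (u - 1) / 2) * log (1 / q) := by
  have : (0:ℝ) < n.choose u := by exact_mod_cast Nat.choose_pos hu
  rw [muNat, log_mul this.ne' (by positivity), log_pow, Nat.cast_choose_two, one_div, log_inv]
  ring

lemma log_muNat_le {q : ℝ} (hq : 0 < q) {n u : ℕ} (hu : u ≤ n) :
    log (muNat n u q) ≤ expo (1 / q) n u := by
  rw [log_muNat hq hu, expo]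
  rcases Nat.eq_zero_or_pos n with rfl | hn
  · obtain rfl : u = 0 := by omega
    simp
  have hn' : (0:ℝ) < n := by exact_mod_cast hn
  have h := log_le_log (by exact_mod_cast Nat.choose_pos hu)
    (Nat.choose_le_pow_div (α := ℝ) u n)
  rw [log_div (by positivity) (by positivity), log_pow] at h
  linarith

lemma le_log_muNat {q : ℝ} (hq : 0 < q) {n u : ℕ} (hu : 2 * u ≤ n) (hn : 0 < n) :
    expo (1 / q) n u - 2 * u ^ 2 / n ≤ log (muNat n u q) := by
  have hun : u ≤ n := by omega
  rw [log_muNat hq hun, expo]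
  have hn' : (0:ℝ) < n := by exact_mod_cast hn
  have hlt : (0:ℝ) < n - u := by
    have : u < n := by omega
    have : (u:ℝ) < n := by exact_mod_cast this
    linarith
  have h1 : ((n:ℝ) - u) ^ u / u.factorial ≤ n.choose u := by
    rw [div_le_iff₀ (by positivity)]
    have h2 := Nat.pow_sub_le_descFactorial n u
    rw [Nat.descFactorial_eq_factorial_mul_choose] at h2
    have h3 : ((n:ℝ) - u) ^ u ≤ ((n + 1 - u : ℕ) : ℝ) ^ u := by
      gcongr
      rw [Nat.cast_sub (by omega)]
      push_cast
      linarith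
    refine h3.trans ?_
    rw [mul_comm]
    exact_mod_cast h2
  have h := log_le_log (by positivity) h1
  rw [log_div (by positivity) (by positivity), log_pow] at h
  have h4 := one_sub_inv_le_log_of_pos (show (0:ℝ) < (n - u) / n by positivity)
  rw [log_div hlt.ne' hn'.ne', inv_div] at h4
  have h5 : -(2 * (u:ℝ) / n) ≤ 1 - n / (n - u) := by
    have : (n:ℝ) / (n - u) ≤ 1 + 2 * u / n := by
      have hu2 : 2 * (u:ℝ) ≤ n := by exact_mod_cast hu
      rw [div_le_iff₀ hlt]
      have : (1 + 2 * (u:ℝ) / n) * (n - u) = n + u * (n - 2 * u) / n := by field_simp; ring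
      rw [this]
      have : 0 ≤ u * ((n:ℝ) - 2 * u) / n := by
        apply div_nonneg (mul_nonneg (by positivity) (by linarith)) hn'.le
      linarith
    linarith
  have h6 : (u:ℝ) * -(2 * u / n) ≤ u * (log (n - u) - log n) := by gcongr; linarith
  have h7 : (u:ℝ) * -(2 * u / n) = -(2 * u ^ 2 / n) := by ring
  linarith

/-- The logarithm of the expected number of independent `u`-sets. -/
lemma eventually_log_muNat {p : ℝ} (hp0 : 0 < p) (hp1 : p < 1) (K : ℝ) {ξ : ℝ} (hξ : 0 < ξ) :
    ∀ᶠ n : ℕ in atTop, ∀ u : ℕ, |(u:ℝ) - alpha0 (1 / (1 - p)) n| ≤ K →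
      2 * u ≤ n ∧
      |log (muNat n u (1 - p)) - (alpha0 (1 / (1 - p)) n - u) * log n| ≤ ξ * log n := by
  have hq : 0 < 1 - p := by linarith
  set b := 1 / (1 - p) with hbd
  have hb : 1 < b := by rw [hbd, lt_div_iff₀ hq]; linarith
  have hlb := log_pos hb
  set c := 2 / log b + 1 with hc
  have hc0 : 0 < c := by positivity
  filter_upwards [eventually_expo hb K (half_pos hξ), eventually_near_alpha0 hb K one_pos,
    tendsto_log_nat.eventually_gt_atTop 0, eventually_gt_atTop 0,
    ((tendsto_log_pow_div_nat 1).const_mul (2 * c)).eventually_le_const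
      (show 2 * c * 0 < 1 by simp),
    ((tendsto_log_pow_div_nat 1).const_mul (2 * c ^ 2)).eventually_le_const
      (show 2 * c ^ 2 * 0 < ξ / 2 by simpa using hξ)] with n h1 h2 hL hn h3 h4 u hu
  have hn' : (0:ℝ) < n := by exact_mod_cast hn
  have hu1 := (h2 u hu).2
  have hun : 2 * u ≤ n := by
    rw [pow_one, mul_div, div_le_one hn'] at h3
    have : (2 * u : ℝ) ≤ n := by linarith
    exact_mod_cast this
  refine ⟨hun, ?_⟩
  have h5 := log_muNat_le hq (show u ≤ n by omega)
  have h6 := le_log_muNat hq hun hn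
  have h7 := abs_le.1 (h1 u hu)
  have h8 : 2 * (u:ℝ) ^ 2 / n ≤ ξ / 2 * log n := by
    have : 2 * (u:ℝ) ^ 2 / n ≤ 2 * (c * log n) ^ 2 / n := by gcongr
    refine this.trans ?_
    have := mul_le_mul_of_nonneg_right h4 hL.le
    refine le_trans (le_of_eq ?_) this
    ring
  rw [abs_le]
  constructor <;> linarith [h7.1, h7.2]

lemma alpha0_sub_alpha0_le {b x y : ℝ} (hb : 1 < b) (hx : 1 < x) (hxy : x ≤ y) :
    alpha0 b y - alpha0 b x ≤ 2 / log b * log (y / x) := by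
  have hlb := log_pos hb
  have h1 : 0 < log x := log_pos hx
  have h2 : log x ≤ log y := log_le_log (by linarith) hxy
  have h3 : log (log x / log b) ≤ log (log y / log b) := log_le_log (by positivity) (by gcongr)
  rw [alpha0_eq hb, alpha0_eq hb, log_div (show y ≠ 0 by linarith) (show x ≠ 0 by linarith)]
  have h4 : (2 / log b) * (log (log x / log b)) ≤ (2 / log b) * log (log y / log b) := by gcongr
  linarith

lemma le_alpha0_sub_alpha0 {b x y : ℝ} (hb : 1 < b) (hx : 1 < x) (hxy : x ≤ y) :
    2 / log b * (log (y / x) - log (y / x) / log x) ≤ alpha0 b y - alpha0 b x := by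
  have hlb := log_pos hb
  have h1 : 0 < log x := log_pos hx
  have h2 : log x ≤ log y := log_le_log (by linarith) hxy
  have h3 : log (log y / log b) - log (log x / log b) ≤ log (y / x) / log x := by
    rw [log_div (by linarith) hlb.ne', log_div h1.ne' hlb.ne']
    have h5 := log_le_sub_one_of_pos (show 0 < log y / log x by apply div_pos <;> linarith)
    rw [log_div (by linarith) h1.ne'] at h5
    have h6 : log (y / x) / log x = log y / log x - 1 := by
      rw [log_div (by linarith) (by linarith)]; field_simp
    linarith
  rw [alpha0_eq hb, alpha0_eq hb]
  have h4 : (2 / log b) * (log (log y / log b) - log (log x / log b)) ≤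
    (2 / log b) * (log (y / x) / log x) := by gcongr
  have h5 := log_div (show y ≠ 0 by linarith) (show x ≠ 0 by linarith)
  rw [h5] at h4 ⊢
  linarith

end Exponent

section OverlapAsymptotics

lemma tendsto_log_pow_div_rpow (k : ℕ) {a : ℝ} (ha : 0 < a) :
    Tendsto (fun n : ℕ => log (n:ℝ) ^ k / (n:ℝ) ^ a) atTop (nhds 0) := by
  have h := (isLittleO_log_rpow_rpow_atTop (k:ℝ) ha).tendsto_div_nhds_zero.comp
    tendsto_natCast_atTop_atTop
  simpa [Function.comp_def, rpow_natCast] using h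

lemma two_mul_choose_two (e : ℕ) : 2 * e.choose 2 = e * (e - 1) := by
  rw [Nat.choose_two_right, Nat.mul_div_cancel' (Nat.even_mul_pred_self e).two_dvd]

lemma overlap_term_le {b ρ Y : ℝ} (hb : 1 < b) (hρ : 0 ≤ ρ) (hρ1 : ρ ≤ 1)
    {D e : ℕ} (hD : b ^ D ≤ Y) (hy : ρ ^ 2 * Y ≤ 1) (he : 2 ≤ e) (heD : e ≤ D) :
    ρ ^ e * b ^ e.choose 2 ≤ ρ ^ 2 * b ^ 3 + (ρ ^ 2 * Y) ^ 2 := by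
  have hY : 0 ≤ Y := le_trans (by positivity) hD
  rcases le_or_gt e 3 with h3 | h3
  · have h1 : ρ ^ e ≤ ρ ^ 2 := pow_le_pow_of_le_one hρ hρ1 he
    have h2 : b ^ e.choose 2 ≤ b ^ 3 := pow_le_pow_right₀ hb.le (by interval_cases e <;> decide)
    have : ρ ^ e * b ^ e.choose 2 ≤ ρ ^ 2 * b ^ 3 := by gcongr
    have := sq_nonneg (ρ ^ 2 * Y)
    linarith
  · have h1 : (ρ ^ e * b ^ e.choose 2) ^ 2 ≤ ((ρ ^ 2 * Y) ^ 2) ^ 2 := by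
      calc (ρ ^ e * b ^ e.choose 2) ^ 2 = (ρ ^ 2) ^ e * b ^ (2 * e.choose 2) := by ring
        _ = (ρ ^ 2 * b ^ (e - 1)) ^ e := by
          rw [two_mul_choose_two, mul_pow, ← pow_mul b (e - 1) e, mul_comm e]
        _ ≤ (ρ ^ 2 * Y) ^ e := by
          gcongr
          exact (pow_le_pow_right₀ hb.le (by omega)).trans hD
        _ ≤ (ρ ^ 2 * Y) ^ 4 := pow_le_pow_of_le_one (by positivity) hy (by omega)
        _ = _ := by ring
    have h2 := le_of_sq_le_sq h1 (by positivity)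
    have : 0 ≤ ρ ^ 2 * b ^ 3 := by positivity
    linarith

lemma eventually_overlap_sum_le {b c : ℝ} (hb : 1 < b) (hc : 0 < c) :
    ∀ᶠ n : ℕ in atTop, ∀ m₀ D v u : ℕ, (v:ℝ) ≤ c * log n → (u:ℝ) ≤ c * log n →
      n / log n ^ 3 ≤ (m₀:ℝ) → b ^ D ≤ c * n * log n →
      ∑ e ∈ Icc 2 D, (v.choose e : ℝ) * b ^ e.choose 2 * ((u:ℝ) / m₀) ^ e
        ≤ (n:ℝ) ^ (-(3 / 2) : ℝ) := by
  have hlb := log_pos hb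
  have hA : 0 < (2 / log b) * (c ^ 4 * b ^ 3 + c ^ 10) := by positivity
  filter_upwards [tendsto_log_nat.eventually_ge_atTop 1, eventually_gt_atTop 0,
    ((tendsto_log_pow_div_nat 5).const_mul (c ^ 2)).eventually_le_const
      (show c ^ 2 * 0 < 1 by simp),
    ((tendsto_log_pow_div_nat 11).const_mul (c ^ 5)).eventually_le_const
      (show c ^ 5 * 0 < 1 by simp),
    ((tendsto_log_pow_div_nat 1).const_mul c).eventually_le_const
      (show c * 0 < 1 by simp),
    ((tendsto_log_pow_div_rpow 23 (show (0:ℝ) < 1 / 2 by norm_num)).const_mul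
      ((2 / log b) * (c ^ 4 * b ^ 3 + c ^ 10))).eventually_le_const
      (show ((2 / log b) * (c ^ 4 * b ^ 3 + c ^ 10)) * 0 < 1 by simp)]
    with n hL hn h1 h2 h3 h4 m₀ D v u hv hu hm hD
  have hn' : (0:ℝ) < n := by exact_mod_cast hn
  set L := log (n:ℝ) with hLd
  have hL0 : 0 < L := by linarith
  have hm0 : (0:ℝ) < m₀ := lt_of_lt_of_le (by positivity) hm
  set ρ := c ^ 2 * (L ^ 5 / n) with hρ
  have hρ0 : 0 ≤ ρ := by positivity
  have hy : ρ ^ 2 * (c * n * L) = c ^ 5 * (L ^ 11 / n) := by rw [hρ]; field_simp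
  have hD2 : (D:ℝ) ≤ 2 * L / log b := by
    rw [le_div_iff₀ hlb, ← log_pow]
    rw [pow_one, mul_div, div_le_one hn'] at h3
    have h5 : b ^ D ≤ (n:ℝ) ^ 2 := by
      refine hD.trans ?_
      calc c * n * L = (c * L) * n := by ring
        _ ≤ n * n := by gcongr
        _ = _ := by ring
    have := log_le_log (by positivity) h5
    rw [log_pow n] at this
    exact_mod_cast this
  have hterm : ∀ e ∈ Icc 2 D, (v.choose e : ℝ) * b ^ e.choose 2 * ((u:ℝ) / m₀) ^ e ≤
      ρ ^ 2 * b ^ 3 + (ρ ^ 2 * (c * n * L)) ^ 2 := by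
    intro e he
    rw [Finset.mem_Icc] at he
    refine le_trans ?_ (overlap_term_le hb hρ0 h1 hD (by rw [hy]; exact h2) he.1 he.2)
    have h6 : (v.choose e : ℝ) ≤ (v:ℝ) ^ e := by exact_mod_cast Nat.choose_le_pow v e
    calc (v.choose e : ℝ) * b ^ e.choose 2 * ((u:ℝ) / m₀) ^ e
        ≤ (v:ℝ) ^ e * b ^ e.choose 2 * ((u:ℝ) / m₀) ^ e := by gcongr
      _ = (v * (u / m₀)) ^ e * b ^ e.choose 2 := by rw [mul_pow]; ring
      _ ≤ ρ ^ e * b ^ e.choose 2 := by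
        gcongr
        calc (v:ℝ) * (u / m₀) ≤ (c * L) * ((c * L) / (n / L ^ 3)) := by gcongr
          _ = ρ := by rw [hρ]; field_simp
  refine (Finset.sum_le_card_nsmul _ _ _ hterm).trans ?_
  rw [nsmul_eq_mul, Nat.card_Icc, hy]
  have hcard : ((D + 1 - 2 : ℕ) : ℝ) ≤ 2 * L / log b := by
    refine le_trans ?_ hD2
    exact_mod_cast (by omega)
  have h7 : ρ ^ 2 * b ^ 3 + (c ^ 5 * (L ^ 11 / n)) ^ 2 ≤
      (c ^ 4 * b ^ 3 + c ^ 10) * (L ^ 22 / n ^ 2) := by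
    have : L ^ 10 ≤ L ^ 22 := pow_le_pow_right₀ hL (by norm_num)
    calc ρ ^ 2 * b ^ 3 + (c ^ 5 * (L ^ 11 / n)) ^ 2
        = c ^ 4 * b ^ 3 * (L ^ 10 / n ^ 2) + c ^ 10 * (L ^ 22 / n ^ 2) := by rw [hρ]; ring
      _ ≤ c ^ 4 * b ^ 3 * (L ^ 22 / n ^ 2) + c ^ 10 * (L ^ 22 / n ^ 2) := by gcongr
      _ = _ := by ring
  calc ((D + 1 - 2 : ℕ) : ℝ) * (ρ ^ 2 * b ^ 3 + (c ^ 5 * (L ^ 11 / n)) ^ 2)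
      ≤ (2 * L / log b) * ((c ^ 4 * b ^ 3 + c ^ 10) * (L ^ 22 / n ^ 2)) := by gcongr
    _ = ((2 / log b) * (c ^ 4 * b ^ 3 + c ^ 10) * (L ^ 23 / (n:ℝ) ^ (1 / 2 : ℝ))) *
        ((n:ℝ) ^ (1 / 2 : ℝ) / n ^ 2) := by field_simp
    _ ≤ 1 * ((n:ℝ) ^ (1 / 2 : ℝ) / n ^ 2) := by gcongr
    _ = _ := by
      rw [one_mul, ← rpow_natCast, ← rpow_sub hn']
      norm_num

/-- Every number at least one lies between consecutive powers of `b`. -/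
lemma exists_pow_le_lt {b x : ℝ} (hb : 1 < b) (hx : 1 ≤ x) :
    ∃ D : ℕ, b ^ D ≤ x ∧ x ≤ b ^ (D + 1) := by
  obtain ⟨D, h1, h2⟩ := exists_nat_pow_near hx hb
  exact ⟨D, h1, h2.le⟩

end OverlapAsymptotics

section Coupling

lemma coupling_factorial_le {q : ℝ} (hq : 0 < q) {m r u : ℕ} (hum : u ≤ m) (vs : List ℕ)
    (hvs : vs.Subperm (List.replicate r u)) :
    (vs.map fun v => (List.replicate r u).length * 1 * (1 / q) ^ v.choose 2 * (4 / 3 : ℝ) *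
      v.factorial).prod * ((m + r * u) - vs.sum).factorial ≤
      1 * (4 / 3 * r / muNat m u q) ^ vs.length * (m + r * u).factorial := by
  set s := vs.length with hs
  have hsr : s ≤ r := by simpa using hvs.length_le
  have hvs' : vs = List.replicate s u := List.eq_replicate_iff.2
    ⟨rfl, fun a ha => List.eq_of_mem_replicate (hvs.subset ha)⟩
  have hμ := muNat_pos hq hum
  clear_value s
  subst hvs'
  simp only [List.map_replicate, List.prod_replicate, List.sum_replicate, List.length_replicate,
    smul_eq_mul]
  have hsu : s * u ≤ r * u := Nat.mul_le_mul_right u hsr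
  have h1 := Nat.factorial_mul_descFactorial (show s * u ≤ m + r * u by omega)
  have h2 : (m:ℝ) ^ (s * u) ≤ (m + r * u).descFactorial (s * u) := by
    have h3 := Nat.pow_sub_le_descFactorial (m + r * u) (s * u)
    refine le_trans ?_ (Nat.cast_le.2 h3)
    push_cast
    gcongr
    omega
  have h4 : (r:ℝ) * 1 * (1 / q) ^ u.choose 2 * (4 / 3) * u.factorial ≤
      (4 / 3 * r / muNat m u q) * m ^ u := by
    rw [div_mul_eq_mul_div, le_div_iff₀ hμ, muNat]
    have h5 := Nat.choose_le_pow_div (α := ℝ) u m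
    rw [le_div_iff₀ (by positivity)] at h5
    calc (r:ℝ) * 1 * (1 / q) ^ u.choose 2 * (4 / 3) * u.factorial *
          ((m.choose u) * q ^ u.choose 2)
        = 4 / 3 * r * ((m.choose u) * u.factorial) * ((1 / q) ^ u.choose 2 * q ^ u.choose 2) := by
          ring
      _ = 4 / 3 * r * ((m.choose u) * u.factorial) := by
          rw [← mul_pow, one_div_mul_cancel hq.ne', one_pow, mul_one]
      _ ≤ 4 / 3 * r * m ^ u := by gcongr
  rw [← h1]
  push_cast
  rw [one_mul]
  calc ((r:ℝ) * 1 * (1 / q) ^ u.choose 2 * (4 / 3) * u.factorial) ^ s *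
        (m + r * u - s * u).factorial
      ≤ ((4 / 3 * r / muNat m u q) * m ^ u) ^ s * (m + r * u - s * u).factorial := by
        gcongr
    _ = (4 / 3 * r / muNat m u q) ^ s * ((m + r * u - s * u).factorial * m ^ (s * u)) := by
        rw [mul_pow, ← pow_mul, mul_comm u s]; ring
    _ ≤ _ := by
        gcongr

lemma exp_half_mul_exp_lt : exp (1 / 2) * exp (4 / 3) < 8.1 := by
  rw [← exp_add]
  have h6 : exp (1 / 2 + 4 / 3 : ℝ) ≤ exp 2 := exp_le_exp.2 (by norm_num)
  have h7 : exp (2:ℝ) = exp 1 * exp 1 := by rw [← exp_add]; norm_num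
  have h8 := exp_one_lt_d9
  have h9 : exp (1:ℝ) * exp 1 < 2.7182818286 * 2.7182818286 := by
    apply mul_lt_mul'' h8 h8 (exp_pos 1).le (exp_pos 1).le
  norm_num at h9 ⊢
  linarith

lemma le_add_of_overlap_bounds {p g : ℝ} (hp0 : 0 < p) (hp1 : p < 1) {m r u D : ℕ} (hm : 0 < m)
    (hum : u ≤ m) (hrμ : (r:ℝ) ^ 2 ≤ muNat m u (1 - p))
    (hD : 4 * (((m + r * u : ℕ) : ℝ) * u) ≤ (1 / (1 - p)) ^ (D + 1))
    (hg : ∑ e ∈ Icc 2 D, (u.choose e : ℝ) * (1 / (1 - p)) ^ e.choose 2 * ((u:ℝ) / m) ^ e ≤ g)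
    (hg0 : 0 ≤ g) (hgr : g * (r:ℝ) ^ 2 ≤ 1 / 2)
    {s t : ℝ} (hs : 0.9 ≤ probGe p (m + r * u) s) (ht : 0.9 ≤ probLe p m t) : s ≤ t + r := by
  have hq : 0 < 1 - p := by linarith
  have hμ := muNat_pos hq hum
  have hζ : 0 ≤ 4 / 3 * (r:ℝ) / muNat m u (1 - p) := div_nonneg (by positivity) hμ.le
  have hmem : ∀ v ∈ List.replicate r u, v = u := fun v hv => List.eq_of_mem_replicate hv
  have h := indepCount_second_moment (us := List.replicate r u) (κ := 1) (t := u) (C₀ := 1)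
    (n := m + r * u) (m₀ := m) (ζ := 4 / 3 * r / muNat m u (1 - p)) (g := g)
    hp0 hp1 zero_le_one (by positivity) hζ zero_le_one hg0 hm
    (fun v hv => by rw [hmem v hv]; exact hum)
    (fun v hv w hw d hd => by
      rw [hmem v hv]; rw [hmem w hw] at hd ⊢
      rw [one_mul, ← Nat.choose_symm hd]
      exact_mod_cast Nat.choose_le_pow u (u - d))
    hD
    (fun v hv w hw => by rw [hmem v hv, hmem w hw]; exact hg)
    (by simp [add_comm])
    (coupling_factorial_le hq hum)
  rw [List.length_replicate, one_mul] at h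
  have h3 : ((1 + g) ^ r) ^ r ≤ exp (1 / 2) := by
    calc ((1 + g) ^ r) ^ r ≤ ((exp g) ^ r) ^ r := by
          gcongr; linarith [add_one_le_exp g]
      _ = exp (g * (r:ℝ) ^ 2) := by
          rw [← exp_nat_mul, ← exp_nat_mul]; congr 1; ring
      _ ≤ _ := exp_le_exp.2 hgr
  have h4 : (1 + 4 / 3 * r / muNat m u (1 - p)) ^ r ≤ exp (4 / 3) := by
    calc (1 + 4 / 3 * r / muNat m u (1 - p)) ^ r
        ≤ (exp (4 / 3 * r / muNat m u (1 - p))) ^ r := by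
          gcongr; linarith [add_one_le_exp (4 / 3 * (r:ℝ) / muNat m u (1 - p))]
      _ = exp (4 / 3 * ((r:ℝ) ^ 2 / muNat m u (1 - p))) := by
          rw [← exp_nat_mul]; congr 1; ring
      _ ≤ exp (4 / 3) := by
          rw [exp_le_exp]
          have := (div_le_one hμ).2 hrμ
          linarith
  have hB : ((1 + g) ^ r) ^ r * (1 + 4 / 3 * r / muNat m u (1 - p)) ^ r < 8.1 :=
    (mul_le_mul h3 h4 (pow_nonneg (add_nonneg zero_le_one hζ) r) (exp_pos _).le).trans_lt exp_half_mul_exp_lt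
  have hsum : m + r * u = m + (List.replicate r u).sum := by rw [List.sum_replicate, smul_eq_mul]
  have h2 := le_add_length_of_second_moment hp0 hp1 hsum h hB hs ht
  rwa [List.length_replicate] at h2

/-- Adding `r` colour classes of size `u` to `m` vertices moves the typical range of the chromatic
number by at most `r`, provided that `r²` is at most the expected number of independent
`u`-sets. -/
theorem eventually_coupling {p : ℝ} (hp0 : 0 < p) (hp1 : p < 1) (K : ℝ) :
    ∀ᶠ m : ℕ in atTop, ∀ u r : ℕ, |(u:ℝ) - alpha0 (1 / (1 - p)) m| ≤ K →
      (r:ℝ) ^ 2 ≤ muNat m u (1 - p) → (r:ℝ) ^ 2 ≤ m → r * u ≤ m →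
      ∀ s t : ℝ, 0.9 ≤ probGe p (m + r * u) s → 0.9 ≤ probLe p m t → s ≤ t + r := by
  have hq : 0 < 1 - p := by linarith
  set b := 1 / (1 - p) with hbd
  have hb : 1 < b := by rw [hbd, lt_div_iff₀ hq]; linarith
  have hlb := log_pos hb
  have hc : 0 < 8 * (2 / log b + 1) := by positivity
  filter_upwards [eventually_near_alpha0 hb K one_pos,
    eventually_near_alpha0 hb K (show 0 < 2 / log b by positivity),
    eventually_log_muNat hp0 hp1 K one_pos,
    eventually_overlap_sum_le hb hc, eventually_gt_atTop 0,
    tendsto_log_nat.eventually_ge_atTop 1,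
    ((tendsto_log_pow_div_rpow 0 (show (0:ℝ) < 1 / 2 by norm_num))).eventually_le_const
      (show (0:ℝ) < 1 / 2 by norm_num)]
    with m h1 h1' h2 h3 hm hL h4 u r hu hrμ hrm hrum s t hs ht
  have hm' : (0:ℝ) < m := by exact_mod_cast hm
  have hum : u ≤ m := by have := (h2 u hu).1; omega
  have hu1 := (h1 u hu).2
  rcases Nat.eq_zero_or_pos u with rfl | hu0
  · have hlen : r = 0 ∨ 0 < r := Nat.eq_zero_or_pos r
    have hst : s ≤ t := by
      by_contra! hlt
      have := probLe_add_probGe (p := p) m hp0.le hp1.le hlt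
      simp only [mul_zero, add_zero] at hs
      norm_num at hs ht
      linarith
    have : (0:ℝ) ≤ r := by positivity
    linarith
  have hu0' : (1:ℝ) ≤ u := by exact_mod_cast hu0
  have hrum' : (((m + r * u : ℕ) : ℝ)) ≤ 2 * m := by
    have : ((m + r * u : ℕ) : ℝ) ≤ ((2 * m : ℕ) : ℝ) := by exact_mod_cast (by omega)
    simpa using this
  have hmr : (1:ℝ) ≤ ((m + r * u : ℕ) : ℝ) := by exact_mod_cast (by omega)
  obtain ⟨D, hD1, hD2⟩ := exists_pow_le_lt hb
    (show (1:ℝ) ≤ 4 * (((m + r * u : ℕ) : ℝ) * u) by nlinarith)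
  refine le_add_of_overlap_bounds hp0 hp1 hm hum hrμ hD2 (h3 m D u u ?_ ?_ ?_ ?_) (by positivity) ?_ hs ht
  · have : (0:ℝ) ≤ (2 / log b + 1) * log m := by positivity
    linarith
  · have : (0:ℝ) ≤ (2 / log b + 1) * log m := by positivity
    linarith
  · exact div_le_self hm'.le (one_le_pow₀ hL)
  · calc b ^ D ≤ 4 * (((m + r * u : ℕ) : ℝ) * u) := hD1
      _ ≤ 4 * ((2 * m) * ((2 / log b + 1) * log m)) := by gcongr
      _ = _ := by ring
  · calc (m:ℝ) ^ (-(3 / 2) : ℝ) * (r:ℝ) ^ 2 ≤ (m:ℝ) ^ (-(3 / 2) : ℝ) * m := by gcongr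
      _ = (log (m:ℝ)) ^ 0 / (m:ℝ) ^ (1 / 2 : ℝ) := by
        rw [pow_zero, one_div, ← rpow_neg hm'.le]
        nth_rewrite 2 [← rpow_one (m:ℝ)]
        rw [← rpow_add hm']
        norm_num
      _ ≤ 1 / 2 := h4

end Coupling

section UpperBound

lemma exists_perm_of_subperm_replicate {a c x y : ℕ} {vs : List ℕ}
    (h : vs.Subperm (List.replicate a x ++ List.replicate c y)) :
    ∃ i ≤ a, ∃ j ≤ c, vs.Perm (List.replicate i x ++ List.replicate j y) := by
  obtain ⟨l, hl, hsub⟩ := h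
  obtain ⟨l₁, l₂, rfl, h₁, h₂⟩ := List.sublist_append_iff.1 hsub
  obtain ⟨i, hi, rfl⟩ := List.sublist_replicate_iff.1 h₁
  obtain ⟨j, hj, rfl⟩ := List.sublist_replicate_iff.1 h₂
  exact ⟨i, hi, j, hj, hl.symm⟩

lemma factorial_sub_le {n S : ℕ} (hS : S < n) :
    ((n - S).factorial : ℝ) ≤
      exp (-(S * log n) + S - S * (1 - S / n)) * (exp 1 * n) * n.factorial := by
  have hn : (0:ℝ) < n := by exact_mod_cast (by omega)
  have hS' : (0:ℝ) < n - S := by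
    have : (S:ℝ) < n := by exact_mod_cast hS
    linarith
  have hcast : ((n - S : ℕ) : ℝ) = n - S := by rw [Nat.cast_sub hS.le]
  have h1 := log_factorial_le (n - S) (by omega)
  have h2 := pow_div_exp_le_factorial n (by omega)
  rw [hcast] at h1
  have h3 : log ((n:ℝ) - S) ≤ log n - S / n := by
    have := log_le_sub_one_of_pos (show (0:ℝ) < (n - S) / n by positivity)
    rw [log_div hS'.ne' hn.ne', sub_div, div_self hn.ne'] at this
    linarith
  have h4 : ((n:ℝ) - S) * log (n - S) ≤ (n - S) * (log n - S / n) := by gcongr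
  have h5 : log ((n:ℝ) - S) ≤ log n := by
    apply log_le_log hS'; linarith [(show (0:ℝ) ≤ S by positivity)]
  have h6 : ((n:ℝ) - S) * (log n - S / n) = n * log n - S * log n - S * (1 - S / n) := by
    field_simp
  have h7 : log ((n - S).factorial) ≤
      (-(S * log n) + S - S * (1 - S / n)) + 1 + log n + log n.factorial := by
    linarith
  calc ((n - S).factorial : ℝ) = exp (log ((n - S).factorial)) :=
        (exp_log (by positivity)).symm
    _ ≤ exp ((-(S * log n) + S - S * (1 - S / n)) + 1 + log n + log n.factorial) :=
        exp_le_exp.2 h7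
    _ = _ := by
      rw [exp_add, exp_add, exp_add, exp_log hn, exp_log (by positivity)]
      ring

lemma weighted_sum_le {l₁ l₀ k t y n L η θ : ℝ} (h₁ : 0 ≤ l₁) (h₀ : 0 ≤ l₀) (hk : 0 < k)
    (h₁y : l₁ ≤ y * k) (hlk : l₁ + l₀ ≤ k) (ht : 0 < t) (hy : 0 ≤ y) (hn : k * (t + y) ≤ n)
    (hL : 0 ≤ L) (hθ : 0 ≤ θ) (htL : (1 - θ) * L ≤ t ^ 2 / (t + y)) :
    l₁ * ((1 - y - η + θ) * L) + l₀ * ((-y - η + θ) * L) -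
      (l₁ * (t + 1) + l₀ * t) * (1 - (l₁ * (t + 1) + l₀ * t) / n) ≤
      (-η + 2 * θ) * (l₁ + l₀) * L := by
  set l := l₁ + l₀ with hl
  have hl0 : 0 ≤ l := by positivity
  have hS : l₁ * (t + 1) + l₀ * t = l * t + l₁ := by rw [hl]; ring
  rw [hS]
  set S := l * t + l₁ with hSd
  have hS0 : 0 ≤ S := by positivity
  have hkt : 0 < k * (t + y) := by positivity
  have h2 : (k - l) * t / (k * (t + y)) ≤ 1 - S / n := by
    have h3 : S / n ≤ S / (k * (t + y)) := by gcongr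
    have h4 : (k - l) * t / (k * (t + y)) ≤ 1 - S / (k * (t + y)) := by
      rw [le_sub_iff_add_le, ← add_div, div_le_one hkt, hSd]
      linarith
    linarith
  have hkl : 0 ≤ k - l := by linarith
  have h0 : 0 ≤ (k - l) * t / (k * (t + y)) := by positivity
  have h5 : (l * t) * ((k - l) * t / (k * (t + y))) ≤ S * (1 - S / n) := by
    gcongr
    linarith
  have h6 : (l * t) * ((k - l) * t / (k * (t + y))) = (l * (k - l) / k) * (t ^ 2 / (t + y)) := by
    field_simp
  have h7 : (l * (k - l) / k) * ((1 - θ) * L) ≤ (l * (k - l) / k) * (t ^ 2 / (t + y)) := by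
    gcongr
  have h8 : l * (k - l) / k ≤ l := by
    rw [div_le_iff₀ hk]; nlinarith
  have h9 : l₁ - y * l ≤ l * (k - l) / k := by
    rw [le_div_iff₀ hk]
    rcases le_total (y * k) l with h | h
    · nlinarith
    · nlinarith
  have h10 := mul_le_mul_of_nonneg_right h9 hL
  have h11 := mul_le_mul_of_nonneg_right h8 (mul_nonneg hθ hL)
  have h12 : l₁ * ((1 - y - η + θ) * L) + l₀ * ((-y - η + θ) * L) =
      (l₁ - y * l) * L + (-η + θ) * l * L := by rw [hl]; ring
  rw [h12]
  linarith

/-- The normalised joint weight of a subfamily is small. -/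
lemma subfamily_weight_le {b κ η θ y : ℝ} {n k k₁ k₀ t : ℕ} (hb : 0 < b) (hκ : 0 < κ)
    (hk : 0 < k) (hk₁ : (k₁:ℝ) ≤ y * k) (hkk : k₁ + k₀ = k) (ht : 0 < t) (hy : 0 ≤ y)
    (hn : k * (t + y) ≤ n) (hsum : k₁ * (t + 1) + k₀ * t < n)
    (hL : 0 ≤ log (n:ℝ)) (hθ : 0 ≤ θ) (htL : (1 - θ) * log n ≤ (t:ℝ) ^ 2 / (t + y))
    (hA₁ : log k + log κ + log (4 / 3) - expo b n (t + 1) + (t + 1) ≤ (1 - y - η + θ) * log n)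
    (hA₀ : log k + log κ + log (4 / 3) - expo b n t + t ≤ (-y - η + θ) * log n)
    (vs : List ℕ) (hvs : vs.Subperm (List.replicate k₁ (t + 1) ++ List.replicate k₀ t)) :
    (vs.map fun u => ((List.replicate k₁ (t + 1) ++ List.replicate k₀ t).length : ℝ) * κ *
      b ^ u.choose 2 * (4 / 3) * u.factorial).prod * (n - vs.sum).factorial ≤
      (exp 1 * n) * exp ((-η + 2 * θ) * log n) ^ vs.length * n.factorial := by
  obtain ⟨i, hi, j, hj, hp⟩ := exists_perm_of_subperm_replicate hvs
  have hlen : (List.replicate k₁ (t + 1) ++ List.replicate k₀ t).length = k := by simp [hkk]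
  rw [(hp.map _).prod_eq, hp.sum_eq, hp.length_eq, hlen]
  simp only [List.map_append, List.map_replicate, List.prod_append, List.prod_replicate,
    List.sum_append, List.sum_replicate, List.length_append, List.length_replicate, smul_eq_mul]
  set S := i * (t + 1) + j * t with hS
  have hSn : S < n := by
    have h1 := Nat.mul_le_mul_right (t + 1) hi
    have h2 := Nat.mul_le_mul_right t hj
    omega
  have hn' : (0:ℝ) < n := by exact_mod_cast (by omega)
  have hk' : (0:ℝ) < k := by exact_mod_cast hk
  have hF : ∀ u : ℕ, (k:ℝ) * κ * b ^ u.choose 2 * (4 / 3) * u.factorial =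
      exp (log k + log κ + log (4 / 3) - expo b n u + u * log n) := by
    intro u
    rw [← exp_log (show 0 < (k:ℝ) * κ * b ^ u.choose 2 * (4 / 3) * u.factorial by positivity),
      log_mul (by positivity) (by positivity), log_mul (by positivity) (by positivity),
      log_mul (by positivity) (by positivity), log_mul (by positivity) (by positivity),
      log_pow, Nat.cast_choose_two, expo]
    ring_nf
  have hSc : (S:ℝ) = i * (t + 1) + j * t := by rw [hS]; push_cast; ring
  have hw := weighted_sum_le (l₁ := i) (l₀ := j) (k := k) (t := t) (y := y) (n := n)
    (L := log n) (η := η) (θ := θ) (by positivity) (by positivity) hk'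
    (le_trans (by exact_mod_cast hi) hk₁) (by exact_mod_cast (by omega))
    (by exact_mod_cast ht) hy hn hL hθ htL
  rw [← hSc] at hw
  rw [hF, hF, ← exp_nat_mul, ← exp_nat_mul, ← exp_nat_mul]
  have h1 := mul_le_mul_of_nonneg_left hA₁ (Nat.cast_nonneg (α := ℝ) i)
  have h0 := mul_le_mul_of_nonneg_left hA₀ (Nat.cast_nonneg (α := ℝ) j)
  calc exp (i * (log k + log κ + log (4 / 3) - expo b n (t + 1) + ((t + 1 : ℕ) : ℝ) * log n)) *
        exp (j * (log k + log κ + log (4 / 3) - expo b n t + t * log n)) * (n - S).factorial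
      ≤ exp (i * (log k + log κ + log (4 / 3) - expo b n (t + 1) + ((t + 1 : ℕ) : ℝ) * log n)) *
        exp (j * (log k + log κ + log (4 / 3) - expo b n t + t * log n)) *
        (exp (-(S * log n) + S - S * (1 - S / n)) * (exp 1 * n) * n.factorial) := by
        gcongr
        exact factorial_sub_le hSn
    _ = exp (i * (log k + log κ + log (4 / 3) - expo b n (t + 1) + ((t + 1 : ℕ) : ℝ) * log n) +
        j * (log k + log κ + log (4 / 3) - expo b n t + t * log n) +
        (-(S * log n) + S - S * (1 - S / n))) * (exp 1 * n) * n.factorial := by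
        rw [exp_add, exp_add]; ring
    _ ≤ exp (((i + j : ℕ) : ℝ) * ((-η + 2 * θ) * log n)) * (exp 1 * n) * n.factorial := by
        gcongr
        have h3 : (S:ℝ) * log n = i * (((t + 1 : ℕ) : ℝ) * log n) + j * (t * log n) := by
          rw [hSc]; push_cast; ring
        have h4 : ((i + j : ℕ) : ℝ) * ((-η + 2 * θ) * log n) =
          (-η + 2 * θ) * (i + j) * log n := by push_cast; ring
        rw [h4]
        linarith
    _ = _ := by ring

lemma choose_le_mul_pow {t v u d : ℕ} (hv : v ≤ t + 1) (hvu : v ≤ u + 1) (hd : d ≤ u) :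
    (v.choose d : ℝ) ≤ ((t + 1 : ℕ) : ℝ) * ((t + 1 : ℕ) : ℝ) ^ (u - d) := by
  rcases lt_or_ge v d with h | h
  · rw [Nat.choose_eq_zero_of_lt h, Nat.cast_zero]; positivity
  · rw [← pow_succ', ← Nat.choose_symm h]
    have h1 : v.choose (v - d) ≤ (t + 1) ^ (u - d + 1) :=
      (Nat.choose_le_pow v _).trans ((Nat.pow_le_pow_left hv _).trans
        (Nat.pow_le_pow_right (by omega) (by omega)))
    exact_mod_cast h1

set_option maxHeartbeats 1000000 in
/-- A crude lower bound on the probability of having few colours. -/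
lemma eventually_one_le_mul_probLe {p η : ℝ} (hp0 : 0 < p) (hp1 : p < 1)
    (hlb2 : log (1 / (1 - p)) ≤ 2) (hη : 0 < η) (hη1 : η ≤ 1) :
    ∀ᶠ n : ℕ in atTop, ∃ a : ℕ,
      (a:ℝ) ≤ n / (tau0 (1 / (1 - p)) n + -η) + n / log n ^ 3 + (tau0 (1 / (1 - p)) n + -η) + 1 ∧
      1 ≤ exp (1 + log n + (n:ℝ) ^ (1 / 2 : ℝ) + (n:ℝ) ^ (1 - η / 2)) * probLe p n a := by
  have hq : 0 < 1 - p := by linarith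
  set b := 1 / (1 - p) with hbd
  have hb : 1 < b := by rw [hbd, lt_div_iff₀ hq]; linarith
  have hlb := log_pos hb
  set θ := η / 4 with hθd
  have hθ : 0 < θ := by positivity
  set C := 2 / log b + 1 with hCd
  have hC : 0 < C := by positivity
  have hlb1 : 1 ≤ 2 / log b := by rw [le_div_iff₀ hlb]; linarith
  set K := 3 + 2 / log b with hK
  filter_upwards [tendsto_log_nat.eventually_ge_atTop 2,
    tendsto_log_nat.eventually_ge_atTop (2 / θ), eventually_gt_atTop 0,
    (tendsto_tau0_add hb (-η)).eventually_ge_atTop 2,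
    (tendsto_tau0_add_div_nat hb (-η)).eventually_le_const (show (0:ℝ) < 1 / 2 by norm_num),
    eventually_near_alpha0 hb K one_pos,
    eventually_near_alpha0 hb K (show 0 < θ / 8 by positivity),
    eventually_expo hb K (show 0 < θ / 8 by positivity),
    eventually_overlap_sum_le hb (show 0 < 8 * C by positivity),
    ((tendsto_log_pow_div_nat 4).const_mul C).eventually_le_const (show C * 0 < 1 by simp),
    ((tendsto_log_pow_div_rpow 1 (show 0 < θ / 8 by positivity)).const_mul
      (4 / 3 * C)).eventually_le_const (show 4 / 3 * C * 0 < 1 by simp)]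
    with n hL2 hLθ hn hτ2 hτn hnear hnear2 hexpo hover hL4 hlogt
  have hn' : (0:ℝ) < n := by exact_mod_cast hn
  set L := log (n:ℝ) with hLd
  have hL0 : 0 < L := by linarith
  set τ := tau0 b n + -η with hτd
  rw [div_le_iff₀ hn'] at hτn
  set t := ⌊τ⌋₊ with htd
  set y := τ - t with hyd
  have hy0 : 0 ≤ y := by have := Nat.floor_le (show 0 ≤ τ by linarith); linarith
  have hy1 : y < 1 := by have := Nat.lt_floor_add_one τ; linarith
  have hty : (t:ℝ) + y = τ := by rw [hyd]; ring
  have ht2 : 2 ≤ t := Nat.le_floor (by exact_mod_cast hτ2)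
  have ht2' : (2:ℝ) ≤ t := by exact_mod_cast ht2
  have hL3 : (n:ℝ) / L ^ 3 ≤ n / 8 := by
    have : (2:ℝ) ^ 3 ≤ L ^ 3 := by gcongr
    apply div_le_div_of_nonneg_left hn'.le (by norm_num) (by linarith)
  have hL3' : 0 < (n:ℝ) / L ^ 3 := by positivity
  set x := ((n:ℝ) - n / L ^ 3) / τ with hxd
  have hx0 : 0 ≤ x := div_nonneg (by linarith) (by linarith)
  set k := ⌊x⌋₊ with hkd
  have hxτ : x * τ = n - n / L ^ 3 := by rw [hxd]; field_simp
  have hkx : (k:ℝ) ≤ x := Nat.floor_le hx0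
  have hxk : x < k + 1 := Nat.lt_floor_add_one x
  have hk : 0 < k := Nat.floor_pos.2 (by rw [hxd, one_le_div (by linarith)]; linarith)
  have hk' : (0:ℝ) < k := by exact_mod_cast hk
  have hkτ : k * τ ≤ n - n / L ^ 3 := by rw [← hxτ]; gcongr
  have hkτ' : n - n / L ^ 3 - τ ≤ k * τ := by
    have : x * τ ≤ (k + 1) * τ := by gcongr
    linarith
  have hkn : (k:ℝ) ≤ n := (le_mul_of_one_le_right hk'.le (by linarith)).trans (hkτ.trans (by linarith))
  set k₁ := ⌊y * k⌋₊ with hk₁d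
  have hk₁ : (k₁:ℝ) ≤ y * k := Nat.floor_le (by positivity)
  have hk₁' : y * k < k₁ + 1 := Nat.lt_floor_add_one _
  have hk₁k : k₁ ≤ k := by
    have : (k₁:ℝ) ≤ k := hk₁.trans (mul_le_of_le_one_left hk'.le hy1.le)
    exact_mod_cast this
  obtain ⟨k₀, hk₀⟩ : ∃ k₀, k₁ + k₀ = k := ⟨k - k₁, by omega⟩
  set us := List.replicate k₁ (t + 1) ++ List.replicate k₀ t with hus
  have hlen : us.length = k := by simp [hus, hk₀]
  have hsum : us.sum = k * t + k₁ := by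
    simp only [hus, List.sum_append, List.sum_replicate, smul_eq_mul, ← hk₀]; ring
  have hsum' : (us.sum : ℝ) = k * t + k₁ := by rw [hsum]; push_cast; ring
  have hkty : (k:ℝ) * τ = k * t + y * k := by rw [← hty]; ring
  have hsumle : (us.sum:ℝ) ≤ n - n / L ^ 3 := by rw [hsum']; linarith
  obtain ⟨m₀, hm₀⟩ : ∃ m₀, n = m₀ + us.sum := by
    have : us.sum ≤ n := by
      have : (us.sum:ℝ) ≤ n := by linarith
      exact_mod_cast this
    exact ⟨n - us.sum, by omega⟩
  have hm₀' : (n:ℝ) = m₀ + us.sum := by exact_mod_cast hm₀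
  have hm₀ge : n / L ^ 3 ≤ (m₀:ℝ) := by linarith
  have hm₀pos : 0 < m₀ := by
    have : (0:ℝ) < m₀ := by linarith
    exact_mod_cast this
  have hα : alpha0 b n = τ + η + 1 + 2 / log b := by rw [hτd, tau0]; ring
  have hd1 : |((t + 1 : ℕ) : ℝ) - alpha0 b n| ≤ K := by
    rw [hα, abs_le, hK]; push_cast; constructor <;> linarith
  have hd0 : |(t : ℝ) - alpha0 b n| ≤ K := by
    rw [hα, abs_le, hK]; constructor <;> linarith
  have ht1C : ((t + 1 : ℕ) : ℝ) ≤ C * L := (hnear _ hd1).2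
  have hmem : ∀ u ∈ us, t ≤ u ∧ u ≤ t + 1 := by
    intro u hu
    rw [hus, List.mem_append, List.mem_replicate, List.mem_replicate] at hu
    omega
  have hCL : 0 ≤ C * L := by positivity
  have hmemL : ∀ u ∈ us, (u:ℝ) ≤ C * L := fun u hu =>
    le_trans (by exact_mod_cast (hmem u hu).2) ht1C
  have hum : ∀ u ∈ us, u ≤ m₀ := by
    intro u hu
    have h1 : C * L ≤ n / L ^ 3 := by
      rw [le_div_iff₀ (by positivity)]
      have := mul_le_mul_of_nonneg_right hL4 hn'.le
      have h2 : C * (L ^ 4 / n) * n = C * L * L ^ 3 := by field_simp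
      linarith
    have : (u:ℝ) ≤ m₀ := by linarith [hmemL u hu]
    exact_mod_cast this
  obtain ⟨D, hD1, hD2⟩ := exists_pow_le_lt hb
    (show (1:ℝ) ≤ 4 * (n * ((t + 1 : ℕ) : ℝ)) by
      have h1 : (1:ℝ) ≤ n := by exact_mod_cast hn
      have h2 : (1:ℝ) ≤ ((t + 1 : ℕ) : ℝ) := by push_cast; linarith
      linarith [one_le_mul_of_one_le_of_one_le h1 h2])
  have hlogs : log k + log ((t + 1 : ℕ) : ℝ) + log (4 / 3) ≤ L + θ / 8 * L := by
    have h1 : log (k:ℝ) ≤ L := log_le_log hk' hkn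
    have h2 : ((t + 1 : ℕ) : ℝ) * (4 / 3) ≤ (n:ℝ) ^ (θ / 8) := by
      rw [pow_one, mul_div, div_le_one (by positivity)] at hlogt
      linarith
    have h3 := log_le_log (by positivity) h2
    rw [log_mul (by positivity) (by positivity), log_rpow hn'] at h3
    linarith
  have he1 := abs_le.1 (hexpo _ hd1)
  have he0 := abs_le.1 (hexpo _ hd0)
  have hθL : 0 ≤ θ * L := by positivity
  have hA : ∀ u : ℕ, |(u : ℝ) - alpha0 b n| ≤ K →
      log k + log ((t + 1 : ℕ) : ℝ) + log (4 / 3) - expo b n u + u ≤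
        (1 + 2 / log b - (alpha0 b n - u) + θ) * L := by
    intro u hu
    have h1 := (abs_le.1 (hexpo _ hu)).1
    have h2 := (hnear2 _ hu).2
    linarith
  have hJ := subfamily_weight_le (b := b) (κ := ((t + 1 : ℕ) : ℝ)) (η := η) (θ := θ) (y := y)
    (n := n) (k := k) (k₁ := k₁) (k₀ := k₀) (t := t) (by linarith) (by positivity) hk hk₁ hk₀
    (by omega) hy0 (by rw [hty]; linarith) (by
      have h1 : k₁ * (t + 1) + k₀ * t = us.sum := by rw [hsum, ← hk₀]; ring
      omega) hL0.le hθ.le (by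
      have h1 := (hnear2 _ hd0).1
      have h2 : (t:ℝ) - 1 ≤ t ^ 2 / (t + y) := by
        rw [le_div_iff₀ (by linarith)]
        linarith [mul_le_mul_of_nonneg_left hy1.le (show (0:ℝ) ≤ t - 1 by linarith)]
      have h3 : (1 - θ / 8) * L ≤ (2 / log b - θ / 8) * L := by gcongr
      have h4 : 2 ≤ θ * L := by rw [div_le_iff₀ hθ] at hLθ; linarith
      linarith) (by
      have h1 := hA _ hd1
      rw [hα] at h1
      push_cast at h1 ⊢
      refine h1.trans (le_of_eq ?_)
      rw [hyd]; ring) (by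
      have h1 := hA _ hd0
      rw [hα] at h1
      refine h1.trans (le_of_eq ?_)
      rw [hyd]; ring)
  have hX := indepCount_second_moment (us := us) (κ := ((t + 1 : ℕ) : ℝ))
    (t := ((t + 1 : ℕ) : ℝ)) (C₀ := exp 1 * n) (n := n) (m₀ := m₀)
    (ζ := exp ((-η + 2 * θ) * log n)) (g := (n:ℝ) ^ (-(3 / 2) : ℝ))
    hp0 hp1 (by positivity) (by positivity) (exp_pos _).le (by positivity) (by positivity) hm₀pos
    hum
    (fun v hv u hu d hd => choose_le_mul_pow (hmem v hv).2
      (by have := (hmem v hv).2; have := (hmem u hu).1; omega) hd)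
    hD2
    (fun v hv u hu => hover m₀ D v u (by linarith [hmemL v hv])
      (by linarith [hmemL u hu]) hm₀ge
      (by
        refine hD1.trans ?_
        have h1 : (n:ℝ) * ((t + 1 : ℕ) : ℝ) ≤ n * (C * L) := by gcongr
        have h2 : 0 ≤ (n:ℝ) * (C * L) := by positivity
        linarith))
    (by omega) hJ
  have hone := one_le_mul_probLe_of_second_moment hp0 hp1 hm₀ hX
  refine ⟨m₀ + us.length, ?_, hone.trans ?_⟩
  · rw [hlen]
    push_cast
    have h1 : x ≤ n / τ := by rw [hxd]; gcongr; linarith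
    linarith
  refine mul_le_mul_of_nonneg_right ?_ (by
    by_contra! h
    have h1 : 0 ≤ exp 1 * (n:ℝ) * ((1 + (n:ℝ) ^ (-(3 / 2) : ℝ)) ^ us.length) ^ us.length *
      (1 + exp ((-η + 2 * θ) * log n)) ^ us.length := by positivity
    linarith [mul_nonpos_of_nonneg_of_nonpos h1 h.le])
  rw [hlen]
  have h3 : ((1 + (n:ℝ) ^ (-(3 / 2) : ℝ)) ^ k) ^ k ≤ exp ((n:ℝ) ^ (1 / 2 : ℝ)) := by
    calc ((1 + (n:ℝ) ^ (-(3 / 2) : ℝ)) ^ k) ^ k ≤ ((exp ((n:ℝ) ^ (-(3 / 2) : ℝ))) ^ k) ^ k := by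
          gcongr; linarith [add_one_le_exp ((n:ℝ) ^ (-(3 / 2) : ℝ))]
      _ = exp (k ^ 2 * (n:ℝ) ^ (-(3 / 2) : ℝ)) := by
          rw [← exp_nat_mul, ← exp_nat_mul]; congr 1; ring
      _ ≤ exp (n ^ 2 * (n:ℝ) ^ (-(3 / 2) : ℝ)) := by gcongr
      _ = _ := by
          rw [← rpow_natCast, ← rpow_add hn']; norm_num
  have h4 : (1 + exp ((-η + 2 * θ) * log n)) ^ k ≤ exp ((n:ℝ) ^ (1 - η / 2)) := by
    have h5 : exp ((-η + 2 * θ) * log n) = (n:ℝ) ^ (-(η / 2)) := by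
      rw [rpow_def_of_pos hn', hθd]; ring_nf
    rw [h5]
    calc (1 + (n:ℝ) ^ (-(η / 2))) ^ k ≤ (exp ((n:ℝ) ^ (-(η / 2)))) ^ k := by
          gcongr; linarith [add_one_le_exp ((n:ℝ) ^ (-(η / 2)))]
      _ = exp (k * (n:ℝ) ^ (-(η / 2))) := by rw [← exp_nat_mul]
      _ ≤ exp (n * (n:ℝ) ^ (-(η / 2))) := by gcongr
      _ = _ := by
          nth_rewrite 1 [← rpow_one (n:ℝ)]
          rw [← rpow_add hn']; ring_nf
  have h6 : exp 1 * (n:ℝ) = exp (1 + L) := by rw [exp_add, hLd, exp_log hn']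
  calc exp 1 * (n:ℝ) * ((1 + (n:ℝ) ^ (-(3 / 2) : ℝ)) ^ k) ^ k *
        (1 + exp ((-η + 2 * θ) * log n)) ^ k
      ≤ exp (1 + L) * exp ((n:ℝ) ^ (1 / 2 : ℝ)) * exp ((n:ℝ) ^ (1 - η / 2)) := by
        rw [h6]; gcongr
    _ = _ := by rw [← exp_add, ← exp_add]

lemma probGe_anti {p : ℝ} (hp0 : 0 ≤ p) (hp1 : p ≤ 1) (n : ℕ) {a c : ℝ} (h : a ≤ c) :
    probGe p n c ≤ probGe p n a := by
  refine ev_mono hp0 hp1 fun A _ => ?_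
  split_ifs <;> linarith

/-- Upper bound on the chromatic number. -/
theorem eventually_upper_bound {p η ξ : ℝ} (hp0 : 0 < p) (hp1 : p < 1)
    (hlb2 : log (1 / (1 - p)) ≤ 2) (hη : 0 < η) (hη1 : η ≤ 1) (hξ : 0 < ξ) :
    ∀ᶠ n : ℕ in atTop, ∀ s : ℝ, 0.9 ≤ probGe p n s →
      s ≤ n / (tau0 (1 / (1 - p)) n + -η) + ξ * (n / log n ^ 2) := by
  have hq : 0 < 1 - p := by linarith
  set b := 1 / (1 - p) with hbd
  have hb : 1 < b := by rw [hbd, lt_div_iff₀ hq]; linarith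
  have hlb := log_pos hb
  obtain ⟨c, hc⟩ : ∃ c, c = η / 8 := ⟨_, rfl⟩
  have hc0 : 0 < c := by rw [hc]; positivity
  have hτL : Tendsto (fun n : ℕ => (tau0 b n + (-η + 1)) / log n * (log (n:ℝ) ^ 3 / n)) atTop
      (nhds 0) := by
    simpa using (tendsto_tau0_add_div_log hb (-η + 1)).mul (tendsto_log_pow_div_nat 3)
  filter_upwards [eventually_one_le_mul_probLe hp0 hp1 hlb2 hη hη1,
    tendsto_log_nat.eventually_ge_atTop 2, tendsto_log_nat.eventually_ge_atTop (3 / ξ),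
    eventually_gt_atTop 0,
    hτL.eventually_le_const (show 0 < ξ / 3 by positivity),
    (tendsto_log_pow_div_rpow 2 hc0).eventually_le_const (show 0 < ξ / 3 by positivity),
    (tendsto_log_pow_div_rpow 1 (show 0 < 1 - 3 * c by linarith)).eventually_le_const
      (show (0:ℝ) < 1 / 8 by norm_num),
    (tendsto_log_pow_div_rpow 0 (show 0 < 1 / 2 - 3 * c by linarith)).eventually_le_const
      (show (0:ℝ) < 1 / 8 by norm_num),
    (tendsto_log_pow_div_rpow 0 hc0).eventually_le_const (show (0:ℝ) < 1 / 8 by norm_num)]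
    with n hone hL2 hLξ hn hτ hlogc hlog1 hhalf hcc s hs
  have hn' : (0:ℝ) < n := by exact_mod_cast hn
  obtain ⟨a, ha, hPa⟩ := hone
  set L := log (n:ℝ) with hLd
  have hL0 : 0 < L := by linarith
  set τ := tau0 b n + -η with hτd
  by_contra! hlt
  have hrp : ∀ x y : ℝ, (n:ℝ) ^ (x + y) = (n:ℝ) ^ x * (n:ℝ) ^ y := fun x y => rpow_add hn' x y
  have hnc : 0 < (n:ℝ) ^ c := by positivity
  have haw : a + (n:ℝ) ^ (1 - c) ≤ s := by
    have h1 : n / L ^ 3 ≤ ξ / 3 * (n / L ^ 2) := by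
      have h2 : 1 ≤ ξ / 3 * L := by rw [div_le_iff₀ hξ] at hLξ; linarith
      calc n / L ^ 3 = 1 * (n / L ^ 3) := by ring
        _ ≤ (ξ / 3 * L) * (n / L ^ 3) := by gcongr
        _ = _ := by field_simp
    have h2 : τ + 1 ≤ ξ / 3 * (n / L ^ 2) := by
      have h3 := mul_le_mul_of_nonneg_right hτ (show 0 ≤ n / L ^ 2 by positivity)
      refine le_trans (le_of_eq ?_) h3
      rw [hτd]; field_simp; ring
    have h3 : (n:ℝ) ^ (1 - c) ≤ ξ / 3 * (n / L ^ 2) := by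
      have h4 := mul_le_mul_of_nonneg_right hlogc (show 0 ≤ n / L ^ 2 by positivity)
      refine le_trans (le_of_eq ?_) h4
      rw [sub_eq_add_neg, hrp, rpow_one, rpow_neg hn'.le]
      field_simp
    linarith
  have hP1 := hs.trans (probGe_anti hp0.le hp1.le n haw)
  have hl0 : 0 ≤ (n:ℝ) ^ (-(2 * c)) := by positivity
  have hl1 : (n:ℝ) ^ (-(2 * c)) ≤ 1 :=
    rpow_le_one_of_one_le_of_nonpos (by exact_mod_cast hn) (by linarith)
  have hprod := probLe_mul_probGe_le hp0.le hp1.le n hl0 hl1 a ((n:ℝ) ^ (1 - c))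
  have e1 : 2 * ((n:ℝ) ^ (-(2 * c))) ^ 2 * n = 2 * (n:ℝ) ^ (1 - 4 * c) := by
    have : (n:ℝ) ^ (1 - 4 * c) = (n:ℝ) ^ (-(2 * c)) * (n:ℝ) ^ (-(2 * c)) * (n:ℝ) ^ (1:ℝ) := by
      rw [← hrp, ← hrp]; ring_nf
    rw [this, rpow_one]; ring
  have e2 : (n:ℝ) ^ (-(2 * c)) * (n:ℝ) ^ (1 - c) = (n:ℝ) ^ (1 - 3 * c) := by
    rw [← hrp]; ring_nf
  rw [e1, e2] at hprod
  set M := (n:ℝ) ^ (1 - 3 * c) with hM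
  have hM0 : 0 < M := by positivity
  have f1 : L ≤ M / 8 := by
    rw [pow_one, div_le_iff₀ hM0] at hlog1; linarith
  have f2 : (n:ℝ) ^ (1 / 2 : ℝ) ≤ M / 8 := by
    have : M = (n:ℝ) ^ (1 / 2 : ℝ) * (n:ℝ) ^ (1 / 2 - 3 * c) := by rw [hM, ← hrp]; ring_nf
    rw [pow_zero, div_le_iff₀ (by positivity)] at hhalf
    rw [this]
    have h1 := mul_le_mul_of_nonneg_left hhalf (show 0 ≤ (n:ℝ) ^ (1 / 2 : ℝ) by positivity)
    linarith
  have f3 : (n:ℝ) ^ (1 - 4 * c) ≤ M / 8 := by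
    have : M = (n:ℝ) ^ (1 - 4 * c) * (n:ℝ) ^ c := by rw [hM, ← hrp]; ring_nf
    rw [pow_zero, div_le_iff₀ hnc] at hcc
    rw [this]
    have h1 := mul_le_mul_of_nonneg_left hcc (show 0 ≤ (n:ℝ) ^ (1 - 4 * c) by positivity)
    linarith
  rw [show 1 - η / 2 = 1 - 4 * c by rw [hc]; ring] at hPa
  have hP0 : 0 ≤ probLe p n a := by
    by_contra! h
    linarith [mul_nonpos_of_nonneg_of_nonpos
      (exp_pos (1 + L + (n:ℝ) ^ (1 / 2 : ℝ) + (n:ℝ) ^ (1 - 4 * c))).le h.le]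
  set E := 1 + L + (n:ℝ) ^ (1 / 2 : ℝ) + (n:ℝ) ^ (1 - 4 * c) with hE
  have g1 : (0.9:ℝ) ≤ exp E * probLe p n a * probGe p n (a + (n:ℝ) ^ (1 - c)) := by
    calc (0.9:ℝ) ≤ 1 * probGe p n (a + (n:ℝ) ^ (1 - c)) := by linarith
      _ ≤ _ := mul_le_mul_of_nonneg_right hPa (by norm_num at hP1; linarith)
  have g2 : exp E * probLe p n a * probGe p n (a + (n:ℝ) ^ (1 - c)) ≤ exp (-1) := by
    rw [mul_assoc]
    calc exp E * (probLe p n a * probGe p n (a + (n:ℝ) ^ (1 - c)))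
        ≤ exp E * exp (2 * (n:ℝ) ^ (1 - 4 * c) - M) := by gcongr
      _ = exp (E + (2 * (n:ℝ) ^ (1 - 4 * c) - M)) := (exp_add _ _).symm
      _ ≤ exp (-1) := by rw [exp_le_exp, hE]; linarith
  have g3 := Real.exp_neg_one_lt_d9
  norm_num at g1 g3
  linarith

end UpperBound

section Window

lemma alphaNat_eq_of_mem {b x : ℝ} {α : ℕ} (h₀ : (α:ℝ) ≤ alpha0 b x)
    (h₁ : alpha0 b x < α + 1) : alphaNat b x = α := by
  have : ⌊alpha0 b x⌋ = (α:ℤ) := Int.floor_eq_iff.2 ⟨by exact_mod_cast h₀, by exact_mod_cast h₁⟩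
  rw [alphaNat, this, Int.toNat_natCast]

lemma alphaNat_le_and_lt {b x : ℝ} (h : 0 ≤ alpha0 b x) :
    (alphaNat b x : ℝ) ≤ alpha0 b x ∧ alpha0 b x < alphaNat b x + 1 := by
  have h1 : ((alphaNat b x : ℕ) : ℤ) = ⌊alpha0 b x⌋ := Int.toNat_of_nonneg (Int.floor_nonneg.2 h)
  have h2 : (alphaNat b x : ℝ) = (⌊alpha0 b x⌋ : ℝ) := by exact_mod_cast h1
  rw [h2]
  exact ⟨Int.floor_le _, Int.lt_floor_add_one _⟩

lemma half_le_log_one_add {σ : ℝ} (h0 : 0 < σ) (h1 : σ ≤ 1) : σ / 2 ≤ log (1 + σ) := by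
  have h := one_sub_inv_le_log_of_pos (show 0 < 1 + σ by linarith)
  refine le_trans ?_ h
  have : 1 - (1 + σ)⁻¹ = σ / (1 + σ) := by field_simp; ring
  rw [this]
  apply div_le_div_of_nonneg_left h0.le (by linarith) (by linarith)

/-- Slightly above `n`, the independence number is still `α(n)`, and the expected number of
independent sets of this size lies between `1` and the number of vertices. -/
lemma eventually_window {p ε σ : ℝ} (hp0 : 0 < p) (hp1 : p < 1)
    (hlb2 : log (1 / (1 - p)) ≤ 2) (hε : 0 < ε) (hσ : 0 < σ) (hσ1 : σ ≤ 1 / 10)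
    (hσε : 100 * (2 / log (1 / (1 - p)) * σ) ≤ ε) :
    ∀ᶠ n : ℕ in atTop, muAlpha p n < (n : ℝ) ^ (1 - ε) →
      ∀ m : ℕ, (1 + σ) * n ≤ m → (m:ℝ) ≤ (1 + 3 * σ) * n →
        alphaNat (1 / (1 - p)) m = alphaNat (1 / (1 - p)) n ∧
        1 ≤ muAlpha p m ∧ muAlpha p m ≤ m ∧
        alphaNat (1 / (1 - p)) m ≤ alpha0 (1 / (1 - p)) m ∧
        alpha0 (1 / (1 - p)) m - 1 + 0.92 * ε ≤ alphaNat (1 / (1 - p)) m := by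
  have hq : 0 < 1 - p := by linarith
  set b := 1 / (1 - p) with hbd
  have hb : 1 < b := by rw [hbd, lt_div_iff₀ hq]; linarith
  have hlb := log_pos hb
  have ha1 : 1 ≤ 2 / log b := by rw [le_div_iff₀ hlb]; linarith
  obtain ⟨ξ, hξ0, hξε, hξσ⟩ : ∃ ξ : ℝ, 0 < ξ ∧ ξ ≤ ε / 100 ∧ ξ ≤ σ / 8 :=
    ⟨min (ε / 100) (σ / 8), by positivity, min_le_left _ _, min_le_right _ _⟩
  have hα0 : ∀ᶠ n : ℕ in atTop, 0 ≤ alpha0 b n := by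
    filter_upwards [(tendsto_tau0_add hb (1 + 2 / log b)).eventually_ge_atTop 0] with n hn
    rw [tau0] at hn
    linarith
  filter_upwards [hα0, tendsto_log_nat.eventually_ge_atTop 2, eventually_gt_atTop 1,
    eventually_forall_ge_atTop.2 (eventually_log_muNat hp0 hp1 1 hξ0)]
    with n h0 hL hn hmu hμ m hm1 hm2
  have hn' : (1:ℝ) < n := by exact_mod_cast hn
  have hn0 : (0:ℝ) < n := by linarith
  set α := alphaNat b n with hα
  obtain ⟨hα1, hα2⟩ := alphaNat_le_and_lt h0
  rw [← hα] at hα1 hα2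
  have hnear : |(α:ℝ) - alpha0 b n| ≤ 1 := by rw [abs_le]; constructor <;> linarith
  obtain ⟨hαn, hμn⟩ := hmu n le_rfl α hnear
  have hμn1 := (abs_le.1 hμn).1
  have hpos := muNat_pos hq (show α ≤ n by omega)
  have hlogμ : log (muNat n α (1 - p)) < (1 - ε) * log n := by
    rw [← log_rpow hn0]
    exact log_lt_log hpos hμ
  have hx : alpha0 b n - α < 1 - ε + ξ := by
    have h1 : (alpha0 b n - α) * log n < (1 - ε + ξ) * log n := by linarith
    exact lt_of_mul_lt_mul_right h1 (by linarith)
  have hnm : (n:ℝ) ≤ m := by nlinarith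
  have hnm' : n ≤ m := by exact_mod_cast hnm
  have hm0 : (0:ℝ) < m := by linarith
  have hratio : (m:ℝ) / n ≤ 1 + 3 * σ := by rw [div_le_iff₀ hn0]; linarith
  have hratio' : 1 + σ ≤ (m:ℝ) / n := by rw [le_div_iff₀ hn0]; linarith
  have hlogr : log ((m:ℝ) / n) ≤ 3 * σ := by
    have := log_le_sub_one_of_pos (show 0 < (m:ℝ) / n by positivity)
    linarith
  have hlogr' : σ / 2 ≤ log ((m:ℝ) / n) :=
    (half_le_log_one_add hσ (by linarith)).trans (log_le_log (by linarith) hratio')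
  have hup : alpha0 b m - alpha0 b n ≤ 0.03 * ε := by
    refine (alpha0_sub_alpha0_le hb hn' hnm).trans ?_
    have : 2 / log b * log ((m:ℝ) / n) ≤ 2 / log b * (3 * σ) := by gcongr
    norm_num
    linarith
  have hlow : σ / 4 ≤ alpha0 b m - alpha0 b n := by
    refine le_trans ?_ (le_alpha0_sub_alpha0 hb hn' hnm)
    have h1 : log ((m:ℝ) / n) / log n ≤ log ((m:ℝ) / n) / 2 := by
      apply div_le_div_of_nonneg_left (by linarith) (by norm_num) hL
    have h2 : σ / 4 ≤ log ((m:ℝ) / n) - log ((m:ℝ) / n) / log n := by linarith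
    exact h2.trans (le_mul_of_one_le_left (by linarith) ha1)
  norm_num at hup
  have hαm : alphaNat b m = α := alphaNat_eq_of_mem (by linarith) (by linarith)
  have hlm : 0 < log (m:ℝ) := log_pos (by linarith)
  obtain ⟨hαm2, hμm⟩ := hmu m hnm' α (by rw [abs_le]; constructor <;> linarith)
  obtain ⟨hμm1, hμm2⟩ := abs_le.1 hμm
  have hposm := muNat_pos hq (show α ≤ m by omega)
  rw [muAlpha, ← hbd, hαm]
  refine ⟨rfl, ?_, ?_, by linarith, by norm_num; linarith⟩
  · rw [← log_nonneg_iff hposm]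
    have : 0 ≤ (alpha0 b m - α - ξ) * log m := mul_nonneg (by linarith) hlm.le
    linarith
  · rw [← log_le_log_iff hposm hm0]
    have : (alpha0 b m - α + ξ) * log m ≤ 1 * log m :=
      mul_le_mul_of_nonneg_right (by linarith) hlm.le
    linarith

lemma exists_chain {P : ℕ → Prop} {N H : ℕ}
    (step : ∀ m, m < N → P m → ∃ m', m < m' ∧ m' ≤ m + H ∧ P m') {m : ℕ} (hm : m ≤ N)
    (h : P m) : ∃ m', N ≤ m' ∧ m' ≤ N + H ∧ P m' := by
  induction hd : N - m using Nat.strong_induction_on generalizing m with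
  | _ d ih =>
    rcases hm.eq_or_lt with rfl | hlt
    · exact ⟨m, le_rfl, by omega, h⟩
    obtain ⟨m', h1, h2, h3⟩ := step m hlt h
    rcases le_or_gt m' N with h4 | h4
    · exact ih (N - m') (by omega) h4 h3 rfl
    · exact ⟨m', h4.le, by omega, h3⟩

/-- Comparison of the average and the marginal number of colours per vertex. -/
lemma increment_le {T a g d m η ε R : ℝ} (hη : 0 < η) (hTη : 2 * η ≤ T) (ha : 0 ≤ a)
    (hg : 0 ≤ g) (hd : 0 ≤ d) (hm : 0 < m)
    (h : (m + d) / (T + a * d / m + η) ≤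
      m / (T - η) + R + d * (1 / (T + g) + ε / (2 * T ^ 2))) :
    d * (g - a - ε / 2 - g ^ 2 / T) ≤ a * d ^ 2 / m + (3 * m + d) * η + R * T ^ 2 := by
  have hT : 0 < T := by linarith
  set k := a * d / m + η with hk
  have hk0 : 0 < k := by positivity
  have h1 : (m + d) * (1 / T - k / T ^ 2) ≤ (m + d) / (T + a * d / m + η) := by
    rw [add_assoc, ← hk, div_eq_mul_one_div (m + d)]
    gcongr
    rw [le_div_iff₀ (by linarith)]
    have : (1 / T - k / T ^ 2) * (T + k) = 1 - (k / T) ^ 2 := by field_simp; ring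
    rw [this]
    linarith [sq_nonneg (k / T)]
  have h2 : m / (T - η) ≤ m * (1 / T + 2 * η / T ^ 2) := by
    rw [div_eq_mul_one_div m]
    gcongr
    rw [div_le_iff₀ (by linarith)]
    have : (1 / T + 2 * η / T ^ 2) * (T - η) = 1 + η * (T - 2 * η) / T ^ 2 := by field_simp; ring
    rw [this]
    have : 0 ≤ η * (T - 2 * η) / T ^ 2 :=
      div_nonneg (mul_nonneg hη.le (by linarith)) (by positivity)
    linarith
  have h3 : 1 / (T + g) ≤ 1 / T - g / T ^ 2 + g ^ 2 / T ^ 3 := by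
    rw [div_le_iff₀ (by linarith)]
    have : (1 / T - g / T ^ 2 + g ^ 2 / T ^ 3) * (T + g) = 1 + (g / T) ^ 3 := by
      field_simp; ring
    rw [this]
    have : 0 ≤ (g / T) ^ 3 := by positivity
    linarith
  have h4 : d * (1 / (T + g) + ε / (2 * T ^ 2)) ≤
      d * (1 / T - g / T ^ 2 + g ^ 2 / T ^ 3 + ε / (2 * T ^ 2)) := by gcongr
  have h5 : (m + d) * (1 / T - k / T ^ 2) ≤ m * (1 / T + 2 * η / T ^ 2) + R +
      d * (1 / T - g / T ^ 2 + g ^ 2 / T ^ 3 + ε / (2 * T ^ 2)) := by linarith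
  have h6 := mul_le_mul_of_nonneg_right h5 (sq_nonneg T)
  have e1 : (m + d) * (1 / T - k / T ^ 2) * T ^ 2 = (m + d) * T - (m + d) * k := by
    field_simp
  have e2 : (m * (1 / T + 2 * η / T ^ 2) + R +
      d * (1 / T - g / T ^ 2 + g ^ 2 / T ^ 3 + ε / (2 * T ^ 2))) * T ^ 2 =
      m * T + 2 * η * m + R * T ^ 2 + d * T - d * (g - ε / 2 - g ^ 2 / T) := by
    field_simp; ring
  rw [e1, e2] at h6
  have e3 : (m + d) * k = a * d + a * d ^ 2 / m + (m + d) * η := by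
    rw [hk]; field_simp
  rw [e3] at h6
  linarith

end Window

section Nonconcentration

/-- If the interval at `m` is short, then a larger number `m'` of vertices needs at most about
`(m' - m) / α` additional colours. -/
lemma exists_marginal_step {μ ε l L : ℝ} {α m H : ℕ} {s t : ℕ → ℝ} (hε : 0 < ε) (hα : 0 < α)
    (hμ1 : 1 ≤ μ) (hμm : μ ≤ m) (hL : 0 < L) (hl : 0 < l) (hαL : 4 * l * α ≤ 9 * L)
    (hH : √m * α ≤ H) (hHm : H ≤ m)
    (hc : ∀ r : ℕ, (r:ℝ) ^ 2 ≤ μ → r * α ≤ m → s (m + r * α) ≤ t m + r)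
    (hgap : t m - s m ≤ ε * l / 9 * √μ / L) :
    ∃ m', m < m' ∧ m' ≤ m + H ∧
      s m' - (1 + ε / (2 * α)) / α * m' ≤ s m - (1 + ε / (2 * α)) / α * m := by
  have hα' : (0:ℝ) < α := by exact_mod_cast hα
  have hμ0 : 0 ≤ √μ := sqrt_nonneg _
  have hsq1 : 1 ≤ √μ := one_le_sqrt.2 hμ1
  set r := ⌊√μ⌋₊ with hr
  have hr1 : 1 ≤ r := Nat.le_floor (by exact_mod_cast hsq1)
  have hr1' : (1:ℝ) ≤ r := by exact_mod_cast hr1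
  have hrle : (r:ℝ) ≤ √μ := Nat.floor_le hμ0
  have hrge : √μ ≤ 2 * r := by linarith [Nat.lt_floor_add_one (√μ)]
  have hrα : r * α ≤ H := by
    have : (r:ℝ) * α ≤ H :=
      le_trans (mul_le_mul_of_nonneg_right (hrle.trans (sqrt_le_sqrt hμm)) hα'.le) hH
    exact_mod_cast this
  have h1 := hc r ((pow_le_pow_left₀ (by positivity) hrle 2).trans_eq (sq_sqrt (by linarith)))
    (hrα.trans hHm)
  refine ⟨m + r * α, by have := Nat.mul_pos hr1 hα; omega, by omega, ?_⟩
  have h2 : ε * l / 9 * √μ / L ≤ r * (ε / (2 * α)) := by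
    rw [div_le_iff₀ hL]
    have h3 : ε * l / 9 * √μ ≤ ε * l / 9 * (2 * r) := by gcongr
    refine h3.trans ?_
    have h4 : r * (ε / (2 * α)) * L = ε * r / (18 * α) * (9 * L) := by field_simp; ring
    have h5 : ε * l / 9 * (2 * r) = ε * r / (18 * α) * (4 * l * α) := by field_simp; ring
    rw [h4, h5]
    gcongr
  push_cast
  have h6 : (1 + ε / (2 * α)) / α * ((m:ℝ) + r * α) =
      (1 + ε / (2 * α)) / α * m + r + r * (ε / (2 * α)) := by field_simp; ring
  rw [h6]
  linarith

lemma marginal_cost_le {T g ε α : ℝ} (hT : 0 < T) (hg : 0 ≤ g) (hε : 0 < ε) (hα : T + g ≤ α) :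
    (1 + ε / (2 * α)) / α ≤ 1 / (T + g) + ε / (2 * T ^ 2) := by
  have h0 : 0 < α := by linarith
  have h1 : (1 + ε / (2 * α)) / α = 1 / α + ε / (2 * α ^ 2) := by field_simp
  rw [h1]
  have : T ≤ α := by linarith
  gcongr

lemma increment_absurd {T a g d m n η ε σ R : ℝ} (hn : 0 < n) (hη : 0 < η) (hTη : 2 * η ≤ T)
    (ha : 0 ≤ a) (hε : 0 < ε) (hσ : 0 < σ) (hσε : 100 * (a * σ) ≤ ε)
    (hgd : g = a + 0.92 * ε) (hgT : g ^ 2 ≤ 0.01 * ε * T) (hηε : η ≤ ε * σ / 100)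
    (hnm : n ≤ m) (hm : m + d ≤ 1.3 * n) (hd1 : σ * n / 2 ≤ d) (hd2 : d ≤ 2 * σ * n)
    (hR : R * T ^ 2 ≤ 0.04 * (ε * σ * n))
    (h : (m + d) / (T + a * d / m + η) ≤
      m / (T - η) + R + d * (1 / (T + g) + ε / (2 * T ^ 2))) : False := by
  have hT : 0 < T := by linarith
  have hm0 : 0 < m := by linarith
  have hd0 : 0 < d := lt_of_lt_of_le (by positivity) hd1
  have hg : 0 ≤ g := by rw [hgd]; positivity
  have h1 := increment_le hη hTη ha hg hd0.le hm0 h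
  have h2 : g ^ 2 / T ≤ 0.01 * ε := by rwa [div_le_iff₀ hT]
  have h3 : a * d ^ 2 / m ≤ 0.02 * ε * d := by
    rw [div_le_iff₀ hm0]
    have e1 : a * d ^ 2 ≤ a * d * (2 * σ * m) := by
      rw [sq, ← mul_assoc]
      refine mul_le_mul_of_nonneg_left (hd2.trans ?_) (by positivity)
      gcongr
    have e2 : a * d * (2 * σ * m) = 0.02 * (100 * (a * σ)) * (d * m) := by ring
    have e3 : 0.02 * (100 * (a * σ)) * (d * m) ≤ 0.02 * ε * (d * m) := by gcongr
    rw [e2] at e1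
    linarith
  have h4 : (3 * m + d) * η ≤ 0.05 * (ε * σ * n) := by
    have e1 : (3 * m + d) * η ≤ (5 * n) * (ε * σ / 100) := by
      gcongr
      linarith
    linarith
  have h5 : d * (0.41 * ε) ≤ d * (g - a - ε / 2 - g ^ 2 / T) := by
    refine mul_le_mul_of_nonneg_left ?_ hd0.le
    rw [hgd] at h2 ⊢
    norm_num at h2 ⊢
    linarith
  have h6 : ε * (σ * n / 2) ≤ ε * d := by gcongr
  have h7 : 0 < ε * σ * n := by positivity
  norm_num at h3 h4 h5 hR
  linarith

end Nonconcentration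

end Auxiliary

section Nonconcentration

set_option maxHeartbeats 1000000 in
/-- Nonconcentration near `n`, in terms of the two tail bounds for the chromatic number. -/
theorem exists_wide_interval_near {p ε δ : ℝ} {s t : ℕ → ℝ} (hp0 : 0 < p) (hp1 : p < 1)
    (hlb2 : log (1 / (1 - p)) ≤ 2) (hε : 0 < ε) (hδ : 0 < δ)
    (hge : ∀ n, 0.9 ≤ probGe p n (s n)) (hle : ∀ n, 0.9 ≤ probLe p n (t n)) :
    ∃ n₀ : ℕ, ∀ n : ℕ, n₀ ≤ n → muAlpha p n < (n : ℝ) ^ (1 - ε) →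
      ∃ m : ℕ, |(m : ℝ) / n - 1| ≤ δ ∧
        ε * log (1 / (1 - p)) / 9 * √(muAlpha p m) / log m < t m - s m := by
  have hq : 0 < 1 - p := by linarith
  set b := 1 / (1 - p) with hbd
  have hb : 1 < b := by rw [hbd, lt_div_iff₀ hq]; linarith
  have hlb := log_pos hb
  set a := 2 / log b with had
  have ha1 : 1 ≤ a := by rw [had, le_div_iff₀ hlb]; linarith
  obtain ⟨σ, hσ, hσδ, hσ1, hσε⟩ : ∃ σ : ℝ, 0 < σ ∧ 3 * σ ≤ δ ∧ σ ≤ 1 / 10 ∧ 100 * (a * σ) ≤ ε := by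
    refine ⟨min (δ / 3) (min (1 / 10) (ε / (100 * a))), by positivity, ?_, ?_, ?_⟩
    · linarith [min_le_left (δ / 3) (min (1 / 10) (ε / (100 * a)))]
    · exact (min_le_right _ _).trans (min_le_left _ _)
    · have h1 : min (δ / 3) (min (1 / 10) (ε / (100 * a))) ≤ ε / (100 * a) :=
        (min_le_right _ _).trans (min_le_right _ _)
      rw [le_div_iff₀ (by positivity)] at h1
      linarith
  obtain ⟨η, hη, hη1, hηε⟩ : ∃ η : ℝ, 0 < η ∧ η ≤ 1 ∧ η ≤ ε * σ / 100 :=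
    ⟨min 1 (ε * σ / 100), by positivity, min_le_left _ _, min_le_right _ _⟩
  set κ := ε * σ / (100 * (a + 1) ^ 2) with hκd
  have hκ : 0 < κ := by positivity
  set g := a + 0.92 * ε with hgd
  set C := ε * log b / 9 with hCd
  have hC : 0 < C := by positivity
  have evL := tendsto_log_nat.eventually_ge_atTop 1
  have evT := (tendsto_tau0_add hb 0).eventually_ge_atTop (2 * η + g ^ 2 / (0.01 * ε))
  have evTL := (tendsto_tau0_add_div_log hb 0).eventually_le_const
    (show 2 / log b < a + 1 by linarith)
  have evS := (tendsto_log_pow_div_rpow 2 (show (0:ℝ) < 1 / 2 by norm_num)).eventually_le_const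
    (show 0 < κ / C by positivity)
  have evA := (tendsto_log_pow_div_rpow 1 (show (0:ℝ) < 1 / 2 by norm_num)).eventually_le_const
    (show 0 < σ * log b / 18 by positivity)
  have evN := eventually_near_alpha0 hb 1 (show 0 < 1 / (4 * log b) by positivity)
  have ev := eventually_forall_ge_atTop.2 (evL.and (evT.and (evTL.and (evS.and (evA.and (evN.and
    ((eventually_coupling hp0 hp1 1).and ((eventually_lower_bound hp0 hp1 hη).and
      (eventually_upper_bound hp0 hp1 hlb2 hη hη1 hκ)))))))))
  obtain ⟨n₀, hn₀⟩ := eventually_atTop.1 (ev.and ((eventually_window hp0 hp1 hlb2 hε hσ hσ1 hσε).and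
    ((tendsto_natCast_atTop_atTop (R := ℝ)).eventually_ge_atTop (max 10 (4 / σ)))))
  refine ⟨n₀, fun n hn hμ => ?_⟩
  obtain ⟨hbig, hwin, hnlarge⟩ := hn₀ n hn
  clear hn₀ ev evL evT evTL evS evA evN
  replace hwin := hwin hμ
  have hn10 : (10:ℝ) ≤ n := (le_max_left _ _).trans hnlarge
  have hnσ : 4 ≤ σ * n := by
    have := (le_max_right _ _).trans hnlarge
    rw [div_le_iff₀ hσ] at this
    linarith
  have hn0 : (0:ℝ) < n := by linarith
  have hσn : σ * n ≤ 1 / 10 * n := by gcongr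
  by_contra! hcon
  have hgap : ∀ m : ℕ, (1 + σ) * n ≤ m → (m:ℝ) ≤ (1 + 3 * σ) * n →
      t m - s m ≤ C * √(muAlpha p m) / log m := by
    intro m h1 h2
    refine hcon m (le_trans ?_ hσδ)
    have h3 : (m:ℝ) / n ≤ 1 + 3 * σ := by rwa [div_le_iff₀ hn0]
    have h4 : 1 + σ ≤ (m:ℝ) / n := by rwa [le_div_iff₀ hn0]
    rw [abs_le]; constructor <;> linarith
  clear hcon
  set n1 := ⌈(1 + σ) * n⌉₊ with hn1
  set N := ⌈(1 + 2 * σ) * n⌉₊ with hN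
  set H := ⌊σ * n / 2⌋₊ with hH
  have hn1l : (1 + σ) * n ≤ n1 := Nat.le_ceil _
  have hn1u : (n1:ℝ) < (1 + σ) * n + 1 := Nat.ceil_lt_add_one (by positivity)
  have hNl : (1 + 2 * σ) * n ≤ N := Nat.le_ceil _
  have hNu : (N:ℝ) < (1 + 2 * σ) * n + 1 := Nat.ceil_lt_add_one (by positivity)
  have hHu : (H:ℝ) ≤ σ * n / 2 := Nat.floor_le (by positivity)
  have hHl : σ * n / 4 ≤ H := by linarith [Nat.lt_floor_add_one (σ * n / 2)]
  have hNH : (N:ℝ) + H ≤ (1 + 3 * σ) * n := by linarith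
  have hnn1' : (n:ℝ) ≤ n1 := by linarith [mul_pos hσ hn0]
  have hnn1 : n ≤ n1 := by exact_mod_cast hnn1'
  have hn1N : n1 ≤ N := by
    refine Nat.ceil_mono ?_
    linarith [mul_pos hσ hn0]
  have hwin1 := hwin n1 hn1l (by linarith)
  set α := alphaNat b n with hαd
  obtain ⟨hL1, hT1, hTL1, -, -, hN1, -, -, hub⟩ := hbig n1 hnn1
  rw [add_zero] at hT1 hTL1
  obtain ⟨hα1, -, -, hα2, hα3⟩ := hwin1
  rw [hα1] at hα2 hα3
  set T := tau0 b n1 with hTd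
  have hTα : T + g ≤ α := by
    rw [hTd, tau0, ← had, hgd]
    linarith
  have hg0 : 0 < g := by positivity
  have hTη : 2 * η ≤ T := le_trans (by linarith [show 0 ≤ g ^ 2 / (0.01 * ε) by positivity]) hT1
  have hT0 : 0 < T := by linarith
  have hα0 : 0 < α := by
    have : (0:ℝ) < α := by linarith
    exact_mod_cast this
  have hαl : (α:ℝ) ≤ 9 / (4 * log b) * log n1 := by
    refine (hN1 α (by rw [abs_le]; constructor <;> linarith)).2.trans_eq ?_
    field_simp
    ring
  have hαL : ∀ m : ℕ, n1 ≤ m → 4 * log b * α ≤ 9 * log m := by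
    intro m hm
    have h1 : log (n1:ℝ) ≤ log m := log_le_log (by linarith) (by exact_mod_cast hm)
    have h2 : 4 * log b * α ≤ 4 * log b * (9 / (4 * log b) * log n1) := by gcongr
    have h3 : 4 * log b * (9 / (4 * log b) * log n1) = 9 * log n1 := by field_simp
    linarith
  obtain ⟨n2, hn2l, hn2u, hn12, hchain⟩ := exists_chain (N := N) (H := H) (m := n1)
    (P := fun m => n1 ≤ m ∧ s m - (1 + ε / (2 * α)) / α * m ≤
      s n1 - (1 + ε / (2 * α)) / α * n1) (by
    rintro m hmN ⟨hm1, hm2⟩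
    have hmN' : (m:ℝ) ≤ N := by exact_mod_cast hmN.le
    have hm1' : (n1:ℝ) ≤ m := by exact_mod_cast hm1
    have hm0 : (0:ℝ) < m := by linarith
    obtain ⟨hwα, hw1, hw2, hw3, hw4⟩ := hwin m (hn1l.trans hm1') (by linarith)
    obtain ⟨hmL, -, -, -, hmA, -, hmc, -, -⟩ := hbig m (hnn1.trans hm1)
    have hgm := hgap m (hn1l.trans hm1') (by linarith)
    rw [hwα] at hw3 hw4
    have hμα : muNat m α (1 - p) = muAlpha p m := by rw [muAlpha, ← hbd, hwα]
    have hm2n : (m:ℝ) ≤ 2 * n := by linarith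
    obtain ⟨m', h1, h2, h3⟩ := exists_marginal_step (s := s) (t := t) (H := H) hε hα0 hw1 hw2
      (by linarith) hlb (hαL m hm1) (by
        rw [pow_one, ← sqrt_eq_rpow, div_le_iff₀ (sqrt_pos.2 hm0)] at hmA
        have e1 : √(m:ℝ) * α ≤ √m * (9 / (4 * log b) * log m) := by
          gcongr
          have := hαL m hm1
          rw [div_mul_eq_mul_div, le_div_iff₀ (by positivity)]
          linarith
        have e2 : √(m:ℝ) * (9 / (4 * log b) * log m) ≤
            √m * (9 / (4 * log b) * (σ * log b / 18 * √m)) := by gcongr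
        have e3 : √(m:ℝ) * (9 / (4 * log b) * (σ * log b / 18 * √m)) = σ / 8 * (√m * √m) := by
          field_simp
          ring
        rw [mul_self_sqrt hm0.le] at e3
        have e4 : σ / 8 * m ≤ σ / 8 * (2 * n) := by gcongr
        linarith) (by
        have : (H:ℝ) ≤ m := by linarith
        exact_mod_cast this) (by
        intro r hr1 hr2
        refine hmc α r (by rw [abs_le]; constructor <;> linarith) (by rwa [hμα])
          (hr1.trans hw2) hr2 _ _
          (hge _) (hle _)) hgm
    exact ⟨m', h1, h2, by omega, h3.trans hm2⟩) hn1N ⟨le_rfl, le_rfl⟩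
  have hn2l' : (N:ℝ) ≤ n2 := by exact_mod_cast hn2l
  have hn2u' : (n2:ℝ) ≤ N + H := by exact_mod_cast hn2u
  have hn12' : (n1:ℝ) ≤ n2 := by exact_mod_cast hn12
  have hn20 : (0:ℝ) < n2 := by linarith
  have hn10' : (0:ℝ) < n1 := by linarith
  obtain ⟨-, hμ2, hμ2', -, -⟩ := hwin n2 (by linarith) (by linarith)
  obtain ⟨hL2, hT2, -, hS2, -, -, -, hlow, -⟩ := hbig n2 (hnn1.trans hn12)
  have hgap2 := hgap n2 (by linarith) (by linarith)
  have hlow := hlow _ (hle n2)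
  have hub := hub _ (hge n1)
  have hgap2' : t n2 - s n2 ≤ C * √n2 := by
    refine hgap2.trans ((div_le_self (by positivity) hL2).trans ?_)
    gcongr
  have hτ : tau0 b n2 ≤ T + a * (n2 - n1) / n1 := by
    have h1 := alpha0_sub_alpha0_le hb (show (1:ℝ) < n1 by linarith) hn12'
    have h2 := log_le_sub_one_of_pos (show 0 < (n2:ℝ) / n1 by positivity)
    have h3 : a * log ((n2:ℝ) / n1) ≤ a * ((n2:ℝ) / n1 - 1) := by gcongr
    have h4 : a * ((n2:ℝ) / n1 - 1) = a * (n2 - n1) / n1 := by field_simp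
    rw [hTd, tau0, tau0, ← had]
    linarith
  have hcost := marginal_cost_le hT0 hg0.le hε hTα
  have hmul := mul_le_mul_of_nonneg_left hcost (show (0:ℝ) ≤ n2 - n1 by linarith)
  have hτ0 : 0 < tau0 b n2 := by
    rw [add_zero] at hT2
    linarith [show 0 ≤ g ^ 2 / (0.01 * ε) by positivity]
  have hdiv : (n2:ℝ) / (T + a * (n2 - n1) / n1 + η) ≤ n2 / (tau0 b n2 + η) := by gcongr
  have hTlog : T ≤ (a + 1) * log n1 := by rwa [div_le_iff₀ (by linarith)] at hTL1
  refine increment_absurd (R := κ * (n1 / log n1 ^ 2) + C * √n2) (m := n1) (d := n2 - n1)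
    hn0 hη hTη (by linarith) hε hσ hσε hgd ?_ hηε
    hnn1' ?_ ?_ ?_ ?_ ?_
  · have : g ^ 2 / (0.01 * ε) ≤ T := by linarith
    rwa [div_le_iff₀' (by positivity)] at this
  · norm_num; linarith
  · linarith
  · linarith
  · have hlog0 : 0 < log (n1:ℝ) := by linarith
    have hlog12 : log (n1:ℝ) ≤ log n2 := log_le_log hn10' hn12'
    have hT2l : T ^ 2 ≤ (a + 1) ^ 2 * log n1 ^ 2 := by
      rw [← mul_pow]
      gcongr
    have hT2l' : T ^ 2 ≤ (a + 1) ^ 2 * log n2 ^ 2 := hT2l.trans (by gcongr)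
    rw [← sqrt_eq_rpow, div_le_div_iff₀ (sqrt_pos.2 hn20) hC] at hS2
    have e1 : κ * (n1 / log n1 ^ 2) * T ^ 2 ≤
        κ * (n1 / log n1 ^ 2) * ((a + 1) ^ 2 * log n1 ^ 2) := by gcongr
    have e2 : κ * (n1 / log n1 ^ 2) * ((a + 1) ^ 2 * log n1 ^ 2) = ε * σ / 100 * n1 := by
      rw [hκd]
      field_simp
    have e3 : C * √n2 * T ^ 2 ≤ C * √n2 * ((a + 1) ^ 2 * log n2 ^ 2) := by gcongr
    have e4 : C * √n2 * ((a + 1) ^ 2 * log n2 ^ 2) =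
        (a + 1) ^ 2 * √n2 * (log n2 ^ 2 * C) := by ring
    have e5 : (a + 1) ^ 2 * √n2 * (log n2 ^ 2 * C) ≤ (a + 1) ^ 2 * √n2 * (κ * √n2) := by gcongr
    have e6 : (a + 1) ^ 2 * √n2 * (κ * √n2) = (a + 1) ^ 2 * κ * (√n2 * √n2) := by ring
    have e7 : (a + 1) ^ 2 * κ = ε * σ / 100 := by
      rw [hκd]
      field_simp
    rw [mul_self_sqrt hn20.le, e7] at e6
    have e9 : ε * σ / 100 * n2 ≤ ε * σ / 100 * (1.3 * n) := by
      gcongr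
      norm_num; linarith
    have e10 : ε * σ / 100 * n1 ≤ ε * σ / 100 * n2 := by gcongr
    have e11 : 0 < ε * σ * n := by positivity
    norm_num at e9 ⊢
    linarith
  · rw [add_sub_cancel]
    rw [← sub_eq_add_neg] at hub
    linarith

end Nonconcentration

/-- Fix `0 < p ≤ 1 − 1/e²` and `ε > 0`, and let `[s n, t n]` be a sequence of
intervals with `P(χ(G_{n,p}) ∈ [s n, t n]) ≥ 0.9` for every `n`.  Then for every `δ > 0` there
is `n₀` such that for every `n ≥ n₀` with `μ_{α(n)}(n) < n^{1−ε}`, there is an integer `n*`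
with `|n*/n − 1| ≤ δ` and `t_{n*} − s_{n*} > C √(μ_{α(n*)}(n*)) / log n*`,
where `C = ε log b / 9` and `b = 1/(1-p)`. -/
theorem chromatic_nonconcentration_nstar (p ε : ℝ) (hp0 : 0 < p)
    (hp : p ≤ 1 - 1 / Real.exp 1 ^ 2) (hε : 0 < ε)
    (s t : ℕ → ℝ)
    (hconc : ∀ n : ℕ, 0.9 ≤ gnpProb n p {G | (chrom G : ℝ) ∈ Set.Icc (s n) (t n)}) :
    ∀ δ : ℝ, 0 < δ → ∃ n₀ : ℕ, ∀ n : ℕ, n₀ ≤ n →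
      muAlpha p n < (n : ℝ) ^ (1 - ε) →
      ∃ nstar : ℕ,
        |(nstar : ℝ) / (n : ℝ) - 1| ≤ δ ∧
        ε * Real.log (1 / (1 - p)) / 9 * Real.sqrt (muAlpha p nstar) / Real.log nstar
          < t nstar - s nstar := by
  intro δ hδ
  have hq' : 1 / Real.exp 1 ^ 2 ≤ 1 - p := by linarith
  have hq : 0 < 1 - p := lt_of_lt_of_le (by positivity) hq'
  have hp1 : p < 1 := by linarith
  have hlb2 : log (1 / (1 - p)) ≤ 2 := by
    rw [log_le_iff_le_exp (by positivity), div_le_iff₀ hq]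
    have h1 : exp 2 = exp 1 ^ 2 := by rw [← exp_nat_mul]; norm_num
    rw [h1]
    rwa [div_le_iff₀' (by positivity)] at hq'
  exact exists_wide_interval_near hp0 hp1 hlb2 hε hδ
    (fun n => (probGe_of_gnpProb hp0.le hp1.le (hconc n)).1)
    (fun n => (probGe_of_gnpProb hp0.le hp1.le (hconc n)).2)
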